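/- arXiv:1908.07106 — 3 statements merged into one kernel-verified Lean document; each statement's English description precedes it below -/
import Mathlib

section
/- For every d ≥ 1 there exist C > 0 and n₀ such that for all n ≥ n₀ and all integers N ≥ C·n⁴ the following holds. Let T_d be the set of (d+1)-tuples (x₁,…,x_d,x₀) of pairwise distinct points of (ℤ/nℤ)², let p_i = (i−1,0) for 1 ≤ i ≤ d and b = (n−1,n−1), and let ν_N(x₁,…,x_d,x₀) be the probability that after N steps of the n²−1 puzzle chain the state σ satisfies σ(p_i) = x_i for all 1 ≤ i ≤ d and σ(b) = x₀. Then the d₂ distance to uniformity satisfies ( |T_d| · Σ_{x∈T_d} (ν_N(x) − 1/|T_d|)² )^{1/2} ≤ 1/e; that is, the d₂ mixing time of d marked squares together with the empty square is O(n⁴). -/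
open Finset

/-- The label of the empty square: `(n−1, n−1)`. -/
def emptyLabel (n : ℕ) : ZMod n × ZMod n := (((n - 1 : ℕ) : ZMod n), ((n - 1 : ℕ) : ZMod n))

/-- The five displacements `{(0,0),(1,0),(−1,0),(0,1),(0,−1)}` of the empty square. -/
def displacements (n : ℕ) : Finset (ZMod n × ZMod n) :=
  {((0 : ZMod n), (0 : ZMod n)), (1, 0), (-1, 0), (0, 1), (0, -1)}

open Classical in
/-- One-step transition probability of the `n²−1` puzzle chain on `Sym((ℤ/nℤ)²)`:
from the arrangement `σ` a displacement `d` is chosen uniformly among the five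
possibilities and `σ` is replaced by `τ ∘ σ`, where `τ` is the transposition of the
positions `σ(b)` and `σ(b) + d` of the board (`b = (n−1,n−1)` the label of the empty
square). -/
noncomputable def puzzleStep (n : ℕ) (σ τ : Equiv.Perm (ZMod n × ZMod n)) : ℝ :=
  (1 / 5 : ℝ) * (((displacements n).filter
    (fun d => τ = Equiv.swap (σ (emptyLabel n)) (σ (emptyLabel n) + d) * σ)).card : ℝ)

/-- The distribution of the `n²−1` puzzle chain after `N` steps, started at the identity
arrangement. -/
noncomputable def puzzleDist (n : ℕ) [NeZero n] : ℕ → Equiv.Perm (ZMod n × ZMod n) → ℝ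
  | 0 => fun τ => if τ = 1 then 1 else 0
  | (N + 1) => fun τ => ∑ σ : Equiv.Perm (ZMod n × ZMod n), puzzleDist n N σ * puzzleStep n σ τ

/-- The labels tracked in the `d`-piece chain: the pieces `(0,0), (1,0), …, (d−1,0)`
followed by the empty square `(n−1,n−1)`. -/
def trackedLabels (n d : ℕ) (i : Fin (d + 1)) : ZMod n × ZMod n :=
  if (i : ℕ) < d then (((i : ℕ) : ZMod n), 0) else emptyLabel n

open Classical in
/-- The probability that after `N` steps of the `n²−1` puzzle chain the `d` marked pieces
`(0,0),…,(d−1,0)` occupy the positions `x 0, …, x (d−1)` and the empty square occupies the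
position `x d`. -/
noncomputable def markedDist (n d : ℕ) [NeZero n] (N : ℕ)
    (x : Fin (d + 1) → ZMod n × ZMod n) : ℝ :=
  ∑ σ : Equiv.Perm (ZMod n × ZMod n),
    if ∀ i, σ (trackedLabels n d i) = x i then puzzleDist n N σ else 0

open Finset in
/-- Configurations of `d` marked pieces and the empty square (the last entry). -/
abbrev Conf (n d : ℕ) := {x : Fin (d + 1) → ZMod n × ZMod n // Function.Injective x}

namespace Conf

variable {n d : ℕ}

/-- The position of the empty square. -/
def blank (x : Conf n d) : ZMod n × ZMod n := x.1 (Fin.last d)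

/-- The configuration after applying a permutation of the positions. -/
def permute (τ : Equiv.Perm (ZMod n × ZMod n)) (x : Conf n d) : Conf n d :=
  ⟨fun j => τ (x.1 j), τ.injective.comp x.2⟩

/-- Moving the empty square by the displacement `c`. -/
def move (c : ZMod n × ZMod n) : Equiv.Perm (Conf n d) where
  toFun x := permute (Equiv.swap x.blank (x.blank + c)) x
  invFun x := permute (Equiv.swap x.blank (x.blank + -c)) x
  left_inv x := by
    apply Subtype.ext
    funext j
    simp [permute, blank, Equiv.swap_comm]
  right_inv x := by
    apply Subtype.ext
    funext j
    simp [permute, blank, Equiv.swap_comm]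

theorem move_apply (c : ZMod n × ZMod n) (x : Conf n d) (j : Fin (d + 1)) :
    (move c x).1 j = Equiv.swap x.blank (x.blank + c) (x.1 j) := rfl

theorem blank_move (c : ZMod n × ZMod n) (x : Conf n d) :
    (move c x).blank = x.blank + c := by
  simp [blank, move_apply]

theorem move_inv (c : ZMod n × ZMod n) : (move c : Equiv.Perm (Conf n d))⁻¹ = move (-c) :=
  Equiv.ext fun _ => rfl

/-- Moving the empty square `k < n` times in a direction of order `n` pushes the pieces it meets
back by one. -/
theorem move_pow_apply (c : ZMod n × ZMod n) (hc : ∀ l : ℕ, 0 < l → l < n → l • c ≠ 0)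
    (x : Conf n d) (k : ℕ) (hk : k < n) :
    (((move c : Equiv.Perm (Conf n d)) ^ k) x).blank = x.blank + k • c ∧
    ∀ j, j ≠ Fin.last d →
      ((∃ l : ℕ, 1 ≤ l ∧ l ≤ k ∧ x.1 j = x.blank + l • c) ∧
        (((move c : Equiv.Perm (Conf n d)) ^ k) x).1 j = x.1 j - c) ∨
      ((∀ l : ℕ, 1 ≤ l → l ≤ k → x.1 j ≠ x.blank + l • c) ∧
        (((move c : Equiv.Perm (Conf n d)) ^ k) x).1 j = x.1 j) := by
  induction k with
  | zero =>
    refine ⟨by simp, fun j _ => Or.inr ⟨fun l h1 h2 => by omega, by simp⟩⟩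
  | succ k ih =>
    obtain ⟨ihb, iht⟩ := ih (by omega)
    have hs : ∀ y : Conf n d, ((move c : Equiv.Perm (Conf n d)) ^ (k + 1)) y =
        move c (((move c : Equiv.Perm (Conf n d)) ^ k) y) := by
      intro y
      rw [pow_succ']
      rfl
    rw [hs]
    refine ⟨by rw [blank_move, ihb, succ_nsmul, add_assoc], fun j hj => ?_⟩
    rw [move_apply, ihb]
    have key : ∀ a b : ℕ, a < b → b < a + n → x.blank + a • c ≠ x.blank + b • c := by
      intro a b hab hb h
      apply hc (b - a) (by omega) (by omega)
      have h2 : b • c = a • c + (b - a) • c := by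
        rw [← add_nsmul]
        congr 1
        omega
      rw [h2] at h
      have := add_left_cancel h
      exact (left_eq_add.mp this)
    have hsum : x.blank + k • c + c = x.blank + (k + 1) • c := by
      rw [succ_nsmul, add_assoc]
    rw [hsum]
    rcases iht j hj with ⟨⟨l, h1, h2, h3⟩, h4⟩ | ⟨h3, h4⟩
    · left
      refine ⟨⟨l, h1, by omega, h3⟩, ?_⟩
      have h5 : x.1 j - c = x.blank + (l - 1) • c := by
        rw [h3]
        obtain ⟨m, rfl⟩ : ∃ m, l = m + 1 := ⟨l - 1, by omega⟩
        rw [succ_nsmul]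
        simp [add_sub_assoc]
      rw [h4, h5]
      apply Equiv.swap_apply_of_ne_of_ne
      · exact key _ _ (by omega) (by omega)
      · exact key _ _ (by omega) (by omega)
    · by_cases h5 : x.1 j = x.blank + (k + 1) • c
      · left
        refine ⟨⟨k + 1, by omega, le_rfl, h5⟩, ?_⟩
        rw [h4, h5, Equiv.swap_apply_right, ← hsum]
        simp
      · right
        constructor
        · intro l h1 h2
          rcases Nat.lt_or_ge k l with h | h
          · have : l = k + 1 := by omega
            rw [this]
            exact h5
          · exact h3 l h1 h
        · rw [h4]
          apply Equiv.swap_apply_of_ne_of_ne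
          · rcases Nat.eq_zero_or_pos k with h | h
            · subst h
              intro h6
              apply hj
              apply x.2
              simpa [blank] using h6
            · exact h3 k h le_rfl
          · exact h5

end Conf

namespace Conf

variable {n d : ℕ}

theorem nsmul_right_ne_zero (l : ℕ) (h0 : 0 < l) (hl : l < n) :
    l • ((1, 0) : ZMod n × ZMod n) ≠ 0 := by
  intro h
  have h1 : (l : ZMod n) = 0 := by simpa using congrArg Prod.fst h
  rw [ZMod.natCast_eq_zero_iff] at h1
  exact absurd (Nat.le_of_dvd h0 h1) (by omega)

theorem nsmul_up_ne_zero (l : ℕ) (h0 : 0 < l) (hl : l < n) :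
    l • ((0, 1) : ZMod n × ZMod n) ≠ 0 := by
  intro h
  have h1 : (l : ZMod n) = 0 := by simpa using congrArg Prod.snd h
  rw [ZMod.natCast_eq_zero_iff] at h1
  exact absurd (Nat.le_of_dvd h0 h1) (by omega)

theorem nsmul_neg_ne_zero {c : ZMod n × ZMod n}
    (hc : ∀ l : ℕ, 0 < l → l < n → l • c ≠ 0) (l : ℕ) (h0 : 0 < l) (hl : l < n) :
    l • (-c) ≠ 0 := by
  rw [smul_neg]
  exact neg_ne_zero.mpr (hc l h0 hl)

/-- The position of the empty square relative to the piece `i`. -/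
def offset (i : Fin d) (x : Conf n d) : ZMod n × ZMod n := x.blank - x.1 i.castSucc

theorem offset_ne_zero (i : Fin d) (x : Conf n d) : offset i x ≠ 0 := by
  intro h
  have h1 := x.2 (sub_eq_zero.mp h)
  exact (Fin.castSucc_lt_last i).ne h1.symm

theorem blank_eq (i : Fin d) (x : Conf n d) : x.blank = x.1 i.castSucc + offset i x := by
  simp [offset]

/-- Moves the empty square from the right neighbour of a piece to relative position `δ`. -/
def walk (δ : ZMod n × ZMod n) : Equiv.Perm (Conf n d) :=
  move (1, 0) ^ (δ.1 - 1).val * move (0, 1) ^ δ.2.val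

theorem walk_fixed (hn : 2 ≤ n) [NeZero n] (i : Fin d) (δ : ZMod n × ZMod n) (hδ : δ ≠ 0)
    (s : Conf n d) (hs : offset i s = (1, 0)) :
    (walk δ s).1 i.castSucc = s.1 i.castSucc ∧ offset i (walk δ s) = δ := by
  have : Fact (1 < n) := ⟨hn⟩
  have hi : i.castSucc ≠ Fin.last d := (Fin.castSucc_lt_last i).ne
  have hb := blank_eq i s
  rw [hs] at hb
  obtain ⟨hv1, hv2⟩ := move_pow_apply (0, 1) nsmul_up_ne_zero s δ.2.val (ZMod.val_lt _)
  have hv3 : ((move (0, 1) ^ δ.2.val : Equiv.Perm (Conf n d)) s).1 i.castSucc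
      = s.1 i.castSucc := by
    rcases hv2 _ hi with ⟨⟨l, h1, h2, h3⟩, -⟩ | ⟨-, h⟩
    · exfalso
      rw [hb] at h3
      have h4 := congrArg Prod.fst h3
      simp at h4
    · exact h
  set y := ((move (0, 1) ^ δ.2.val : Equiv.Perm (Conf n d)) s) with hy
  have hyb : y.blank = s.1 i.castSucc + (1, δ.2) := by
    rw [hv1, hb, add_assoc]
    congr 1
    ext <;> simp
  obtain ⟨hw1, hw2⟩ := move_pow_apply (1, 0) nsmul_right_ne_zero y (δ.1 - 1).val (ZMod.val_lt _)
  have hw : walk δ s = ((move (1, 0) ^ (δ.1 - 1).val : Equiv.Perm (Conf n d)) y) := rfl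
  have hw3 : (walk δ s).1 i.castSucc = s.1 i.castSucc := by
    rw [hw]
    rcases hw2 _ hi with ⟨⟨l, h1, h2, h3⟩, -⟩ | ⟨-, h⟩
    · exfalso
      rw [hyb, hv3, add_assoc] at h3
      have h4 := left_eq_add.mp h3
      have h5 : δ.2 = 0 := by simpa using congrArg Prod.snd h4
      have h6 : (1 : ZMod n) + l = 0 := by simpa using congrArg Prod.fst h4
      have h7 : ((1 + l : ℕ) : ZMod n) = 0 := by push_cast; exact h6
      rw [ZMod.natCast_eq_zero_iff] at h7
      have h8 := Nat.le_of_dvd (by omega) h7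
      have h9 := ZMod.val_lt (δ.1 - 1)
      have h10 : l = (δ.1 - 1).val := by omega
      rw [h10, ZMod.natCast_zmod_val] at h6
      apply hδ
      ext
      · simpa using h6
      · exact h5
    · rw [h, hv3]
  refine ⟨hw3, ?_⟩
  rw [offset, hw3, hw, hw1, hyb]
  ext <;> simp

/-- The displacement of a piece under `walk`. -/
theorem walk_other [NeZero n] (i : Fin d) (δ : ZMod n × ZMod n)
    (s : Conf n d) (hs : offset i s = (1, 0)) (j : Fin d) :
    (∃ p q : ℤ, |p| ≤ 1 ∧ |q| ≤ 1 ∧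
      (walk δ s).1 j.castSucc - s.1 j.castSucc = ((p : ZMod n), (q : ZMod n))) ∧
    ((s.1 j.castSucc - s.1 i.castSucc).1 ≠ 1 → (s.1 j.castSucc - s.1 i.castSucc).2 ≠ δ.2 →
      (walk δ s).1 j.castSucc = s.1 j.castSucc) := by
  have hj : j.castSucc ≠ Fin.last d := (Fin.castSucc_lt_last j).ne
  have hb := blank_eq i s
  rw [hs] at hb
  obtain ⟨hv1, hv2⟩ := move_pow_apply (0, 1) nsmul_up_ne_zero s δ.2.val (ZMod.val_lt _)
  set y := ((move (0, 1) ^ δ.2.val : Equiv.Perm (Conf n d)) s) with hy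
  have hyb : y.blank = s.1 i.castSucc + (1, δ.2) := by
    rw [hv1, hb, add_assoc]
    congr 1
    ext <;> simp
  obtain ⟨hw1, hw2⟩ := move_pow_apply (1, 0) nsmul_right_ne_zero y (δ.1 - 1).val (ZMod.val_lt _)
  have hw : walk δ s = ((move (1, 0) ^ (δ.1 - 1).val : Equiv.Perm (Conf n d)) y) := rfl
  rw [hw]
  constructor
  · rcases hv2 _ hj with ⟨-, h1⟩ | ⟨-, h1⟩ <;> rcases hw2 _ hj with ⟨-, h2⟩ | ⟨-, h2⟩ <;>
      rw [h2, h1]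
    · exact ⟨-1, -1, by simp, by simp, by ext <;> simp⟩
    · exact ⟨0, -1, by simp, by simp, by ext <;> simp⟩
    · exact ⟨-1, 0, by simp, by simp, by ext <;> simp⟩
    · exact ⟨0, 0, by simp, by simp, by ext <;> simp⟩
  · intro hp hq
    have h1 : y.1 j.castSucc = s.1 j.castSucc := by
      rcases hv2 _ hj with ⟨⟨l, -, -, h3⟩, -⟩ | ⟨-, h⟩
      · exfalso
        apply hp
        rw [h3, hb]
        simp
      · exact h
    rcases hw2 _ hj with ⟨⟨l, -, -, h3⟩, -⟩ | ⟨-, h⟩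
    · exfalso
      apply hq
      rw [← h1, h3, hyb]
      simp
    · rw [h, h1]

theorem walk_inv (hn : 2 ≤ n) [NeZero n] (i : Fin d) (s : Conf n d) :
    offset i ((walk (offset i s))⁻¹ s) = (1, 0) := by
  have : Fact (1 < n) := ⟨hn⟩
  have hi : i.castSucc ≠ Fin.last d := (Fin.castSucc_lt_last i).ne
  set δ := offset i s with hδ
  have hδ0 : δ ≠ 0 := offset_ne_zero i s
  have hb := blank_eq i s
  rw [← hδ] at hb
  have hw : (walk δ)⁻¹ s = ((move (-(0, 1)) ^ δ.2.val : Equiv.Perm (Conf n d))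
      ((move (-(1, 0)) ^ (δ.1 - 1).val : Equiv.Perm (Conf n d)) s)) := by
    rw [walk, mul_inv_rev, ← inv_pow, ← inv_pow, move_inv, move_inv]
    rfl
  obtain ⟨hv1, hv2⟩ := move_pow_apply (-(1, 0)) (nsmul_neg_ne_zero nsmul_right_ne_zero) s
    (δ.1 - 1).val (ZMod.val_lt _)
  have hv3 : ((move (-(1, 0)) ^ (δ.1 - 1).val : Equiv.Perm (Conf n d)) s).1 i.castSucc
      = s.1 i.castSucc := by
    rcases hv2 _ hi with ⟨⟨l, h1, h2, h3⟩, -⟩ | ⟨-, h⟩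
    · exfalso
      rw [hb, add_assoc] at h3
      have h4 := left_eq_add.mp h3
      have h5 : δ.2 = 0 := by simpa using congrArg Prod.snd h4
      have h6 : δ.1 + -(l : ZMod n) = 0 := by simpa using congrArg Prod.fst h4
      have h7 : δ.1 = l := by linear_combination h6
      obtain ⟨m, rfl⟩ : ∃ m, l = m + 1 := ⟨l - 1, by omega⟩
      have h8 : δ.1 - 1 = (m : ZMod n) := by rw [h7]; push_cast; ring
      have h9 := ZMod.val_lt (δ.1 - 1)
      have h10 : (δ.1 - 1).val = m := by
        rw [h8, ZMod.val_natCast, Nat.mod_eq_of_lt (by omega)]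
      omega
    · exact h
  set y := ((move (-(1, 0)) ^ (δ.1 - 1).val : Equiv.Perm (Conf n d)) s) with hy
  have hyb : y.blank = s.1 i.castSucc + (1, δ.2) := by
    rw [hv1, hb, add_assoc]
    congr 1
    ext <;> simp
  obtain ⟨hw1, hw2⟩ := move_pow_apply (-(0, 1)) (nsmul_neg_ne_zero nsmul_up_ne_zero) y
    δ.2.val (ZMod.val_lt _)
  rw [hw, offset, hw1]
  rcases hw2 _ hi with ⟨⟨l, h1, h2, h3⟩, -⟩ | ⟨-, h⟩
  · exfalso
    rw [hyb, hv3] at h3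
    have h4 := congrArg Prod.fst h3
    simp at h4
  · rw [h, hv3, hyb]
    ext <;> simp

end Conf

namespace Conf

variable {n d : ℕ}

/-- Pushes the piece to the left of the empty square one step up. -/
def push : Equiv.Perm (Conf n d) :=
  move (0, 1) * (move (1, 0) * (move (-(0, 1)) * (move (-(1, 0)) * move (0, 1))))

theorem push_apply (hn : 2 ≤ n) (i : Fin d) (s : Conf n d) (hs : offset i s = (1, 0)) :
    (push s).1 i.castSucc = s.1 i.castSucc + (0, 1) ∧ offset i (push s) = (1, 0) ∧
    ∀ j : Fin d, j ≠ i →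
      (s.1 j.castSucc = s.1 i.castSucc + (1, 1) →
        (push s).1 j.castSucc = s.1 i.castSucc) ∧
      (s.1 j.castSucc = s.1 i.castSucc + (0, 1) →
        (push s).1 j.castSucc = s.1 i.castSucc + (1, 0)) ∧
      (s.1 j.castSucc ≠ s.1 i.castSucc + (1, 1) → s.1 j.castSucc ≠ s.1 i.castSucc + (0, 1) →
        (push s).1 j.castSucc = s.1 j.castSucc) := by
  have : Fact (1 < n) := ⟨by omega⟩
  set p := s.1 i.castSucc with hp
  have hb : s.blank = p + (1, 0) := by rw [blank_eq i s, hs]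
  have e2 : p + (1, 0) + (0, 1) = p + (1, 1) := by rw [add_assoc]; simp
  have e3 : p + (1, 1) + -(1, 0) = p + (0, 1) := by rw [add_assoc]; simp
  have e4 : p + (0, 1) + -(0, 1) = p := add_neg_cancel_right _ _
  have key : ∀ j, (push s).1 j = Equiv.swap (p + (1, 0)) (p + (1, 1)) (Equiv.swap p (p + (1, 0))
      (Equiv.swap (p + (0, 1)) p (Equiv.swap (p + (1, 1)) (p + (0, 1))
        (Equiv.swap (p + (1, 0)) (p + (1, 1)) (s.1 j))))) := by
    intro j
    simp only [push, Equiv.Perm.mul_apply, move_apply, blank_move, hb, e2, e3, e4]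
  have n1 : p + (1, 0) ≠ p := by simp
  have n2 : p + (1, 1) ≠ p := by simp
  have n3 : p + (0, 1) ≠ p := by simp
  have n4 : p + (1, 0) ≠ p + (1, 1) := by simp
  have n5 : p + (1, 0) ≠ p + (0, 1) := by simp
  have n6 : p + (1, 1) ≠ p + (0, 1) := by simp
  have h1 : (push s).1 i.castSucc = p + (0, 1) := by
    rw [key, ← hp]
    simp [Equiv.swap_apply_def, n3, n1.symm, n2.symm, n3.symm]
  have h2 : (push s).blank = p + (1, 1) := by
    simp only [push, Equiv.Perm.mul_apply, blank_move, hb, e2, e3, e4]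
  refine ⟨h1, ?_, fun j hj => ⟨fun h => ?_, fun h => ?_, fun h h' => ?_⟩⟩
  · rw [offset, h1, h2]
    simp
  · rw [key, h]
    simp [Equiv.swap_apply_def]
  · rw [key, h]
    simp [Equiv.swap_apply_def]
  · have m1 : s.1 j.castSucc ≠ p := by
      intro h3
      exact hj (Fin.castSucc_injective _ (s.2 h3))
    have m2 : s.1 j.castSucc ≠ p + (1, 0) := by
      intro h3
      rw [← hb] at h3
      exact (Fin.castSucc_lt_last j).ne (s.2 h3)
    rw [key, Equiv.swap_apply_of_ne_of_ne m2 h, Equiv.swap_apply_of_ne_of_ne h h',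
      Equiv.swap_apply_of_ne_of_ne h' m1, Equiv.swap_apply_of_ne_of_ne m1 m2,
      Equiv.swap_apply_of_ne_of_ne m2 h]

theorem offset_push (hn : 2 ≤ n) (i : Fin d) (s : Conf n d) (hs : offset i s = (1, 0)) :
    offset i (push s) = (1, 0) := (push_apply hn i s hs).2.1

theorem push_pow_apply (hn : 2 ≤ n) (i : Fin d) (s : Conf n d) (hs : offset i s = (1, 0))
    (k : ℕ) (hk : k < n) :
    offset i ((push ^ k : Equiv.Perm (Conf n d)) s) = (1, 0) ∧
    ((push ^ k : Equiv.Perm (Conf n d)) s).1 i.castSucc = s.1 i.castSucc + (0, (k : ZMod n)) ∧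
    ∀ j : Fin d, j ≠ i →
      (∃ l : ℕ, 1 ≤ l ∧ l ≤ k ∧
        ((s.1 j.castSucc = s.1 i.castSucc + (1, (l : ZMod n)) ∧
          ((push ^ k : Equiv.Perm (Conf n d)) s).1 j.castSucc = s.1 j.castSucc + (-1, -1)) ∨
         (s.1 j.castSucc = s.1 i.castSucc + (0, (l : ZMod n)) ∧
          ((push ^ k : Equiv.Perm (Conf n d)) s).1 j.castSucc = s.1 j.castSucc + (1, -1)))) ∨
      ((∀ l : ℕ, 1 ≤ l → l ≤ k → s.1 j.castSucc ≠ s.1 i.castSucc + (1, (l : ZMod n)) ∧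
          s.1 j.castSucc ≠ s.1 i.castSucc + (0, (l : ZMod n))) ∧
        ((push ^ k : Equiv.Perm (Conf n d)) s).1 j.castSucc = s.1 j.castSucc) := by
  have : Fact (1 < n) := ⟨by omega⟩
  induction k with
  | zero =>
    refine ⟨by simpa using hs, by ext <;> simp, fun j hj => Or.inr ⟨fun l h1 h2 => by omega, ?_⟩⟩
    simp
  | succ k ih =>
    obtain ⟨ih1, ih2, ih3⟩ := ih (by omega)
    have hsucc : (push ^ (k + 1) : Equiv.Perm (Conf n d)) s =
        push ((push ^ k : Equiv.Perm (Conf n d)) s) := by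
      rw [pow_succ']
      rfl
    obtain ⟨h1, h2, h3⟩ := push_apply hn i _ ih1
    rw [hsucc]
    set y := (push ^ k : Equiv.Perm (Conf n d)) s with hy
    set p := s.1 i.castSucc with hp
    refine ⟨h2, by rw [h1, ih2]; ext <;> simp [add_assoc], fun j hj => ?_⟩
    obtain ⟨g1, g2, g3⟩ := h3 j hj
    have key : ∀ a b : ℕ, a < b → b < a + n → (a : ZMod n) ≠ (b : ZMod n) := by
      intro a b hab hb h
      rw [ZMod.natCast_eq_natCast_iff, Nat.modEq_iff_dvd' hab.le] at h
      exact absurd (Nat.le_of_dvd (by omega) h) (by omega)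
    have c1 : p + (0, (k : ZMod n)) + (1, 1) = p + (1, ((k + 1 : ℕ) : ZMod n)) := by
      ext <;> simp [add_assoc]
    have c2 : p + (0, (k : ZMod n)) + (0, 1) = p + (0, ((k + 1 : ℕ) : ZMod n)) := by
      ext <;> simp [add_assoc]
    rw [ih2, c1, c2] at g3
    rw [ih2, c1] at g1
    rw [ih2, c2] at g2
    rcases ih3 j hj with ⟨l, hl1, hl2, ⟨e1, e2⟩ | ⟨e1, e2⟩⟩ | ⟨e1, e2⟩
    · left
      refine ⟨l, hl1, by omega, Or.inl ⟨e1, ?_⟩⟩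
      rw [g3, e2] <;> rw [e2, e1] <;> intro h <;> have h := congrArg Prod.snd h
      · refine key (l - 1) (k + 1) (by omega) (by omega) ?_
        rw [Nat.cast_sub hl1]
        simp only [Prod.snd_add, add_assoc] at h
        have := add_left_cancel h
        simpa [sub_eq_add_neg] using this
      · refine key (l - 1) (k + 1) (by omega) (by omega) ?_
        rw [Nat.cast_sub hl1]
        simp only [Prod.snd_add, add_assoc] at h
        have := add_left_cancel h
        simpa [sub_eq_add_neg] using this
    · left
      refine ⟨l, hl1, by omega, Or.inr ⟨e1, ?_⟩⟩
      rw [g3, e2] <;> rw [e2, e1] <;> intro h <;> have h := congrArg Prod.snd h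
      · refine key (l - 1) (k + 1) (by omega) (by omega) ?_
        rw [Nat.cast_sub hl1]
        simp only [Prod.snd_add, add_assoc] at h
        have := add_left_cancel h
        simpa [sub_eq_add_neg] using this
      · refine key (l - 1) (k + 1) (by omega) (by omega) ?_
        rw [Nat.cast_sub hl1]
        simp only [Prod.snd_add, add_assoc] at h
        have := add_left_cancel h
        simpa [sub_eq_add_neg] using this
    · by_cases q1 : s.1 j.castSucc = p + (1, ((k + 1 : ℕ) : ZMod n))
      · left
        refine ⟨k + 1, by omega, le_rfl, Or.inl ⟨q1, ?_⟩⟩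
        rw [g1 (by rw [e2, q1]), q1]
        ext <;> simp [add_assoc]
      by_cases q2 : s.1 j.castSucc = p + (0, ((k + 1 : ℕ) : ZMod n))
      · left
        refine ⟨k + 1, by omega, le_rfl, Or.inr ⟨q2, ?_⟩⟩
        rw [g2 (by rw [e2, q2]), q2]
        ext <;> simp [add_assoc]
      right
      refine ⟨fun l h4 h5 => ?_, by rw [g3 (by rwa [e2]) (by rwa [e2]), e2]⟩
      rcases Nat.lt_or_ge k l with h | h
      · have : l = k + 1 := by omega
        rw [this]
        exact ⟨q1, q2⟩
      · exact e1 l h4 h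

end Conf

section PermEnergy

variable {α : Type*} [Fintype α] (f : α → ℝ)

omit [Fintype α] in
theorem sq_pow_sub_le (p : Equiv.Perm α) (k : ℕ) (x : α) :
    (f ((p ^ k) x) - f x) ^ 2 ≤
      k * ∑ j ∈ range k, (f (p ((p ^ j) x)) - f ((p ^ j) x)) ^ 2 := by
  have h1 : f ((p ^ k) x) - f x = ∑ j ∈ range k, (f (p ((p ^ j) x)) - f ((p ^ j) x)) := by
    have := Finset.sum_range_sub (fun j => f ((p ^ j) x)) k
    simp only [pow_zero, Equiv.Perm.one_apply] at this
    rw [← this]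
    refine Finset.sum_congr rfl fun j _ => ?_
    rw [pow_succ', Equiv.Perm.mul_apply]
  rw [h1]
  simpa using sq_sum_le_card_mul_sum_sq (s := range k)
    (f := fun j => f (p ((p ^ j) x)) - f ((p ^ j) x))

theorem sum_sq_pow_sub_le (p : Equiv.Perm α) (k : ℕ) :
    ∑ x, (f ((p ^ k) x) - f x) ^ 2 ≤ k ^ 2 * ∑ x, (f (p x) - f x) ^ 2 := by
  calc ∑ x, (f ((p ^ k) x) - f x) ^ 2
      ≤ ∑ x, k * ∑ j ∈ range k, (f (p ((p ^ j) x)) - f ((p ^ j) x)) ^ 2 :=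
        Finset.sum_le_sum fun x _ => sq_pow_sub_le f p k x
    _ = k * ∑ j ∈ range k, ∑ x, (f (p ((p ^ j) x)) - f ((p ^ j) x)) ^ 2 := by
        rw [← Finset.mul_sum, Finset.sum_comm]
    _ = k * ∑ _j ∈ range k, ∑ x, (f (p x) - f x) ^ 2 := by
        congr 1
        refine Finset.sum_congr rfl fun j _ => ?_
        exact Equiv.sum_comp (p ^ j) (fun x => (f (p x) - f x) ^ 2)
    _ = k ^ 2 * ∑ x, (f (p x) - f x) ^ 2 := by
        simp
        ring

theorem sum_sq_mul_sub_le (p q : Equiv.Perm α) :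
    ∑ x, (f ((p * q) x) - f x) ^ 2 ≤
      2 * ∑ x, (f (p x) - f x) ^ 2 + 2 * ∑ x, (f (q x) - f x) ^ 2 := by
  rw [← Equiv.sum_comp q (fun x => (f (p x) - f x) ^ 2), Finset.mul_sum, Finset.mul_sum,
    ← Finset.sum_add_distrib]
  refine Finset.sum_le_sum fun x _ => ?_
  rw [Equiv.Perm.mul_apply]
  nlinarith [sq_nonneg ((f (p (q x)) - f (q x)) - (f (q x) - f x))]

theorem sum_range_le_sum_of_injective {β : Type*} [Fintype β] (F : β → ℝ) (hF : ∀ x, 0 ≤ F x)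
    (k : ℕ) (g : ∀ j, j < k → β) (hg : ∀ j j' h h', g j h = g j' h' → j = j') (a : ℕ → ℝ)
    (ha : ∀ j h, a j ≤ F (g j h)) : ∑ j ∈ range k, a j ≤ ∑ x, F x := by
  rw [Finset.sum_range]
  calc ∑ j : Fin k, a j ≤ ∑ j : Fin k, F (g j j.2) := Finset.sum_le_sum fun j _ => ha j j.2
    _ = ∑ x ∈ univ.map ⟨fun j : Fin k => g j j.2, fun j j' h => Fin.ext (hg _ _ _ _ h)⟩, F x := by
        rw [Finset.sum_map]
        rfl
    _ ≤ ∑ x, F x := Finset.sum_le_univ_sum_of_nonneg hF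

end PermEnergy

namespace Conf

variable {n d : ℕ}

/-- The (unnormalised) Dirichlet form of the chain. -/
noncomputable def energy [NeZero n] (f : Conf n d → ℝ) : ℝ :=
  ∑ c ∈ displacements n, ∑ x, (f (move c x) - f x) ^ 2

theorem sum_sq_move_le_energy [NeZero n] (f : Conf n d → ℝ) {c : ZMod n × ZMod n}
    (hc : c ∈ displacements n) : ∑ x, (f (move c x) - f x) ^ 2 ≤ energy f :=
  Finset.single_le_sum (f := fun c => ∑ x, (f (move c x) - f x) ^ 2)
    (fun _ _ => Finset.sum_nonneg fun _ _ => sq_nonneg _) hc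

theorem energy_nonneg [NeZero n] (f : Conf n d → ℝ) : 0 ≤ energy f :=
  Finset.sum_nonneg fun _ _ => Finset.sum_nonneg fun _ _ => sq_nonneg _

theorem sum_sq_push_le [NeZero n] (f : Conf n d → ℝ) :
    ∑ x, (f (push x) - f x) ^ 2 ≤ 46 * energy f := by
  have m1 := sum_sq_move_le_energy f (c := (0, 1)) (by simp [displacements])
  have m2 := sum_sq_move_le_energy f (c := (1, 0)) (by simp [displacements])
  have m3 := sum_sq_move_le_energy f (c := -(0, 1)) (by simp [displacements])
  have m4 := sum_sq_move_le_energy f (c := -(1, 0)) (by simp [displacements])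
  have h1 := sum_sq_mul_sub_le f (move (-(1, 0))) (move (0, 1))
  have h2 := sum_sq_mul_sub_le f (move (-(0, 1))) (move (-(1, 0)) * move (0, 1))
  have h3 := sum_sq_mul_sub_le f (move (1, 0)) (move (-(0, 1)) * (move (-(1, 0)) * move (0, 1)))
  have h4 := sum_sq_mul_sub_le f (move (0, 1))
    (move (1, 0) * (move (-(0, 1)) * (move (-(1, 0)) * move (0, 1))))
  rw [push]
  linarith

/-- Nonzero relative positions. -/
abbrev Off (n : ℕ) := {δ : ZMod n × ZMod n // δ ≠ 0}

/-- Configurations where the empty square is the right neighbour of the piece `i`. -/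
abbrev Base (n : ℕ) {d : ℕ} (i : Fin d) := {s : Conf n d // offset i s = (1, 0)}

theorem card_off_add_one [NeZero n] : Fintype.card (Off n) + 1 = n ^ 2 := by
  have h := Fintype.card_subtype_compl (fun δ : ZMod n × ZMod n => δ = 0)
  simp only [Fintype.card_prod, ZMod.card, Fintype.card_subtype_eq] at h
  have h3 : 0 < n * n := Nat.mul_pos (NeZero.pos n) (NeZero.pos n)
  have h2 : Fintype.card (Off n) = n * n - 1 := by rw [← h]
  rw [h2, sq]
  omega

variable [NeZero n]

/-- A configuration is determined by the relative position of the empty square and the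
configuration obtained by walking the empty square back to the piece `i`. -/
def splitBase (hn : 2 ≤ n) (i : Fin d) : Conf n d ≃ Base n i × Off n where
  toFun s := (⟨(walk (offset i s))⁻¹ s, walk_inv hn i s⟩, ⟨offset i s, offset_ne_zero i s⟩)
  invFun y := walk y.2.1 y.1.1
  left_inv s := by simp
  right_inv y := by
    obtain ⟨⟨s, hs⟩, δ, hδ⟩ := y
    have h := (walk_fixed hn i δ hδ s hs).2
    simp only [Prod.mk.injEq, Subtype.mk.injEq]
    constructor
    · rw [h]
      simp
    · exact h

theorem sum_eq_sum_base (hn : 2 ≤ n) (i : Fin d) (G : Conf n d → ℝ) :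
    ∑ x, G x = ∑ s : Base n i, ∑ δ : Off n, G (walk δ.1 s.1) := by
  rw [← Fintype.sum_prod_type']
  exact ((splitBase hn i).symm.sum_comp G).symm

/-- `push` as a permutation of the base configurations. -/
noncomputable def pushBase (hn : 2 ≤ n) (i : Fin d) : Equiv.Perm (Base n i) :=
  Equiv.Perm.subtypePermOfFintype push (fun s hs => offset_push hn i s hs)

theorem pushBase_pow_val (hn : 2 ≤ n) (i : Fin d) (k : ℕ) (s : Base n i) :
    ((pushBase hn i ^ k) s).1 = (push ^ k : Equiv.Perm (Conf n d)) s.1 := by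
  induction k with
  | zero => rfl
  | succ k ih =>
    rw [pow_succ', pow_succ', Equiv.Perm.mul_apply, Equiv.Perm.mul_apply, ← ih]
    rfl

theorem sum_walk_le (hn : 2 ≤ n) (i : Fin d) (f : Conf n d → ℝ) :
    ∑ s : Base n i, ∑ δ : Off n, (f (walk δ.1 s.1) - f s.1) ^ 2 ≤ 4 * n ^ 3 * energy f := by
  have : Fact (1 < n) := ⟨hn⟩
  set Gh : Conf n d → ℝ := fun x => (f (move (1, 0) x) - f x) ^ 2 with hGh
  set Gv : Conf n d → ℝ := fun x => (f (move (0, 1) x) - f x) ^ 2 with hGv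
  have hGh0 : ∀ x, 0 ≤ Gh x := fun x => sq_nonneg _
  have hGv0 : ∀ x, 0 ≤ Gv x := fun x => sq_nonneg _
  have m1 : ∑ x, Gv x ≤ energy f :=
    sum_sq_move_le_energy f (c := (0, 1)) (by simp [displacements])
  have m2 : ∑ x, Gh x ≤ energy f :=
    sum_sq_move_le_energy f (c := (1, 0)) (by simp [displacements])
  have pt : ∀ (s : Base n i) (δ : Off n), (f (walk δ.1 s.1) - f s.1) ^ 2 ≤
      2 * n * (∑ η : Off n, Gh (walk η.1 s.1)) + 2 * n * (∑ η : Off n, Gv (walk η.1 s.1)) := by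
    intro s δ
    have ha := ZMod.val_lt (δ.1.1 - 1)
    have hb := ZMod.val_lt δ.1.2
    have e1 : walk δ.1 s.1 = (move (1, 0) ^ (δ.1.1 - 1).val : Equiv.Perm (Conf n d))
      ((move (0, 1) ^ δ.1.2.val : Equiv.Perm (Conf n d)) s.1) := rfl
    set y := (move (0, 1) ^ δ.1.2.val : Equiv.Perm (Conf n d)) s.1 with hy
    have h1 := sq_pow_sub_le f (move (1, 0)) (δ.1.1 - 1).val y
    have h2 := sq_pow_sub_le f (move (0, 1)) δ.1.2.val s.1
    rw [← hy] at h2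
    rw [← e1] at h1
    have k1 : ∑ j ∈ range (δ.1.1 - 1).val,
        (f (move (1, 0) ((move (1, 0) ^ j : Equiv.Perm (Conf n d)) y))
          - f ((move (1, 0) ^ j : Equiv.Perm (Conf n d)) y)) ^ 2 ≤
        ∑ η : Off n, Gh (walk η.1 s.1) := by
      have hval : ∀ j, j < (δ.1.1 - 1).val → ((j : ZMod n)).val = j := by
        intro j hj
        rw [ZMod.val_natCast, Nat.mod_eq_of_lt (by omega)]
      have hne : ∀ j, j < (δ.1.1 - 1).val → ((1 + (j : ZMod n), δ.1.2) : ZMod n × ZMod n) ≠ 0 := by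
        intro j hj h
        have h5 := congrArg Prod.fst h
        simp only [Prod.fst_zero] at h5
        have h7 : ((1 + j : ℕ) : ZMod n) = 0 := by push_cast; exact h5
        rw [ZMod.natCast_eq_zero_iff] at h7
        have h8 := Nat.le_of_dvd (by omega) h7
        omega
      refine sum_range_le_sum_of_injective (fun η : Off n => Gh (walk η.1 s.1)) (fun _ => hGh0 _) _
        (fun j hj => ⟨(1 + (j : ZMod n), δ.1.2), hne j hj⟩) ?_ _ ?_
      · intro j j' h h' hjj
        simp only [Subtype.mk.injEq, Prod.mk.injEq, add_right_inj, and_true] at hjj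
        rw [← hval j h, ← hval j' h', hjj]
      · intro j h
        apply le_of_eq
        rw [hGh]
        simp only [walk, add_sub_cancel_left, Equiv.Perm.mul_apply, hval j h]
        rfl
    have k2 : ∑ j ∈ range δ.1.2.val,
        (f (move (0, 1) ((move (0, 1) ^ j : Equiv.Perm (Conf n d)) s.1))
          - f ((move (0, 1) ^ j : Equiv.Perm (Conf n d)) s.1)) ^ 2 ≤
        ∑ η : Off n, Gv (walk η.1 s.1) := by
      have hval : ∀ j, j < δ.1.2.val → ((j : ZMod n)).val = j := by
        intro j hj
        rw [ZMod.val_natCast, Nat.mod_eq_of_lt (by omega)]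
      refine sum_range_le_sum_of_injective (fun η : Off n => Gv (walk η.1 s.1)) (fun _ => hGv0 _) _
        (fun j hj => ⟨(1, (j : ZMod n)), by simp⟩) ?_ _ ?_
      · intro j j' h h' hjj
        simp only [Subtype.mk.injEq, Prod.mk.injEq, true_and] at hjj
        rw [← hval j h, ← hval j' h', hjj]
      · intro j h
        apply le_of_eq
        rw [hGv]
        simp [walk, hval j h]
    have p1 : 0 ≤ ∑ η : Off n, Gh (walk η.1 s.1) := Finset.sum_nonneg fun _ _ => hGh0 _
    have p2 : 0 ≤ ∑ η : Off n, Gv (walk η.1 s.1) := Finset.sum_nonneg fun _ _ => hGv0 _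
    have q1 : ((δ.1.1 - 1).val : ℝ) ≤ n := by exact_mod_cast ha.le
    have q2 : (δ.1.2.val : ℝ) ≤ n := by exact_mod_cast hb.le
    have r1 := h1.trans (mul_le_mul q1 k1 (Finset.sum_nonneg fun _ _ => sq_nonneg _)
      (by positivity))
    have r2 := h2.trans (mul_le_mul q2 k2 (Finset.sum_nonneg fun _ _ => sq_nonneg _)
      (by positivity))
    nlinarith [sq_nonneg ((f (walk δ.1 s.1) - f y) - (f y - f s.1))]
  have hcard : (Fintype.card (Off n) : ℝ) ≤ n ^ 2 := by
    exact_mod_cast (Nat.le_succ _).trans card_off_add_one.le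
  have hE := energy_nonneg f
  calc ∑ s : Base n i, ∑ δ : Off n, (f (walk δ.1 s.1) - f s.1) ^ 2
      ≤ ∑ s : Base n i, ∑ _δ : Off n, (2 * n * (∑ η : Off n, Gh (walk η.1 s.1))
          + 2 * n * (∑ η : Off n, Gv (walk η.1 s.1))) :=
        Finset.sum_le_sum fun s _ => Finset.sum_le_sum fun δ _ => pt s δ
    _ = Fintype.card (Off n) * (2 * n * (∑ x, Gh x) + 2 * n * ∑ x, Gv x) := by
        rw [sum_eq_sum_base hn i Gh, sum_eq_sum_base hn i Gv, Finset.mul_sum, Finset.mul_sum,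
          ← Finset.sum_add_distrib, Finset.mul_sum]
        refine Finset.sum_congr rfl fun s _ => ?_
        rw [Finset.sum_const, Finset.card_univ, nsmul_eq_mul]
    _ ≤ n ^ 2 * (2 * n * energy f + 2 * n * energy f) := by
        gcongr
    _ = 4 * n ^ 3 * energy f := by ring

end Conf

namespace Conf

variable {n d r : ℕ}

/-- The parameters of a single step: how far the piece is pushed, and where the empty square
ends up relative to the piece. -/
abbrev Param (n r : ℕ) := Fin r × Off n

/-- The piece `j`. -/
abbrev tile (x : Conf n d) (j : Fin d) : ZMod n × ZMod n := x.1 j.castSucc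

/-- The possible perturbations of the other pieces during a single step. -/
noncomputable def perturbations (n : ℕ) : Finset (ZMod n × ZMod n) :=
  (Finset.Icc (-3 : ℤ) 3 ×ˢ Finset.Icc (-3 : ℤ) 3).image
    fun z => ((z.1 : ZMod n), (z.2 : ZMod n))

theorem card_perturbations_le : (perturbations n).card ≤ 49 := by
  refine Finset.card_image_le.trans ?_
  simp

theorem mem_perturbations {p q : ℤ} (hp : |p| ≤ 3) (hq : |q| ≤ 3) {v : ZMod n × ZMod n}
    (hv : v = ((p : ZMod n), (q : ZMod n))) : v ∈ perturbations n := by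
  rw [perturbations, Finset.mem_image]
  exact ⟨(p, q), by simp [abs_le.mp hp, abs_le.mp hq], hv.symm⟩

variable [NeZero n]

/-- The vertical step: walk the empty square to the right neighbour of the piece `i`, push the
piece upwards, and walk the empty square to its new relative position.  The second component
makes the step reversible. -/
noncomputable def vstep (hn : 2 ≤ n) (i : Fin d) (q : Conf n d × Param n r) :
    Conf n d × Param n r :=
  ((splitBase hn i).symm ((pushBase hn i ^ (q.2.1 : ℕ)) (splitBase hn i q.1).1, q.2.2),
    (q.2.1, (splitBase hn i q.1).2))

theorem vstep_injective (hn : 2 ≤ n) (i : Fin d) :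
    Function.Injective (vstep hn i : Conf n d × Param n r → _) := by
  rintro ⟨s, b, δ⟩ ⟨s', b', δ'⟩ h
  simp only [vstep, Prod.mk.injEq, EmbeddingLike.apply_eq_iff_eq] at h
  obtain ⟨⟨h1, h2⟩, h3, h4⟩ := h
  subst h3 h2
  have h5 := (Equiv.injective _) h1
  have : splitBase hn i s = splitBase hn i s' := Prod.ext h5 h4
  rw [(splitBase hn i).injective this]

/-- The decomposition of a vertical step. -/
theorem vstep_spec (hn : 2 ≤ n) (i : Fin d) (s : Base n i) (δ : Off n) (p : Param n r) :
    (vstep hn i (walk δ.1 s.1, p)).1 =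
      walk p.2.1 ((push ^ (p.1 : ℕ) : Equiv.Perm (Conf n d)) s.1) := by
  have h : walk δ.1 s.1 = (splitBase hn i).symm (s, δ) := rfl
  rw [h, vstep]
  simp only [Equiv.apply_symm_apply]
  rw [← pushBase_pow_val hn i]
  rfl

theorem exists_base (hn : 2 ≤ n) (i : Fin d) (x : Conf n d) :
    ∃ (s : Base n i) (δ : Off n), x = walk δ.1 s.1 :=
  ⟨(splitBase hn i x).1, (splitBase hn i x).2, ((splitBase hn i).symm_apply_apply x).symm⟩

theorem vstep_self (hn : 2 ≤ n) (hr : r ≤ n) (i : Fin d) (q : Conf n d × Param n r) :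
    tile (vstep hn i q).1 i = tile q.1 i + (0, ((q.2.1 : ℕ) : ZMod n)) ∧
    offset i (vstep hn i q).1 = q.2.2 := by
  obtain ⟨x, p⟩ := q
  obtain ⟨s, δ, rfl⟩ := exists_base hn i x
  obtain ⟨h1, h2, -⟩ := push_pow_apply hn i s.1 s.2 p.1 (p.1.2.trans_le hr)
  rw [vstep_spec]
  obtain ⟨h3, h4⟩ := walk_fixed hn i p.2.1 p.2.2 _ h1
  obtain ⟨h5, -⟩ := walk_fixed hn i δ.1 δ.2 _ s.2
  exact ⟨by rw [tile, h3, h2, tile, h5], h4⟩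

theorem vstep_other (hn : 2 ≤ n) (hr : r ≤ n) (i j : Fin d) (hj : j ≠ i)
    (q : Conf n d × Param n r) : tile (vstep hn i q).1 j - tile q.1 j ∈ perturbations n := by
  obtain ⟨x, p⟩ := q
  obtain ⟨s, δ, rfl⟩ := exists_base hn i x
  obtain ⟨h1, -, h2⟩ := push_pow_apply hn i s.1 s.2 p.1 (p.1.2.trans_le hr)
  rw [vstep_spec]
  obtain ⟨⟨a, b, ha, hb, hab⟩, -⟩ := walk_other i p.2.1 _ h1 j
  obtain ⟨⟨a', b', ha', hb', hab'⟩, -⟩ := walk_other i δ.1 s.1 s.2 j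
  have h3 : ∃ e g : ℤ, |e| ≤ 1 ∧ |g| ≤ 1 ∧
      ((push ^ (p.1 : ℕ) : Equiv.Perm (Conf n d)) s.1).1 j.castSucc =
        s.1.1 j.castSucc + ((e : ZMod n), (g : ZMod n)) := by
    rcases h2 j hj with ⟨l, -, -, ⟨-, h⟩ | ⟨-, h⟩⟩ | ⟨-, h⟩
    · exact ⟨-1, -1, by simp, by simp, by rw [h]; simp⟩
    · exact ⟨1, -1, by simp, by simp, by rw [h]; simp⟩
    · refine ⟨0, 0, by simp, by simp, ?_⟩
      rw [h]
      ext <;> simp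
  obtain ⟨e, g, he, hg, heg⟩ := h3
  rw [abs_le] at *
  refine mem_perturbations (p := a + e - a') (q := b + g - b') (abs_le.mpr (by omega))
    (abs_le.mpr (by omega)) ?_
  have h4 : tile (walk p.2.1 ((push ^ (p.1 : ℕ) : Equiv.Perm (Conf n d)) s.1)) j -
      tile (walk δ.1 s.1) j = ((a : ZMod n), (b : ZMod n)) + ((e : ZMod n), (g : ZMod n))
        - ((a' : ZMod n), (b' : ZMod n)) := by
    rw [← hab, ← hab', heg, tile, tile]
    abel
  rw [h4]
  ext <;> simp

theorem sum_sq_vstep_le (hn : 2 ≤ n) (i : Fin d) (f : Conf n d → ℝ) :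
    ∑ q : Conf n d × Param n r, (f (vstep hn i q).1 - f q.1) ^ 2 ≤
      Fintype.card (Param n r) * (138 * n ^ 2 * (n + r ^ 2)) * energy f := by
  have hE := energy_nonneg f
  set X := ∑ s : Base n i, ∑ δ : Off n, (f (walk δ.1 s.1) - f s.1) ^ 2 with hX
  have hX4 : X ≤ 4 * n ^ 3 * energy f := sum_walk_le hn i f
  set oc : ℝ := ((Fintype.card (Off n) : ℕ) : ℝ) with hoc
  have hcard : oc ≤ n ^ 2 := by
    rw [hoc]
    exact_mod_cast (Nat.le_succ _).trans card_off_add_one.le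
  have hoc0 : 0 ≤ oc := Nat.cast_nonneg _
  set Y : ℕ → ℝ := fun b => ∑ s : Base n i,
    (f ((push ^ b : Equiv.Perm (Conf n d)) s.1) - f s.1) ^ 2 with hY
  have hYb : ∀ b : Fin r, Y b ≤ 46 * r ^ 2 * energy f := by
    intro b
    have hb : ((b : ℕ) : ℝ) ≤ r := by exact_mod_cast b.2.le
    calc Y b ≤ ∑ x : Conf n d, (f ((push ^ (b : ℕ) : Equiv.Perm (Conf n d)) x) - f x) ^ 2 := by
          rw [hY]
          have := Finset.sum_subtype_of_mem
            (s := univ.filter fun x : Conf n d => offset i x = (1, 0))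
            (p := fun x => offset i x = (1, 0))
            (fun x => (f ((push ^ (b : ℕ) : Equiv.Perm (Conf n d)) x) - f x) ^ 2)
            (by simp)
          refine le_trans (le_of_eq ?_) (Finset.sum_le_sum_of_subset_of_nonneg
            (Finset.filter_subset (fun x : Conf n d => offset i x = (1, 0)) univ)
            fun _ _ _ => sq_nonneg _)
          rw [← this]
          refine Finset.sum_congr ?_ fun _ _ => rfl
          ext x
          simp [x.2]
      _ ≤ (b : ℕ) ^ 2 * ∑ x : Conf n d, (f (push x) - f x) ^ 2 := sum_sq_pow_sub_le f push b
      _ ≤ r ^ 2 * (46 * energy f) := by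
          gcongr
          exact sum_sq_push_le f
      _ = 46 * r ^ 2 * energy f := by ring
  have key : ∀ b : Fin r, ∀ δ' : Off n,
      ∑ x : Conf n d, (f (vstep hn i (x, ((b, δ') : Param n r))).1 - f x) ^ 2 ≤
      3 * X + 3 * oc * Y b + 3 * oc * ∑ s : Base n i, (f (walk δ'.1 s.1) - f s.1) ^ 2 := by
    intro b δ'
    rw [sum_eq_sum_base hn i]
    have e1 : ∑ s : Base n i, (f (walk δ'.1 s.1) - f s.1) ^ 2 = ∑ s : Base n i,
        (f (walk δ'.1 ((push ^ (b : ℕ) : Equiv.Perm (Conf n d)) s.1)) -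
          f ((push ^ (b : ℕ) : Equiv.Perm (Conf n d)) s.1)) ^ 2 := by
      rw [← Equiv.sum_comp (pushBase hn i ^ (b : ℕ))]
      refine Finset.sum_congr rfl fun s _ => ?_
      rw [pushBase_pow_val]
    have e2 : ∀ F : Base n i → ℝ, oc * ∑ s, F s = ∑ s, ∑ _δ : Off n, F s := by
      intro F
      simp [hoc, Finset.mul_sum]
    rw [e1, mul_assoc, mul_assoc, hY, e2, e2, hX, Finset.mul_sum, Finset.mul_sum, Finset.mul_sum,
      ← Finset.sum_add_distrib, ← Finset.sum_add_distrib]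
    refine Finset.sum_le_sum fun s _ => ?_
    rw [Finset.mul_sum, Finset.mul_sum, Finset.mul_sum,
      ← Finset.sum_add_distrib, ← Finset.sum_add_distrib]
    refine Finset.sum_le_sum fun δ _ => ?_
    rw [vstep_spec]
    set u := f (walk δ.1 s.1)
    set v := f s.1
    set w := f ((push ^ (b : ℕ) : Equiv.Perm (Conf n d)) s.1)
    set z := f (walk δ'.1 ((push ^ (b : ℕ) : Equiv.Perm (Conf n d)) s.1))
    nlinarith [sq_nonneg ((z - w) - (w - v)), sq_nonneg ((z - w) - (v - u)),
      sq_nonneg ((w - v) - (v - u))]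
  calc ∑ q : Conf n d × Param n r, (f (vstep hn i q).1 - f q.1) ^ 2
      = ∑ b : Fin r, ∑ δ' : Off n,
        ∑ x : Conf n d, (f (vstep hn i (x, ((b, δ') : Param n r))).1 - f x) ^ 2 := by
        rw [Fintype.sum_prod_type_right, Fintype.sum_prod_type]
    _ ≤ ∑ b : Fin r, ∑ δ' : Off n, (3 * X + 3 * oc * Y b +
          3 * oc * ∑ s : Base n i, (f (walk δ'.1 s.1) - f s.1) ^ 2) :=
        Finset.sum_le_sum fun b _ => Finset.sum_le_sum fun δ' _ => key b δ'
    _ = ∑ b : Fin r, (oc * (3 * X) + oc * (3 * oc * Y b) + 3 * oc * X) := by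
        refine Finset.sum_congr rfl fun b _ => ?_
        rw [Finset.sum_add_distrib, ← Finset.mul_sum, Finset.sum_comm, ← hX, Finset.sum_const,
          Finset.card_univ, nsmul_eq_mul, mul_add]
    _ ≤ ∑ b : Fin r, oc * (138 * n ^ 2 * (n + r ^ 2)) * energy f := by
        refine Finset.sum_le_sum fun b _ => ?_
        have h1 : oc * Y b ≤ n ^ 2 * (46 * r ^ 2 * energy f) :=
          mul_le_mul hcard (hYb b) (Finset.sum_nonneg fun _ _ => sq_nonneg _) (by positivity)
        have h2 : 3 * X + 3 * (oc * Y b) + 3 * X ≤ 138 * n ^ 2 * (n + r ^ 2) * energy f := by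
          have h3 : 0 ≤ (n : ℝ) ^ 3 * energy f := by positivity
          nlinarith
        have := mul_le_mul_of_nonneg_left h2 hoc0
        linarith
    _ = Fintype.card (Param n r) * (138 * n ^ 2 * (n + r ^ 2)) * energy f := by
        simp only [Finset.sum_const, Finset.card_univ, Fintype.card_fin, nsmul_eq_mul,
          Fintype.card_prod, Nat.cast_mul, ← hoc]
        ring

end Conf

namespace Conf

variable {n d r : ℕ} [NeZero n]

/-- At most a proportion `1 / (n - 2)` of the base configurations has another given piece in a
given column. -/
theorem card_column_le (hn : 2 ≤ n) (i j : Fin d) (hj : j ≠ i) (a : ZMod n) :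
    (n - 2) * (univ.filter fun s : Base n i => (tile s.1 j - tile s.1 i).1 = a).card ≤
      Fintype.card (Base n i) := by
  have hne : Fact (1 < n) := ⟨hn⟩
  have hji : j.castSucc ≠ i.castSucc := fun h => hj (Fin.castSucc_injective d h)
  have hjl : j.castSucc ≠ Fin.last d := (Fin.castSucc_lt_last j).ne
  set A : Finset (ZMod n) := (univ.erase 0).erase 1 with hA
  have hAc : A.card = n - 2 := by
    rw [hA, Finset.card_erase_of_mem (by simp), Finset.card_erase_of_mem (Finset.mem_univ _),
      Finset.card_univ, ZMod.card]
    omega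
  have haux : ∀ (s : Base n i) (a' : ZMod n), a' ∈ A →
      tile s.1 i ≠ tile s.1 j + (a' - (tile s.1 j - tile s.1 i).1, 0) ∧
      blank s.1 ≠ tile s.1 j + (a' - (tile s.1 j - tile s.1 i).1, 0) := by
    intro s a' ha'
    simp only [hA, Finset.mem_erase, Finset.mem_univ, and_true] at ha'
    constructor
    · intro h
      have h1 := congrArg Prod.fst h
      simp only [Prod.fst_add, Prod.fst_sub] at h1
      exact ha'.2 (by linear_combination -h1)
    · intro h
      rw [blank_eq i s.1, s.2] at h
      have h1 := congrArg Prod.fst h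
      simp only [Prod.fst_add, Prod.fst_sub] at h1
      exact ha'.1 (by linear_combination -h1)
  set P : Conf n d → ZMod n → Conf n d := fun s a' =>
    permute (Equiv.swap (tile s j) (tile s j + (a' - (tile s j - tile s i).1, 0))) s with hP
  have hPi : ∀ (s : Base n i) (a' : ZMod n), a' ∈ A → tile (P s.1 a') i = tile s.1 i ∧
      blank (P s.1 a') = blank s.1 ∧
      tile (P s.1 a') j = tile s.1 j + (a' - (tile s.1 j - tile s.1 i).1, 0) := by
    intro s a' ha'
    obtain ⟨h1, h2⟩ := haux s a' ha'
    refine ⟨Equiv.swap_apply_of_ne_of_ne (fun h => hji (s.1.2 h).symm) h1,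
      Equiv.swap_apply_of_ne_of_ne (fun h => hjl (s.1.2 h).symm) h2,
      Equiv.swap_apply_left _ _⟩
  rw [← hAc, ← Finset.card_product, ← Finset.card_univ]
  refine Finset.card_le_card_of_injOn
    (fun z => if h : z.1 ∈ A then ⟨P z.2.1 z.1, by
      obtain ⟨h1, h2, -⟩ := hPi z.2 z.1 h
      have := z.2.2
      rw [offset] at this ⊢
      rw [h2]
      rw [tile] at h1
      rw [h1, this]⟩ else z.2) (fun _ _ => Finset.mem_coe.mpr (Finset.mem_univ _)) ?_
  rintro ⟨a', s⟩ h ⟨b', t⟩ h' he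
  simp only [Finset.coe_product, Set.mem_prod, Finset.mem_coe, Finset.mem_filter,
    Finset.mem_univ, true_and] at h h'
  simp only [h.1, h'.1, dif_pos, Subtype.mk.injEq] at he
  obtain ⟨s1, s2, s3⟩ := hPi s a' h.1
  obtain ⟨t1, t2, t3⟩ := hPi t b' h'.1
  have hti : tile s.1 i = tile t.1 i := by rw [← s1, ← t1, he]
  have htj : tile s.1 j + (a' - (tile s.1 j - tile s.1 i).1, 0) =
      tile t.1 j + (b' - (tile t.1 j - tile t.1 i).1, 0) := by rw [← s3, ← t3, he]
  have hab : a' = b' := by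
    have h1 := congrArg Prod.fst htj
    have h2 := congrArg Prod.fst hti
    simp only [Prod.fst_add, Prod.fst_sub] at h1
    linear_combination h1 - h2
  have htj' : tile s.1 j = tile t.1 j := by
    have h1 := h.2
    have h2 := h'.2
    rw [h1, h2, hab] at htj
    exact add_right_cancel htj
  have hst : s.1 = t.1 := by
    have : ∀ s : Conf n d, permute (Equiv.swap (tile s j) (tile s j +
        (a' - (tile s j - tile s i).1, 0))) (P s a') = s := by
      intro s
      apply Subtype.ext
      funext k
      simp [hP, permute]
    rw [← this s.1, ← this t.1]
    rw [htj', hti, he, hab]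
  rw [hab, Subtype.ext hst]

open Classical in
/-- Few steps of given length move another given piece. -/
theorem card_vstep_ne_le (hn : 4 ≤ n) (hr : r ≤ n) (i j : Fin d) (hj : j ≠ i) :
    (n : ℝ) * (univ.filter fun q : Conf n d × Param n r =>
      tile (vstep (by omega) i q).1 j ≠ tile q.1 j).card ≤
      12 * (Fintype.card (Conf n d) * Fintype.card (Param n r)) := by
  have hn2 : 2 ≤ n := by omega
  set oc : ℝ := ((Fintype.card (Off n) : ℕ) : ℝ) with hoc
  set bc : ℝ := ((Fintype.card (Base n i) : ℕ) : ℝ) with hbc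
  set E : Base n i → ZMod n × ZMod n := fun s => tile s.1 j - tile s.1 i with hE
  -- indicator functions
  set col : ZMod n → Base n i → ℝ := fun a s => if (E s).1 = a then 1 else 0 with hcol
  set row : Base n i → Off n → ℝ := fun s δ => if (E s).2 = δ.1.2 then 1 else 0 with hrow
  have col0 : ∀ a s, 0 ≤ col a s := fun a s => by simp only [hcol]; split_ifs <;> norm_num
  have row0 : ∀ s δ, 0 ≤ row s δ := fun s δ => by simp only [hrow]; split_ifs <;> norm_num
  have hcolsum : ∀ a, n * ∑ s, col a s ≤ 2 * bc := by
    intro a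
    have h1 := card_column_le hn2 i j hj a
    have h2 : ∑ s, col a s =
        ((univ.filter fun s : Base n i => (tile s.1 j - tile s.1 i).1 = a).card : ℝ) := by
      simp [hcol, hE]
    rw [h2]
    have h3 : ((n : ℝ) - 2) * ((univ.filter fun s : Base n i =>
        (tile s.1 j - tile s.1 i).1 = a).card : ℝ) ≤ bc := by
      rw [hbc]
      have : ((n - 2 : ℕ) : ℝ) = n - 2 := by push_cast [Nat.cast_sub hn2]; ring
      rw [← this]
      exact_mod_cast h1
    have h4 : (4 : ℝ) ≤ n := by exact_mod_cast hn
    nlinarith [(Nat.cast_nonneg ((univ.filter fun s : Base n i =>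
        (tile s.1 j - tile s.1 i).1 = a).card) : (0 : ℝ) ≤ _)]
  have hrowsum : ∀ s, ∑ δ, row s δ ≤ n := by
    intro s
    have h2 : ∑ δ, row s δ = ((univ.filter fun δ : Off n => (E s).2 = δ.1.2).card : ℝ) := by
      simp [hrow]
    rw [h2]
    have h3 : (univ.filter fun δ : Off n => (E s).2 = δ.1.2).card ≤
        (univ : Finset (ZMod n)).card := by
      refine Finset.card_le_card_of_injOn (fun δ => δ.1.1)
        (fun _ _ => Finset.mem_coe.mpr (Finset.mem_univ _)) ?_
      intro δ hδ δ' hδ' h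
      simp only [Finset.coe_filter, Finset.mem_univ, true_and, Set.mem_ofPred_eq] at hδ hδ'
      exact Subtype.ext (Prod.ext h (hδ.symm.trans hδ'))
    rw [Finset.card_univ, ZMod.card] at h3
    exact_mod_cast h3
  have hoc2 : (n : ℝ) ^ 2 ≤ 2 * oc := by
    have h1 := card_off_add_one (n := n)
    have h2 : n ^ 2 ≤ 2 * Fintype.card (Off n) := by nlinarith
    rw [hoc]
    exact_mod_cast h2
  have hoc0 : 0 ≤ oc := Nat.cast_nonneg _
  have hbc0 : 0 ≤ bc := Nat.cast_nonneg _
  -- the pointwise bound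
  have pt : ∀ (b : Fin r) (δ' : Off n) (s : Base n i) (δ : Off n),
      (if tile (vstep hn2 i (walk δ.1 s.1, ((b, δ') : Param n r))).1 j ≠ tile (walk δ.1 s.1) j
        then (1 : ℝ) else 0) ≤ (2 * col 1 s + col 0 s + row s δ) +
          (col 1 ((pushBase hn2 i ^ (b : ℕ)) s) + row ((pushBase hn2 i ^ (b : ℕ)) s) δ') := by
    intro b δ' s δ
    by_contra hcon
    have c1 := col0 1 s
    have c2 := col0 0 s
    have c3 := row0 s δ
    have c4 := col0 1 ((pushBase hn2 i ^ (b : ℕ)) s)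
    have c5 := row0 ((pushBase hn2 i ^ (b : ℕ)) s) δ'
    split_ifs at hcon with hif
    · have d1 : (E s).1 ≠ 1 := fun h => hcon (by
        have : col 1 s = 1 := if_pos h
        linarith)
      have d2 : (E s).1 ≠ 0 := fun h => hcon (by
        have : col 0 s = 1 := if_pos h
        linarith)
      have d3 : (E s).2 ≠ δ.1.2 := fun h => hcon (by
        have : row s δ = 1 := if_pos h
        linarith)
      have d4 : (E ((pushBase hn2 i ^ (b : ℕ)) s)).1 ≠ 1 := fun h => hcon (by
        have : col 1 ((pushBase hn2 i ^ (b : ℕ)) s) = 1 := if_pos h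
        linarith)
      have d5 : (E ((pushBase hn2 i ^ (b : ℕ)) s)).2 ≠ δ'.1.2 := fun h => hcon (by
        have : row ((pushBase hn2 i ^ (b : ℕ)) s) δ' = 1 := if_pos h
        linarith)
      apply hif
      obtain ⟨h1, -, h2⟩ := push_pow_apply hn2 i s.1 s.2 b (b.2.trans_le hr)
      rw [vstep_spec]
      simp only [hE, tile, pushBase_pow_val] at d1 d2 d3 d4 d5
      have w1 := (walk_other i δ.1 s.1 s.2 j).2 d1 d3
      have w2 := (walk_other i δ'.1 _ h1 j).2 d4 d5
      rw [tile, tile, w1, w2]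
      rcases h2 j hj with ⟨l, -, -, ⟨h, -⟩ | ⟨h, -⟩⟩ | ⟨-, h⟩
      · exact absurd (by rw [h]; simp) d1
      · exact absurd (by rw [h]; simp) d2
      · exact h
    · exact hcon (by linarith)
  have key : ∀ (b : Fin r), ∑ δ' : Off n, ∑ x : Conf n d,
      (if tile (vstep hn2 i (x, ((b, δ') : Param n r))).1 j ≠ tile x j then (1 : ℝ) else 0) ≤
      oc * (oc * (2 * ∑ s, col 1 s + ∑ s, col 0 s) + bc * n) + oc * (oc * ∑ s, col 1 s + bc * n)
      := by
    intro b
    calc ∑ δ' : Off n, ∑ x : Conf n d,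
      (if tile (vstep hn2 i (x, ((b, δ') : Param n r))).1 j ≠ tile x j then (1 : ℝ) else 0)
        ≤ ∑ δ' : Off n, ∑ s : Base n i, ∑ δ : Off n, ((2 * col 1 s + col 0 s + row s δ) +
          (col 1 ((pushBase hn2 i ^ (b : ℕ)) s) + row ((pushBase hn2 i ^ (b : ℕ)) s) δ')) := by
          refine Finset.sum_le_sum fun δ' _ => ?_
          rw [sum_eq_sum_base hn2 i]
          exact Finset.sum_le_sum fun s _ => Finset.sum_le_sum fun δ _ => pt b δ' s δ
      _ = oc * (oc * (2 * ∑ s, col 1 s + ∑ s, col 0 s) + ∑ s, ∑ δ, row s δ) +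
          oc * (oc * (∑ s, col 1 ((pushBase hn2 i ^ (b : ℕ)) s)) +
            ∑ s, ∑ δ', row ((pushBase hn2 i ^ (b : ℕ)) s) δ') := by
          rw [Finset.sum_comm (f := fun s δ' => row ((pushBase hn2 i ^ (b : ℕ)) s) δ')]
          simp only [Finset.sum_add_distrib, Finset.sum_const, Finset.card_univ, nsmul_eq_mul,
            ← hoc, ← Finset.mul_sum]
          ring
      _ ≤ _ := by
          rw [Equiv.sum_comp (pushBase hn2 i ^ (b : ℕ)) (fun s => col 1 s),
            Equiv.sum_comp (pushBase hn2 i ^ (b : ℕ)) (fun s => ∑ δ', row s δ')]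
          have : ∑ s, ∑ δ, row s δ ≤ bc * n := by
            calc ∑ s, ∑ δ, row s δ ≤ ∑ _s : Base n i, (n : ℝ) :=
                  Finset.sum_le_sum fun s _ => hrowsum s
              _ = bc * n := by simp [hbc]
          gcongr
  have hconf : (Fintype.card (Conf n d) : ℝ) = bc * oc := by
    rw [Fintype.card_congr (splitBase hn2 i), Fintype.card_prod, Nat.cast_mul]
  have hpar : (Fintype.card (Param n r) : ℝ) = r * oc := by
    rw [Fintype.card_prod, Fintype.card_fin, Nat.cast_mul]
  have hcount : ((univ.filter fun q : Conf n d × Param n r =>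
      tile (vstep hn2 i q).1 j ≠ tile q.1 j).card : ℝ) =
      ∑ b : Fin r, ∑ δ' : Off n, ∑ x : Conf n d,
      (if tile (vstep hn2 i (x, ((b, δ') : Param n r))).1 j ≠ tile x j then (1 : ℝ) else 0) := by
    rw [Finset.card_filter, Nat.cast_sum, Fintype.sum_prod_type_right, Fintype.sum_prod_type]
    simp only [Nat.cast_ite, Nat.cast_one, Nat.cast_zero]
  rw [hcount, hconf, hpar]
  have h1 := hcolsum 1
  have h0 := hcolsum 0
  calc (n : ℝ) * _ ≤ n * ∑ _b : Fin r, (oc * (oc * (2 * ∑ s, col 1 s + ∑ s, col 0 s) + bc * n) +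
        oc * (oc * ∑ s, col 1 s + bc * n)) := by
        gcongr with b
        exact key b
    _ = r * oc * (oc * (3 * (n * ∑ s, col 1 s) + (n * ∑ s, col 0 s)) + 2 * bc * n ^ 2) := by
        simp only [Finset.sum_const, Finset.card_univ, Fintype.card_fin, nsmul_eq_mul]
        ring
    _ ≤ r * oc * (oc * (3 * (2 * bc) + 2 * bc) + 2 * bc * (2 * oc)) := by
        gcongr
    _ = 12 * (bc * oc * (r * oc)) := by ring

end Conf

namespace Conf

variable {n d r : ℕ}

/-- Exchanging the two coordinates of the board. -/
def flip : Equiv.Perm (Conf n d) where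
  toFun := permute (Equiv.prodComm _ _)
  invFun := permute (Equiv.prodComm _ _)
  left_inv _ := rfl
  right_inv _ := rfl

theorem flip_flip (x : Conf n d) : flip (flip x) = x := rfl

theorem tile_flip (x : Conf n d) (j : Fin d) : tile (flip x) j = (tile x j).swap := rfl

theorem offset_flip (x : Conf n d) (j : Fin d) : offset j (flip x) = (offset j x).swap := rfl

theorem move_flip (c : ZMod n × ZMod n) (x : Conf n d) :
    move c (flip x) = flip (move c.swap x) := by
  apply Subtype.ext
  funext j
  change Equiv.swap (x.blank.swap) (x.blank.swap + c) (x.1 j).swap =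
    (Equiv.swap x.blank (x.blank + c.swap) (x.1 j)).swap
  have h : (x.blank + c.swap).swap = x.blank.swap + c := rfl
  rw [← h]
  exact Function.Injective.swap_apply (f := (Prod.swap : ZMod n × ZMod n → ZMod n × ZMod n))
    Prod.swap_injective _ _ _

theorem mem_perturbations_swap {v : ZMod n × ZMod n} (h : v ∈ perturbations n) :
    v.swap ∈ perturbations n := by
  simp only [perturbations, Finset.mem_image, Finset.mem_product] at h ⊢
  obtain ⟨z, ⟨h1, h2⟩, rfl⟩ := h
  exact ⟨(z.2, z.1), ⟨h2, h1⟩, rfl⟩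

variable [NeZero n]

theorem energy_flip (f : Conf n d → ℝ) : energy (f ∘ flip) = energy f := by
  have h : ∀ c : ZMod n × ZMod n, ∑ x, ((f ∘ flip) (move c x) - (f ∘ flip) x) ^ 2 =
      ∑ x, (f (move c.swap x) - f x) ^ 2 := by
    intro c
    rw [← Equiv.sum_comp flip]
    refine Finset.sum_congr rfl fun x _ => ?_
    simp only [Function.comp_apply, move_flip, flip_flip]
  rw [energy, energy, Finset.sum_congr rfl fun c _ => h c]
  refine Finset.sum_nbij' Prod.swap Prod.swap ?_ ?_ (fun _ _ => rfl) (fun _ _ => rfl)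
    (fun _ _ => rfl)
  all_goals
    intro c hc
    simp only [displacements, Finset.mem_insert, Finset.mem_singleton] at hc ⊢
    rcases hc with rfl | rfl | rfl | rfl | rfl <;> simp

/-- The vector of length `b` in the vertical or horizontal direction. -/
def shift (n : ℕ) (h : Bool) (b : ℕ) : ZMod n × ZMod n := if h then (b, 0) else (0, b)

/-- The single step for the piece `κ.1`, horizontal if `κ.2` and vertical otherwise. -/
noncomputable def step (hn : 2 ≤ n) (κ : Fin d × Bool) (q : Conf n d × Param n r) :
    Conf n d × Param n r :=
  if κ.2 then (flip (vstep hn κ.1 (flip q.1, q.2)).1, (vstep hn κ.1 (flip q.1, q.2)).2)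
  else vstep hn κ.1 q

theorem step_injective (hn : 2 ≤ n) (κ : Fin d × Bool) :
    Function.Injective (step hn κ : Conf n d × Param n r → _) := by
  obtain ⟨i, h | h⟩ := κ
  · exact vstep_injective hn i
  · intro q q' h
    simp only [step, Prod.mk.injEq, EmbeddingLike.apply_eq_iff_eq, if_true] at h
    have h1 := vstep_injective hn i (Prod.ext h.1 h.2)
    simp only [Prod.mk.injEq, EmbeddingLike.apply_eq_iff_eq] at h1
    exact Prod.ext h1.1 h1.2

theorem step_self (hn : 2 ≤ n) (hr : r ≤ n) (κ : Fin d × Bool) (q : Conf n d × Param n r) :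
    tile (step hn κ q).1 κ.1 = tile q.1 κ.1 + shift n κ.2 q.2.1 ∧
    offset κ.1 (step hn κ q).1 = if κ.2 then q.2.2.1.swap else q.2.2.1 := by
  obtain ⟨i, h | h⟩ := κ
  · exact vstep_self hn hr i q
  · obtain ⟨h1, h2⟩ := vstep_self hn hr i (flip q.1, q.2)
    simp only [step, shift, if_true, tile_flip, offset_flip] at h1 h2 ⊢
    rw [h1, h2]
    exact ⟨rfl, rfl⟩

theorem step_other (hn : 2 ≤ n) (hr : r ≤ n) (κ : Fin d × Bool) (j : Fin d) (hj : j ≠ κ.1)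
    (q : Conf n d × Param n r) : tile (step hn κ q).1 j - tile q.1 j ∈ perturbations n := by
  obtain ⟨i, h | h⟩ := κ
  · exact vstep_other hn hr i j hj q
  · exact mem_perturbations_swap (vstep_other hn hr i j hj (flip q.1, q.2))

theorem sum_sq_step_le (hn : 2 ≤ n) (κ : Fin d × Bool) (f : Conf n d → ℝ) :
    ∑ q : Conf n d × Param n r, (f (step hn κ q).1 - f q.1) ^ 2 ≤
      Fintype.card (Param n r) * (138 * n ^ 2 * (n + r ^ 2)) * energy f := by
  obtain ⟨i, h | h⟩ := κ
  · exact sum_sq_vstep_le hn i f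
  · have h := sum_sq_vstep_le (r := r) hn i (f ∘ flip)
    rw [energy_flip, ← Equiv.sum_comp ((flip (n := n) (d := d)).prodCongr (Equiv.refl _))] at h
    exact h

open Classical in
theorem card_step_ne_le (hn : 4 ≤ n) (hr : r ≤ n) (κ : Fin d × Bool) (j : Fin d) (hj : j ≠ κ.1) :
    (n : ℝ) * (univ.filter fun q : Conf n d × Param n r =>
      tile (step (by omega) κ q).1 j ≠ tile q.1 j).card ≤
      12 * (Fintype.card (Conf n d) * Fintype.card (Param n r)) := by
  obtain ⟨i, h | h⟩ := κ
  · exact card_vstep_ne_le hn hr i j hj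
  · refine le_trans (le_of_eq ?_) (card_vstep_ne_le hn hr i j hj)
    congr 2
    refine Finset.card_equiv ((flip (n := n) (d := d)).prodCongr (Equiv.refl _)) fun q => ?_
    simp only [Finset.mem_filter, Finset.mem_univ, true_and, step, if_true, tile_flip]
    refine not_congr ⟨fun h => ?_, fun h => ?_⟩
    · have := congrArg Prod.swap h
      exact this
    · have := congrArg Prod.swap h
      exact this

end Conf

namespace Conf

variable {n d r : ℕ} [NeZero n]

/-- The parameters of all the steps of a run. -/
abbrev Params (n d r : ℕ) := Fin d × Bool → Param n r

/-- The run which starts at `s` and performs the steps prescribed by the schedule `κ`. -/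
noncomputable def traj (hn : 2 ≤ n) (κ : ℕ → Fin d × Bool) (ω : Params n d r) (s : Conf n d) :
    ℕ → Conf n d
  | 0 => s
  | k + 1 => (step hn (κ k) (traj hn κ ω s k, ω (κ k))).1

/-- The single step as a permutation of the pairs of a configuration and parameters. -/
noncomputable def stepPerm (hn : 2 ≤ n) (c : Fin d × Bool) :
    Equiv.Perm (Conf n d × Params n d r) :=
  Equiv.ofBijective (fun q => ((step hn c (q.1, q.2 c)).1,
    Function.update q.2 c (step hn c (q.1, q.2 c)).2)) <| by
    rw [← Finite.injective_iff_bijective]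
    rintro ⟨s, ω⟩ ⟨s', ω'⟩ h
    simp only [Prod.mk.injEq] at h
    obtain ⟨h1, h2⟩ := h
    have h3 := congrFun h2 c
    simp only [Function.update_self] at h3
    have h4 := step_injective hn c (Prod.ext h1 h3)
    simp only [Prod.mk.injEq] at h4
    refine Prod.ext h4.1 (funext fun e => ?_)
    by_cases he : e = c
    · rw [he]
      exact h4.2
    · have h5 := congrFun h2 e
      simpa [Function.update_of_ne he] using h5

/-- The run as a permutation. -/
noncomputable def trajPerm (hn : 2 ≤ n) (κ : ℕ → Fin d × Bool) :
    ℕ → Equiv.Perm (Conf n d × Params n d r)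
  | 0 => 1
  | k + 1 => stepPerm hn (κ k) * trajPerm hn κ k

theorem trajPerm_spec (hn : 2 ≤ n) (κ : ℕ → Fin d × Bool) {m : ℕ}
    (hκ : Set.InjOn κ (Set.Iio m)) (s : Conf n d) (ω : Params n d r) (k : ℕ) (hk : k ≤ m) :
    (trajPerm hn κ k (s, ω)).1 = traj hn κ ω s k ∧
    ∀ c, (∀ l < k, κ l ≠ c) → (trajPerm hn κ k (s, ω)).2 c = ω c := by
  induction k with
  | zero => exact ⟨rfl, fun _ _ => rfl⟩
  | succ k ih =>
    obtain ⟨h1, h2⟩ := ih (by omega)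
    have h3 : (trajPerm hn κ k (s, ω)).2 (κ k) = ω (κ k) := by
      refine h2 _ fun l hl h => ?_
      have := hκ (Set.mem_Iio.mpr (by omega)) (Set.mem_Iio.mpr (by omega)) h
      omega
    have h4 : trajPerm hn κ (k + 1) (s, ω) =
        stepPerm hn (κ k) (trajPerm hn κ k (s, ω)) := rfl
    rw [h4]
    constructor
    · change (step hn (κ k) ((trajPerm hn κ k (s, ω)).1,
        (trajPerm hn κ k (s, ω)).2 (κ k))).1 = _
      rw [h1, h3]
      rfl
    · intro c hc
      change Function.update (trajPerm hn κ k (s, ω)).2 (κ k) _ c = _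
      rw [Function.update_of_ne (hc k (by omega)).symm]
      exact h2 c fun l hl => hc l (by omega)

theorem card_mul_sum_eval {ι P : Type*} [Fintype ι] [DecidableEq ι] [Fintype P] (c : ι)
    (F : P → ℝ) : Fintype.card P * ∑ ω : ι → P, F (ω c) = Fintype.card (ι → P) * ∑ p, F p := by
  have h1 : ∑ ω : ι → P, F (ω c) = ∑ q : P × ({j // j ≠ c} → P), F q.1 :=
    Equiv.sum_comp (Equiv.funSplitAt c P) fun q => F q.1
  rw [h1, Fintype.card_congr (Equiv.funSplitAt c P), Fintype.sum_prod_type, Fintype.card_prod]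
  simp only [Finset.sum_const, nsmul_eq_mul, ← Finset.mul_sum, Finset.card_univ]
  push_cast
  ring

theorem card_mul_sum_traj (hn : 2 ≤ n) (κ : ℕ → Fin d × Bool) {m : ℕ}
    (hκ : Set.InjOn κ (Set.Iio m)) (k : ℕ) (hk : k < m) (G : Conf n d × Param n r → ℝ) :
    Fintype.card (Param n r) * ∑ s, ∑ ω : Params n d r, G (traj hn κ ω s k, ω (κ k)) =
      Fintype.card (Params n d r) * ∑ q, G q := by
  calc _ = Fintype.card (Param n r) * ∑ q : Conf n d × Params n d r,
          G ((trajPerm hn κ k q).1, (trajPerm hn κ k q).2 (κ k)) := by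
        rw [Fintype.sum_prod_type]
        congr 1
        refine Finset.sum_congr rfl fun s _ => Finset.sum_congr rfl fun ω _ => ?_
        obtain ⟨h1, h2⟩ := trajPerm_spec hn κ hκ s ω k hk.le
        rw [h1, h2]
        intro l hl h
        have := hκ (Set.mem_Iio.mpr (by omega)) (Set.mem_Iio.mpr (by omega)) h
        omega
    _ = Fintype.card (Param n r) * ∑ q : Conf n d × Params n d r, G (q.1, q.2 (κ k)) := by
        congr 1
        exact Equiv.sum_comp (trajPerm hn κ k) fun q => G (q.1, q.2 (κ k))
    _ = _ := by
        rw [Fintype.sum_prod_type, Fintype.sum_prod_type, Finset.mul_sum, Finset.mul_sum]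
        exact Finset.sum_congr rfl fun s _ => card_mul_sum_eval (κ k) fun p => G (s, p)

theorem card_param_pos (hn : 2 ≤ n) (hr : 0 < r) : 0 < Fintype.card (Param n r) := by
  have : Fact (1 < n) := ⟨hn⟩
  have : NeZero r := ⟨hr.ne'⟩
  have : Nonempty (Off n) := ⟨⟨(1, 0), by simp⟩⟩
  exact Fintype.card_pos

/-- The comparison of a run with the Dirichlet form. -/
theorem sum_sq_traj_le (hn : 2 ≤ n) (hr : 0 < r) (κ : ℕ → Fin d × Bool) {m : ℕ}
    (hκ : Set.InjOn κ (Set.Iio m)) (f : Conf n d → ℝ) :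
    ∑ s, ∑ ω : Params n d r, (f (traj hn κ ω s m) - f s) ^ 2 ≤
      Fintype.card (Params n d r) * (m ^ 2 * (138 * n ^ 2 * (n + r ^ 2))) * energy f := by
  have hP : (0 : ℝ) < Fintype.card (Param n r) := by exact_mod_cast card_param_pos hn hr
  have pt : ∀ (s : Conf n d) (ω : Params n d r), (f (traj hn κ ω s m) - f s) ^ 2 ≤
      m * ∑ k ∈ range m, (f (traj hn κ ω s (k + 1)) - f (traj hn κ ω s k)) ^ 2 := by
    intro s ω
    have h1 := Finset.sum_range_sub (fun k => f (traj hn κ ω s k)) m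
    have h2 := sq_sum_le_card_mul_sum_sq (s := range m)
      (f := fun k => f (traj hn κ ω s (k + 1)) - f (traj hn κ ω s k))
    rw [h1, Finset.card_range] at h2
    exact h2
  have hk : ∀ k ∈ range m, ∑ s, ∑ ω : Params n d r,
      (f (traj hn κ ω s (k + 1)) - f (traj hn κ ω s k)) ^ 2 ≤
      Fintype.card (Params n d r) * (138 * n ^ 2 * (n + r ^ 2)) * energy f := by
    intro k hk
    have h1 := card_mul_sum_traj hn κ hκ k (Finset.mem_range.mp hk)
      (fun q : Conf n d × Param n r => (f (step hn (κ k) q).1 - f q.1) ^ 2)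
    have h2 := mul_le_mul_of_nonneg_left (sum_sq_step_le (r := r) hn (κ k) f)
      (Nat.cast_nonneg (α := ℝ) (Fintype.card (Params n d r)))
    rw [← h1] at h2
    refine le_of_mul_le_mul_left (h2.trans (le_of_eq ?_)) hP
    ring
  calc ∑ s, ∑ ω : Params n d r, (f (traj hn κ ω s m) - f s) ^ 2
      ≤ ∑ s, ∑ ω : Params n d r, m * ∑ k ∈ range m,
          (f (traj hn κ ω s (k + 1)) - f (traj hn κ ω s k)) ^ 2 :=
        Finset.sum_le_sum fun s _ => Finset.sum_le_sum fun ω _ => pt s ω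
    _ = m * ∑ k ∈ range m, ∑ s, ∑ ω : Params n d r,
          (f (traj hn κ ω s (k + 1)) - f (traj hn κ ω s k)) ^ 2 := by
        simp only [← Finset.mul_sum]
        congr 1
        rw [Finset.sum_comm' (t' := univ) (s' := fun _ => range m) (by simp)]
        refine Finset.sum_congr rfl fun s _ => ?_
        rw [Finset.sum_comm]
    _ ≤ m * ∑ _k ∈ range m,
          Fintype.card (Params n d r) * (138 * n ^ 2 * (n + r ^ 2)) * energy f := by
        gcongr with k hk'
        exact hk k hk'
    _ = _ := by
        simp
        ring

/-- The unintended displacement of the piece `j` during the step number `k`. -/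
noncomputable def err (hn : 2 ≤ n) (κ : ℕ → Fin d × Bool) (ω : Params n d r) (s : Conf n d)
    (k : ℕ) (j : Fin d) : ZMod n × ZMod n :=
  tile (traj hn κ ω s (k + 1)) j - tile (traj hn κ ω s k) j -
    if (κ k).1 = j then shift n (κ k).2 (ω (κ k)).1 else 0

theorem err_eq (hn : 2 ≤ n) (hr : r ≤ n) (κ : ℕ → Fin d × Bool) (ω : Params n d r)
    (s : Conf n d) (k : ℕ) (j : Fin d) : err hn κ ω s k j =
      if (κ k).1 = j then 0 else tile (traj hn κ ω s (k + 1)) j - tile (traj hn κ ω s k) j := by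
  rw [err]
  split_ifs with h
  · subst h
    rw [traj, (step_self hn hr (κ k) _).1]
    simp
  · simp

theorem err_mem (hn : 2 ≤ n) (hr : r ≤ n) (κ : ℕ → Fin d × Bool) (ω : Params n d r)
    (s : Conf n d) (k : ℕ) (j : Fin d) : err hn κ ω s k j ∈ perturbations n := by
  rw [err_eq hn hr]
  split_ifs with h
  · exact mem_perturbations (p := 0) (q := 0) (by simp) (by simp) (by ext <;> simp)
  · exact step_other hn hr (κ k) j (Ne.symm h) _

open Classical in
theorem card_bad_le (hn : 4 ≤ n) (hr0 : 0 < r) (hr : r ≤ n) (κ : ℕ → Fin d × Bool) {m : ℕ}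
    (hκ : Set.InjOn κ (Set.Iio m)) :
    (n : ℝ) * (∑ s : Conf n d, ∑ ω : Params n d r,
      if ∃ k < m, ∃ j, err (by omega) κ ω s k j ≠ 0 then (1 : ℝ) else 0) ≤
      12 * m * d * (Fintype.card (Conf n d) * Fintype.card (Params n d r)) := by
  have hn2 : 2 ≤ n := by omega
  have hP : (0 : ℝ) < Fintype.card (Param n r) := by exact_mod_cast card_param_pos hn2 hr0
  have key : ∀ k ∈ range m, ∀ j : Fin d, n * ∑ s : Conf n d, ∑ ω : Params n d r,
      (if err hn2 κ ω s k j ≠ 0 then (1 : ℝ) else 0) ≤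
      12 * (Fintype.card (Conf n d) * Fintype.card (Params n d r)) := by
    intro k hk j
    by_cases hj : (κ k).1 = j
    · have : ∀ (s : Conf n d) (ω : Params n d r), err hn2 κ ω s k j = 0 := fun s ω => by
        rw [err_eq hn2 hr, if_pos hj]
      simp only [this, ne_eq, not_true_eq_false, if_false, Finset.sum_const_zero, mul_zero]
      positivity
    · have h1 := card_mul_sum_traj hn2 κ hκ k (Finset.mem_range.mp hk)
        (fun q : Conf n d × Param n r => if tile (step hn2 (κ k) q).1 j ≠ tile q.1 j
          then (1 : ℝ) else 0)
      have h2 := card_step_ne_le hn hr (κ k) j (Ne.symm hj)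
      rw [Finset.card_filter, Nat.cast_sum] at h2
      simp only [Nat.cast_ite, Nat.cast_one, Nat.cast_zero] at h2
      have h3 := mul_le_mul_of_nonneg_left h2
        (Nat.cast_nonneg (α := ℝ) (Fintype.card (Params n d r)))
      rw [mul_left_comm, ← h1] at h3
      have h4 : ∑ s : Conf n d, ∑ ω : Params n d r,
          (if err hn2 κ ω s k j ≠ 0 then (1 : ℝ) else 0) =
          ∑ s : Conf n d, ∑ ω : Params n d r,
          (if tile (step hn2 (κ k) (traj hn2 κ ω s k, ω (κ k))).1 j ≠
            tile (traj hn2 κ ω s k, ω (κ k)).1 j then (1 : ℝ) else 0) := by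
        refine Finset.sum_congr rfl fun s _ => Finset.sum_congr rfl fun ω _ => ?_
        rw [err_eq hn2 hr, if_neg hj, traj]
        simp only [ne_eq, sub_eq_zero]
      rw [h4]
      refine le_of_mul_le_mul_left (le_trans (le_of_eq ?_) (h3.trans (le_of_eq ?_))) hP
      · ring
      · ring
  calc (n : ℝ) * (∑ s : Conf n d, ∑ ω : Params n d r,
      if ∃ k < m, ∃ j, err (by omega) κ ω s k j ≠ 0 then (1 : ℝ) else 0)
      ≤ n * ∑ s : Conf n d, ∑ ω : Params n d r, ∑ k ∈ range m, ∑ j : Fin d,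
        (if err hn2 κ ω s k j ≠ 0 then (1 : ℝ) else 0) := by
        gcongr with s _ ω _
        have h0 : ∀ k j, (0 : ℝ) ≤ if err hn2 κ ω s k j ≠ 0 then (1 : ℝ) else 0 := fun k j => by
          split_ifs <;> norm_num
        split_ifs with h
        · obtain ⟨k, hk, j, hj⟩ := h
          calc (1 : ℝ) = if err hn2 κ ω s k j ≠ 0 then (1 : ℝ) else 0 := (if_pos hj).symm
            _ ≤ ∑ j : Fin d, (if err hn2 κ ω s k j ≠ 0 then (1 : ℝ) else 0) :=
              Finset.single_le_sum (f := fun j => if err hn2 κ ω s k j ≠ 0 then (1 : ℝ) else 0)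
                (fun j _ => h0 k j) (Finset.mem_univ j)
            _ ≤ _ := Finset.single_le_sum
              (f := fun k => ∑ j : Fin d, if err hn2 κ ω s k j ≠ 0 then (1 : ℝ) else 0)
                (fun k _ => Finset.sum_nonneg fun j _ => h0 k j) (Finset.mem_range.mpr hk)
        · exact Finset.sum_nonneg fun k _ => Finset.sum_nonneg fun j _ => h0 k j
    _ = ∑ k ∈ range m, ∑ j : Fin d, n * ∑ s : Conf n d, ∑ ω : Params n d r,
        (if err hn2 κ ω s k j ≠ 0 then (1 : ℝ) else 0) := by
        simp only [← Finset.mul_sum]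
        congr 1
        calc _ = ∑ s : Conf n d, ∑ k ∈ range m, ∑ j : Fin d, ∑ ω : Params n d r,
              (if err hn2 κ ω s k j ≠ 0 then (1 : ℝ) else 0) := by
              refine Finset.sum_congr rfl fun s _ => ?_
              rw [Finset.sum_comm]
              refine Finset.sum_congr rfl fun k _ => ?_
              rw [Finset.sum_comm]
          _ = _ := by
              rw [Finset.sum_comm]
              refine Finset.sum_congr rfl fun k _ => ?_
              rw [Finset.sum_comm]
    _ ≤ ∑ _k ∈ range m, ∑ _j : Fin d,
          12 * ((Fintype.card (Conf n d) : ℝ) * Fintype.card (Params n d r)) :=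
        Finset.sum_le_sum fun k hk => Finset.sum_le_sum fun j _ => key k hk j
    _ = _ := by
        simp
        ring

theorem tile_traj (hn : 2 ≤ n) (κ : ℕ → Fin d × Bool) {m : ℕ}
    (hκ : Set.BijOn κ (Set.Iio m) Set.univ) (ω : Params n d r) (s : Conf n d) (j : Fin d) :
    tile (traj hn κ ω s m) j = tile s j + ∑ k ∈ range m, err hn κ ω s k j +
      ((((ω (j, true)).1 : ℕ) : ZMod n), (((ω (j, false)).1 : ℕ) : ZMod n)) := by
  have h1 := Finset.sum_range_sub (fun k => tile (traj hn κ ω s k) j) m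
  have h2 : ∑ k ∈ range m, err hn κ ω s k j = tile (traj hn κ ω s m) j - tile s j -
      ∑ k ∈ range m, if (κ k).1 = j then shift n (κ k).2 (ω (κ k)).1 else 0 := by
    simp only [err, Finset.sum_sub_distrib] at h1 ⊢
    rw [h1]
    rfl
  have h3 : (∑ k ∈ range m, if (κ k).1 = j then shift n (κ k).2 (ω (κ k)).1 else 0) =
      ∑ c : Fin d × Bool, if c.1 = j then shift n c.2 (ω c).1 else 0 := by
    refine Finset.sum_bij (fun k _ => κ k) (fun _ _ => Finset.mem_univ _) ?_ ?_ fun _ _ => rfl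
    · intro a ha b hb h
      exact hκ.injOn (by simpa using ha) (by simpa using hb) h
    · intro c _
      obtain ⟨k, hk, h⟩ := hκ.surjOn (Set.mem_univ c)
      exact ⟨k, by simpa using hk, h⟩
  rw [h2, h3, Fintype.sum_prod_type]
  simp only [Fintype.sum_bool]
  rw [Finset.sum_eq_single j (fun b _ hb => by simp [hb]) (by simp)]
  ext
  · simp only [shift, Prod.fst_add, Prod.fst_sub, if_true, Bool.false_eq_true, if_false]
    ring
  · simp only [shift, Prod.snd_add, Prod.snd_sub, if_true, Bool.false_eq_true, if_false]
    ring

/-- A run is determined by its end points, the unintended displacements and all but one of the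
relative positions. -/
theorem params_ext (hn : 2 ≤ n) (hr : r ≤ n) (κ : ℕ → Fin d × Bool) {m : ℕ}
    (hκ : Set.BijOn κ (Set.Iio (m + 1)) Set.univ) (ω ω' : Params n d r) (s : Conf n d)
    (h : traj hn κ ω s (m + 1) = traj hn κ ω' s (m + 1))
    (he : ∀ k < m + 1, ∀ j, err hn κ ω s k j = err hn κ ω' s k j)
    (hδ : ∀ c, c ≠ κ m → (ω c).2 = (ω' c).2) : ω = ω' := by
  have hb : ∀ j, ((((ω (j, true)).1 : ℕ) : ZMod n), (((ω (j, false)).1 : ℕ) : ZMod n)) =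
      ((((ω' (j, true)).1 : ℕ) : ZMod n), (((ω' (j, false)).1 : ℕ) : ZMod n)) := by
    intro j
    have h1 := tile_traj hn κ hκ ω s j
    rw [h, tile_traj hn κ hκ ω' s j,
      Finset.sum_congr rfl fun k hk => he k (Finset.mem_range.mp hk) j] at h1
    exact (add_left_cancel h1).symm
  have hcast : ∀ a b : Fin r, ((a : ℕ) : ZMod n) = ((b : ℕ) : ZMod n) → a = b := by
    intro a b hab
    have h1 := congrArg ZMod.val hab
    rw [ZMod.val_natCast, ZMod.val_natCast, Nat.mod_eq_of_lt (a.2.trans_le hr),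
      Nat.mod_eq_of_lt (b.2.trans_le hr)] at h1
    exact Fin.ext h1
  funext c
  refine Prod.ext ?_ ?_
  · obtain ⟨j, b⟩ := c
    have h1 := hb j
    simp only [Prod.mk.injEq] at h1
    cases b
    · exact hcast _ _ h1.2
    · exact hcast _ _ h1.1
  · by_cases hc : c = κ m
    · subst hc
      have h1 := (step_self hn hr (κ m) (traj hn κ ω s m, ω (κ m))).2
      have h2 := (step_self hn hr (κ m) (traj hn κ ω' s m, ω' (κ m))).2
      simp only [traj] at h
      rw [h, h2] at h1
      apply Subtype.ext
      split_ifs at h1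
      · exact (Prod.swap_injective h1).symm
      · exact h1.symm
    · exact hδ c hc

theorem card_off_functions (c : Fin d × Bool) :
    Fintype.card (Off n) * Fintype.card ({e : Fin d × Bool // e ≠ c} → Off n) =
      Fintype.card (Off n) ^ (2 * d) := by
  rw [← Fintype.card_prod, ← Fintype.card_congr (Equiv.funSplitAt c (Off n)),
    Fintype.card_fun, Fintype.card_prod, Fintype.card_fin, Fintype.card_bool, mul_comm d]

open Classical in
theorem card_fiber_le (hn : 2 ≤ n) (hr : r ≤ n) (κ : ℕ → Fin d × Bool) {m : ℕ}
    (hκ : Set.BijOn κ (Set.Iio (m + 1)) Set.univ) (s s' : Conf n d) :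
    Fintype.card (Off n) *
      (univ.filter fun ω : Params n d r => traj hn κ ω s (m + 1) = s').card ≤
      Fintype.card (Off n) ^ (2 * d) * 49 ^ ((m + 1) * d) := by
  have h1 : (univ.filter fun ω : Params n d r => traj hn κ ω s (m + 1) = s').card ≤
      (univ : Finset (({e : Fin d × Bool // e ≠ κ m} → Off n) ×
        (Fin (m + 1) → Fin d → perturbations n))).card := by
    refine Finset.card_le_card_of_injOn
      (fun ω => (fun e => (ω e.1).2, fun k j => ⟨err hn κ ω s k j, err_mem hn hr κ ω s k j⟩))
      (fun _ _ => Finset.mem_coe.mpr (Finset.mem_univ _)) ?_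
    intro ω hω ω' hω' h
    simp only [Finset.coe_filter, Finset.mem_univ, true_and, Set.mem_ofPred_eq] at hω hω'
    simp only [Prod.mk.injEq] at h
    refine params_ext hn hr κ hκ ω ω' s (hω.trans hω'.symm) (fun k hk j => ?_) fun c hc => ?_
    · have := congrFun (congrFun h.2 ⟨k, hk⟩) j
      simpa using this
    · exact congrFun h.1 ⟨c, hc⟩
  rw [Finset.card_univ, Fintype.card_prod] at h1
  rw [← card_off_functions (κ m), mul_assoc]
  refine Nat.mul_le_mul_left _ (h1.trans (Nat.mul_le_mul_left _ ?_))
  rw [Fintype.card_fun, Fintype.card_fun, Fintype.card_coe, Fintype.card_fin, Fintype.card_fin,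
    ← pow_mul, mul_comm d]
  exact Nat.pow_le_pow_left card_perturbations_le _

open Classical in
theorem card_good_fiber_le (hn : 2 ≤ n) (hr : r ≤ n) (κ : ℕ → Fin d × Bool) {m : ℕ}
    (hκ : Set.BijOn κ (Set.Iio (m + 1)) Set.univ) (s s' : Conf n d) :
    Fintype.card (Off n) * (univ.filter fun ω : Params n d r =>
      traj hn κ ω s (m + 1) = s' ∧ ¬ ∃ k < m + 1, ∃ j, err hn κ ω s k j ≠ 0).card ≤
      Fintype.card (Off n) ^ (2 * d) := by
  rw [← card_off_functions (κ m)]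
  refine Nat.mul_le_mul_left _ ?_
  rw [← Finset.card_univ]
  refine Finset.card_le_card_of_injOn (fun ω e => (ω e.1).2)
    (fun _ _ => Finset.mem_coe.mpr (Finset.mem_univ _)) ?_
  intro ω hω ω' hω' h
  simp only [Finset.coe_filter, Finset.mem_univ, true_and, Set.mem_ofPred_eq] at hω hω'
  push Not at hω hω'
  refine params_ext hn hr κ hκ ω ω' s (hω.1.trans hω'.1.symm) (fun k hk j => ?_) fun c hc => ?_
  · rw [hω.2 k hk j, hω'.2 k hk j]
  · exact congrFun h ⟨c, hc⟩

end Conf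

section Comparison

variable {X Ω : Type*} [Fintype X] [Fintype Ω] [DecidableEq X]

theorem sum_mul_eq_sum_kernel (t : Ω → X → X) (f : X → ℝ) :
    ∑ s, ∑ ω, f s * f (t ω s) =
      ∑ s, ∑ s', f s * f s' * ∑ ω, if t ω s = s' then (1 : ℝ) else 0 := by
  refine Finset.sum_congr rfl fun s _ => ?_
  simp only [Finset.mul_sum]
  rw [Finset.sum_comm]
  refine Finset.sum_congr rfl fun ω _ => ?_
  simp

omit [DecidableEq X] in
theorem card_mul_sum_sq_le (t : Ω → X → X) (f : X → ℝ) {E : ℝ}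
    (hE : ∑ s, ∑ ω, (f (t ω s) - f s) ^ 2 ≤ Fintype.card Ω * E) :
    Fintype.card Ω * ∑ s, f s ^ 2 ≤ Fintype.card Ω * E + 2 * ∑ s, ∑ ω, f s * f (t ω s) := by
  have h : ∑ s, ∑ _ω : Ω, f s ^ 2 ≤
      ∑ s, ∑ ω, ((f (t ω s) - f s) ^ 2 + 2 * (f s * f (t ω s))) := by
    refine Finset.sum_le_sum fun s _ => Finset.sum_le_sum fun ω _ => ?_
    nlinarith [sq_nonneg (f (t ω s))]
  simp only [Finset.sum_add_distrib, ← Finset.mul_sum, Finset.sum_const, Finset.card_univ,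
    nsmul_eq_mul] at h
  simp only [← Finset.mul_sum]
  linarith

/-- A Nash type inequality from a randomised displacement with bounded transition kernel. -/
theorem sum_sq_le_of_kernel_le [Nonempty Ω] (t : Ω → X → X) (f : X → ℝ) (hf : ∀ s, 0 ≤ f s)
    (hf1 : ∑ s, f s = 1) {E β : ℝ}
    (hE : ∑ s, ∑ ω, (f (t ω s) - f s) ^ 2 ≤ Fintype.card Ω * E)
    (hβ : ∀ s s', (∑ ω, if t ω s = s' then (1 : ℝ) else 0) ≤ Fintype.card Ω * β) :
    ∑ s, f s ^ 2 ≤ E + 2 * β := by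
  have hc : (0 : ℝ) < Fintype.card Ω := by exact_mod_cast Fintype.card_pos
  have h1 := card_mul_sum_sq_le t f hE
  have h2 : ∑ s, ∑ ω, f s * f (t ω s) ≤ Fintype.card Ω * β := by
    rw [sum_mul_eq_sum_kernel]
    calc _ ≤ ∑ s, ∑ s', f s * f s' * (Fintype.card Ω * β) :=
          Finset.sum_le_sum fun s _ => Finset.sum_le_sum fun s' _ =>
            mul_le_mul_of_nonneg_left (hβ s s') (mul_nonneg (hf s) (hf s'))
      _ = (∑ s, f s) * (∑ s, f s) * (Fintype.card Ω * β) := by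
          rw [Finset.sum_mul_sum, Finset.sum_mul]
          exact Finset.sum_congr rfl fun s _ => (Finset.sum_mul _ _ _).symm
      _ = _ := by rw [hf1]; ring
  refine le_of_mul_le_mul_left ?_ hc
  linarith

/-- A Poincaré inequality from a randomised displacement with almost uniform kernel. -/
theorem sum_sq_le_of_kernel_near [Nonempty Ω] (t : Ω → X → X) (g : X → ℝ)
    (hg : ∑ s, g s = 0) {E : ℝ}
    (hE : ∑ s, ∑ ω, (g (t ω s) - g s) ^ 2 ≤ Fintype.card Ω * E) (u : ℝ)
    (hK : ∑ s, ∑ s', ((∑ ω, if t ω s = s' then (1 : ℝ) else 0) / Fintype.card Ω - u) ^ 2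
      ≤ 1 / 16) :
    ∑ s, g s ^ 2 ≤ 2 * E := by
  have hc : (0 : ℝ) < Fintype.card Ω := by exact_mod_cast Fintype.card_pos
  have h1 := card_mul_sum_sq_le t g hE
  set K : X → X → ℝ := fun s s' =>
    (∑ ω, if t ω s = s' then (1 : ℝ) else 0) / Fintype.card Ω with hKdef
  set G := ∑ s, g s ^ 2 with hG
  have hG0 : 0 ≤ G := Finset.sum_nonneg fun _ _ => sq_nonneg _
  have h2 : ∑ s, ∑ ω, g s * g (t ω s) =
      Fintype.card Ω * ∑ q : X × X, g q.1 * g q.2 * (K q.1 q.2 - u) := by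
    have h3 : ∑ q : X × X, g q.1 * g q.2 * u = 0 := by
      rw [← Finset.sum_mul, Fintype.sum_prod_type]
      simp [← Finset.mul_sum, hg]
    rw [sum_mul_eq_sum_kernel]
    simp only [mul_sub, Finset.sum_sub_distrib]
    rw [h3, mul_zero, sub_zero, Fintype.sum_prod_type, Finset.mul_sum]
    refine Finset.sum_congr rfl fun s _ => ?_
    rw [Finset.mul_sum]
    refine Finset.sum_congr rfl fun s' _ => ?_
    simp only [hKdef]
    field_simp
  set S := ∑ q : X × X, g q.1 * g q.2 * (K q.1 q.2 - u) with hS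
  have h4 : S ^ 2 ≤ G ^ 2 * (1 / 16) := by
    calc S ^ 2 ≤ (∑ q : X × X, (g q.1 * g q.2) ^ 2) * ∑ q : X × X, (K q.1 q.2 - u) ^ 2 :=
          Finset.sum_mul_sq_le_sq_mul_sq _ _ _
      _ ≤ (G ^ 2) * (1 / 16) := by
          have h5 : ∑ q : X × X, (g q.1 * g q.2) ^ 2 = G ^ 2 := by
            rw [Fintype.sum_prod_type, sq G, hG, Finset.sum_mul_sum]
            simp only [mul_pow]
          have h6 : ∑ q : X × X, (K q.1 q.2 - u) ^ 2 ≤ 1 / 16 := by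
            rw [Fintype.sum_prod_type]
            exact hK
          rw [h5]
          exact mul_le_mul_of_nonneg_left h6 (sq_nonneg G)
  have h7 : S ≤ G / 4 := by
    refine le_of_sq_le_sq ?_ (by positivity)
    linarith
  have h8 : G ≤ E + 2 * S := by
    refine le_of_mul_le_mul_left ?_ hc
    rw [h2] at h1
    linarith
  linarith

end Comparison

namespace Conf

variable {n d r : ℕ} [NeZero n]

theorem exists_schedule (d : ℕ) (hd : 1 ≤ d) :
    ∃ κ : ℕ → Fin d × Bool, Set.BijOn κ (Set.Iio (2 * d)) Set.univ := by
  have hcard : Fintype.card (Fin d × Bool) = 2 * d := by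
    simp [mul_comm]
  set e : Fin d × Bool ≃ Fin (2 * d) := Fintype.equivFinOfCardEq hcard with he
  have hpos : 0 < 2 * d := by omega
  refine ⟨fun k => e.symm ⟨k % (2 * d), Nat.mod_lt _ hpos⟩, fun _ _ => Set.mem_univ _, ?_, ?_⟩
  · intro a ha b hb h
    simp only [EmbeddingLike.apply_eq_iff_eq, Fin.mk.injEq] at h
    rwa [Nat.mod_eq_of_lt ha, Nat.mod_eq_of_lt hb] at h
  · intro c _
    refine ⟨e c, (e c).2, ?_⟩
    simp [Nat.mod_eq_of_lt (e c).2]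

theorem card_conf_le (hd : 1 ≤ d) : Fintype.card (Conf n d) ≤ n ^ (2 * d) * Fintype.card (Off n)
    := by
  have hV : Fintype.card (Fin d → ZMod n × ZMod n) = n ^ (2 * d) := by
    rw [Fintype.card_fun, Fintype.card_prod, ZMod.card, Fintype.card_fin, ← sq, ← pow_mul]
  rw [← hV, ← Fintype.card_prod]
  refine Fintype.card_le_of_injective
    (fun x => (fun j => tile x j, ⟨offset ⟨0, hd⟩ x, offset_ne_zero _ x⟩)) fun x y h => ?_
  simp only [Prod.mk.injEq, Subtype.mk.injEq] at h
  apply Subtype.ext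
  funext j
  refine Fin.lastCases ?_ (fun j => congrFun h.1 j) j
  have h1 := blank_eq ⟨0, hd⟩ x
  have h2 := blank_eq ⟨0, hd⟩ y
  have h3 := congrFun h.1 ⟨0, hd⟩
  rw [h.2] at h1
  simp only [tile] at h3
  rw [h3, ← h2] at h1
  exact h1

theorem card_params : Fintype.card (Params n d r) = r ^ (2 * d) * Fintype.card (Off n) ^ (2 * d)
    := by
  rw [Fintype.card_fun, Fintype.card_prod, Fintype.card_prod, Fintype.card_fin, Fintype.card_fin,
    Fintype.card_bool, mul_comm d, mul_pow]

theorem card_off_pos (hn : 2 ≤ n) : 0 < Fintype.card (Off n) := by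
  have : Fact (1 < n) := ⟨hn⟩
  have : Nonempty (Off n) := ⟨⟨(1, 0), by simp⟩⟩
  exact Fintype.card_pos

/-- The constant bounding the transition kernel of a run. -/
def kernelConst (d : ℕ) : ℝ := 49 ^ (2 * d * d)

theorem one_le_kernelConst (d : ℕ) : 1 ≤ kernelConst d := one_le_pow₀ (by norm_num)

theorem nonempty_params (hn : 2 ≤ n) (hr : 0 < r) : Nonempty (Params n d r) := by
  have := Fintype.card_pos_iff.mp (card_param_pos hn hr)
  infer_instance

open Classical in
theorem kernel_le (hn : 2 ≤ n) (hr0 : 0 < r) (hr : r ≤ n) (hd : 1 ≤ d) (κ : ℕ → Fin d × Bool)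
    (hκ : Set.BijOn κ (Set.Iio (2 * d)) Set.univ) (s s' : Conf n d) :
    (∑ ω : Params n d r, if traj hn κ ω s (2 * d) = s' then (1 : ℝ) else 0) ≤
      Fintype.card (Params n d r) * (kernelConst d / (r ^ (2 * d) * Fintype.card (Off n))) := by
  obtain ⟨m, hm⟩ : ∃ m, 2 * d = m + 1 := ⟨2 * d - 1, by omega⟩
  have h := card_fiber_le hn hr κ (by rw [← hm]; exact hκ) s s'
  rw [← hm] at h
  have ho : (0 : ℝ) < Fintype.card (Off n) := by exact_mod_cast card_off_pos hn
  have hr' : (0 : ℝ) < r := by exact_mod_cast hr0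
  have h' : (Fintype.card (Off n) : ℝ) *
      (∑ ω : Params n d r, if traj hn κ ω s (2 * d) = s' then (1 : ℝ) else 0) ≤
      (Fintype.card (Off n) : ℝ) ^ (2 * d) * kernelConst d := by
    rw [Finset.sum_boole, kernelConst]
    exact_mod_cast h
  rw [card_params]
  push_cast
  refine le_of_mul_le_mul_left (h'.trans (le_of_eq ?_)) ho
  field_simp

open Classical in
theorem kernel_good_le (hn : 2 ≤ n) (hr0 : 0 < r) (hr : r ≤ n) (hd : 1 ≤ d)
    (κ : ℕ → Fin d × Bool)
    (hκ : Set.BijOn κ (Set.Iio (2 * d)) Set.univ) (s s' : Conf n d) :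
    (∑ ω : Params n d r, if traj hn κ ω s (2 * d) = s' then (1 : ℝ) else 0) ≤
      Fintype.card (Params n d r) * (1 / (r ^ (2 * d) * Fintype.card (Off n))) +
      ∑ ω : Params n d r, if traj hn κ ω s (2 * d) = s' then
        (if ∃ k < 2 * d, ∃ j, err hn κ ω s k j ≠ 0 then (1 : ℝ) else 0) else 0 := by
  obtain ⟨m, hm⟩ : ∃ m, 2 * d = m + 1 := ⟨2 * d - 1, by omega⟩
  have h := card_good_fiber_le hn hr κ (by rw [← hm]; exact hκ) s s'
  rw [← hm] at h
  have ho : (0 : ℝ) < Fintype.card (Off n) := by exact_mod_cast card_off_pos hn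
  have hr' : (0 : ℝ) < r := by exact_mod_cast hr0
  have h1 : (∑ ω : Params n d r, if traj hn κ ω s (2 * d) = s' then (1 : ℝ) else 0) =
      (∑ ω : Params n d r, if traj hn κ ω s (2 * d) = s' ∧
        ¬ ∃ k < 2 * d, ∃ j, err hn κ ω s k j ≠ 0 then (1 : ℝ) else 0) +
      ∑ ω : Params n d r, if traj hn κ ω s (2 * d) = s' then
        (if ∃ k < 2 * d, ∃ j, err hn κ ω s k j ≠ 0 then (1 : ℝ) else 0) else 0 := by
    rw [← Finset.sum_add_distrib]
    refine Finset.sum_congr rfl fun ω _ => ?_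
    by_cases h2 : traj hn κ ω s (2 * d) = s' <;>
      by_cases h3 : ∃ k < 2 * d, ∃ j, err hn κ ω s k j ≠ 0 <;> simp only [h2, h3] <;> norm_num
  have h' : (Fintype.card (Off n) : ℝ) *
      (∑ ω : Params n d r, if traj hn κ ω s (2 * d) = s' ∧
        ¬ ∃ k < 2 * d, ∃ j, err hn κ ω s k j ≠ 0 then (1 : ℝ) else 0) ≤
      (Fintype.card (Off n) : ℝ) ^ (2 * d) := by
    rw [Finset.sum_boole]
    exact_mod_cast h
  rw [h1]
  gcongr
  rw [card_params]
  push_cast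
  refine le_of_mul_le_mul_left (h'.trans (le_of_eq ?_)) ho
  field_simp

open Classical in
theorem kernel_near (hd : 1 ≤ d) (hn4 : 4 ≤ n) (hn : 384 * kernelConst d * d ^ 2 ≤ n)
    (κ : ℕ → Fin d × Bool) (hκ : Set.BijOn κ (Set.Iio (2 * d)) Set.univ) :
    ∑ s : Conf n d, ∑ s', ((∑ ω : Params n d n,
      if traj (by omega) κ ω s (2 * d) = s' then (1 : ℝ) else 0) /
        Fintype.card (Params n d n) - 1 / Fintype.card (Conf n d)) ^ 2 ≤ 1 / 16 := by
  have hn2 : 2 ≤ n := by omega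
  have hn0 : (0 : ℝ) < n := by exact_mod_cast NeZero.pos n
  have : Nonempty (Params n d n) := nonempty_params hn2 (by omega)
  have hW : (0 : ℝ) < Fintype.card (Params n d n) := by exact_mod_cast Fintype.card_pos
  set W : ℝ := ((Fintype.card (Params n d n) : ℕ) : ℝ) with hWdef
  have ho : (0 : ℝ) < Fintype.card (Off n) := by exact_mod_cast card_off_pos hn2
  rcases isEmpty_or_nonempty (Conf n d) with hemp | hne
  · simp
  have hT : (0 : ℝ) < Fintype.card (Conf n d) := by exact_mod_cast Fintype.card_pos
  set T : ℝ := ((Fintype.card (Conf n d) : ℕ) : ℝ) with hTdef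
  set β : ℝ := 1 / (n ^ (2 * d) * Fintype.card (Off n)) with hβ
  have hβ0 : 0 ≤ β := by positivity
  have hTβ : T * β ≤ 1 := by
    have h := card_conf_le (n := n) hd
    have h' : T ≤ n ^ (2 * d) * Fintype.card (Off n) := by
      rw [hTdef]
      exact_mod_cast h
    rw [hβ, mul_one_div]
    exact div_le_one_of_le₀ h' (by positivity)
  set z : Conf n d → Conf n d → ℝ := fun s s' =>
    ∑ ω : Params n d n, if traj hn2 κ ω s (2 * d) = s' then (1 : ℝ) else 0 with hz
  set zb : Conf n d → Conf n d → ℝ := fun s s' =>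
    ∑ ω : Params n d n, if traj hn2 κ ω s (2 * d) = s' then
      (if ∃ k < 2 * d, ∃ j, err hn2 κ ω s k j ≠ 0 then (1 : ℝ) else 0) else 0 with hzb
  have z0 : ∀ s s', 0 ≤ z s s' := fun s s' => Finset.sum_nonneg fun ω _ => by
    split_ifs <;> norm_num
  have zb0 : ∀ s s', 0 ≤ zb s s' := fun s s' => Finset.sum_nonneg fun ω _ => by
    split_ifs <;> norm_num
  have hzM : ∀ s s', z s s' ≤ W * (kernelConst d * β) := by
    intro s s'
    have h := kernel_le hn2 (NeZero.pos n) le_rfl hd κ hκ s s'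
    rwa [← mul_one_div] at h
  have hzg : ∀ s s', z s s' ≤ W * β + zb s s' := fun s s' =>
    kernel_good_le hn2 (NeZero.pos n) le_rfl hd κ hκ s s'
  have hzsum : ∑ s, ∑ s', z s s' = T * W := by
    have : ∀ s, ∑ s', z s s' = W := by
      intro s
      simp only [hz]
      rw [Finset.sum_comm]
      simp [hWdef]
    simp [this, hTdef]
  have hzbsum : n * ∑ s, ∑ s', zb s s' ≤ 12 * (2 * d) * d * (T * W) := by
    have h := card_bad_le hn4 (NeZero.pos n) le_rfl κ hκ.injOn
    have h2 : ∑ s, ∑ s', zb s s' = ∑ s : Conf n d, ∑ ω : Params n d n,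
      if ∃ k < 2 * d, ∃ j, err hn2 κ ω s k j ≠ 0 then (1 : ℝ) else 0 := by
      refine Finset.sum_congr rfl fun s _ => ?_
      simp only [hzb]
      rw [Finset.sum_comm]
      simp
    rw [h2]
    push_cast at h
    exact h
  have hM := one_le_kernelConst d
  have hsq : ∑ s, ∑ s', z s s' ^ 2 ≤
      W * β * (T * W) + W * (kernelConst d * β) * ∑ s, ∑ s', zb s s' := by
    rw [← hzsum, Finset.mul_sum, Finset.mul_sum, ← Finset.sum_add_distrib]
    refine Finset.sum_le_sum fun s _ => ?_
    rw [Finset.mul_sum, Finset.mul_sum, ← Finset.sum_add_distrib]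
    refine Finset.sum_le_sum fun s' _ => ?_
    have h1 := mul_le_mul_of_nonneg_left (hzg s s') (z0 s s')
    have h2 := mul_le_mul_of_nonneg_right (hzM s s') (zb0 s s')
    nlinarith
  have hbad : kernelConst d * ∑ s, ∑ s', zb s s' ≤ T * W / 16 := by
    refine le_of_mul_le_mul_left ?_ hn0
    have h1 := mul_le_mul_of_nonneg_left hzbsum (zero_le_one.trans hM)
    have h2 : 384 * kernelConst d * d ^ 2 * (T * W) ≤ n * (T * W) :=
      mul_le_mul_of_nonneg_right hn (by positivity)
    linarith
  have hsq' : ∑ s, ∑ s', z s s' ^ 2 ≤ W ^ 2 * (17 / 16) := by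
    have h1 : W * β * (kernelConst d * ∑ s, ∑ s', zb s s') ≤ W * β * (T * W / 16) :=
      mul_le_mul_of_nonneg_left hbad (by positivity)
    have h2 : W ^ 2 * (T * β) ≤ W ^ 2 * 1 := mul_le_mul_of_nonneg_left hTβ (by positivity)
    nlinarith
  have hfinal : ∑ s : Conf n d, ∑ s', (z s s' / W - 1 / T) ^ 2 =
      (∑ s, ∑ s', z s s' ^ 2) / W ^ 2 - 1 := by
    have h1 : ∀ s s', (z s s' / W - 1 / T) ^ 2 =
        z s s' ^ 2 * (1 / W ^ 2) - z s s' * (2 / (W * T)) + 1 / T ^ 2 := by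
      intro s s'
      field_simp
      ring
    simp only [h1, Finset.sum_add_distrib, Finset.sum_sub_distrib, ← Finset.sum_mul, hzsum,
      Finset.sum_const, Finset.card_univ, nsmul_eq_mul, ← hTdef]
    field_simp
    ring
  change ∑ s : Conf n d, ∑ s', (z s s' / W - 1 / T) ^ 2 ≤ 1 / 16
  rw [hfinal, sub_le_iff_le_add, div_le_iff₀ (by positivity)]
  linarith

/-- The Nash inequality at scale `r`. -/
theorem nash (hd : 1 ≤ d) (hn : 2 ≤ n) (hr0 : 0 < r) (hr : r ≤ n) (f : Conf n d → ℝ)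
    (hf : ∀ s, 0 ≤ f s) (hf1 : ∑ s, f s = 1) :
    Fintype.card (Conf n d) * ∑ s, f s ^ 2 ≤
      552 * d ^ 2 * n ^ 2 * (n + r ^ 2) * (Fintype.card (Conf n d) * energy f) +
        2 * kernelConst d * (n / r) ^ (2 * d) := by
  classical
  obtain ⟨κ, hκ⟩ := exists_schedule d hd
  have := nonempty_params (d := d) hn hr0
  have h := sum_sq_le_of_kernel_le (fun ω s => traj hn κ ω s (2 * d)) f hf hf1
    (E := ((2 * d : ℕ) : ℝ) ^ 2 * (138 * n ^ 2 * (n + r ^ 2)) * energy f)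
    (by rw [← mul_assoc]; exact sum_sq_traj_le hn hr0 κ hκ.injOn f)
    (kernel_le hn hr0 hr hd κ hκ)
  have ho : (0 : ℝ) < Fintype.card (Off n) := by exact_mod_cast card_off_pos hn
  have hr' : (0 : ℝ) < r := by exact_mod_cast hr0
  have hM := one_le_kernelConst d
  have hT : (Fintype.card (Conf n d) : ℝ) ≤ n ^ (2 * d) * Fintype.card (Off n) := by
    exact_mod_cast card_conf_le (n := n) hd
  have h2 := mul_le_mul_of_nonneg_left h (Nat.cast_nonneg (α := ℝ) (Fintype.card (Conf n d)))
  have h3 : (Fintype.card (Conf n d) : ℝ) *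
      (kernelConst d / (r ^ (2 * d) * Fintype.card (Off n))) ≤ kernelConst d * (n / r) ^ (2 * d)
      := by
    calc _ ≤ (n ^ (2 * d) * Fintype.card (Off n) : ℝ) *
          (kernelConst d / (r ^ (2 * d) * Fintype.card (Off n))) := by gcongr
      _ = _ := by
          rw [div_pow]
          field_simp
  push_cast at h2
  linarith

/-- The Poincaré inequality. -/
theorem poincare (hd : 1 ≤ d) (hn4 : 4 ≤ n) (hn : 384 * kernelConst d * d ^ 2 ≤ n)
    (g : Conf n d → ℝ) (hg : ∑ s, g s = 0) :
    ∑ s, g s ^ 2 ≤ 2208 * d ^ 2 * n ^ 4 * energy g := by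
  classical
  obtain ⟨κ, hκ⟩ := exists_schedule d hd
  have hn2 : 2 ≤ n := by omega
  have := nonempty_params (d := d) hn2 (NeZero.pos n)
  have h := sum_sq_le_of_kernel_near (fun (ω : Params n d n) s => traj hn2 κ ω s (2 * d)) g hg
    (E := ((2 * d : ℕ) : ℝ) ^ 2 * (138 * n ^ 2 * (n + n ^ 2)) * energy g)
    (by rw [← mul_assoc]; exact sum_sq_traj_le hn2 (NeZero.pos n) κ hκ.injOn g)
    (1 / Fintype.card (Conf n d)) (kernel_near hd hn4 hn κ hκ)
  refine h.trans ?_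
  have hE := energy_nonneg g
  have hn1 : (1 : ℝ) ≤ n := by exact_mod_cast NeZero.pos n
  have h1 : (n : ℝ) + n ^ 2 ≤ 2 * n ^ 2 := by nlinarith
  have h2 : (n : ℝ) ^ 2 * (n + n ^ 2) ≤ 2 * n ^ 4 :=
    (mul_le_mul_of_nonneg_left h1 (sq_nonneg _)).trans (le_of_eq (by ring))
  push_cast
  have h3 := mul_le_mul_of_nonneg_left h2 (mul_nonneg (sq_nonneg (d : ℝ)) hE)
  linarith

end Conf

namespace Conf

variable {n d : ℕ} [NeZero n]

omit [NeZero n] in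
theorem card_displacements (hn : 3 ≤ n) : (displacements n).card = 5 := by
  have h1 : Fact (1 < n) := ⟨by omega⟩
  have h2 : (2 : ZMod n) ≠ 0 := by
    intro h
    have h3 : ((2 : ℕ) : ZMod n) = 0 := by exact_mod_cast h
    rw [ZMod.natCast_eq_zero_iff] at h3
    have := Nat.le_of_dvd (by norm_num) h3
    omega
  have h4 : (1 : ZMod n) ≠ -1 := by
    intro h
    apply h2
    linear_combination h
  have h5 : (0 : ZMod n) ≠ -1 := by simp
  rw [displacements, Finset.card_insert_of_notMem, Finset.card_insert_of_notMem,
    Finset.card_insert_of_notMem, Finset.card_insert_of_notMem, Finset.card_singleton]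
  all_goals simp [h4, h5]

omit [NeZero n] in
theorem neg_mem_displacements {c : ZMod n × ZMod n} (hc : c ∈ displacements n) :
    -c ∈ displacements n := by
  simp only [displacements, Finset.mem_insert, Finset.mem_singleton] at hc ⊢
  rcases hc with rfl | rfl | rfl | rfl | rfl <;> simp

omit [NeZero n] in
theorem sum_displacements_neg (F : ZMod n × ZMod n → ℝ) :
    ∑ c ∈ displacements n, F (-c) = ∑ c ∈ displacements n, F c :=
  Finset.sum_nbij' Neg.neg Neg.neg (fun _ h => neg_mem_displacements h)
    (fun _ h => neg_mem_displacements h) (fun _ _ => neg_neg _) (fun _ _ => neg_neg _)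
    fun _ _ => rfl

omit [NeZero n] in
theorem move_zero (x : Conf n d) : move 0 x = x := by
  apply Subtype.ext
  funext j
  simp [move_apply]

/-- The law of the marked pieces and the empty square after `N` steps. -/
noncomputable def law (n d : ℕ) [NeZero n] (N : ℕ) (x : Conf n d) : ℝ := markedDist n d N x.1

omit [NeZero n] in
theorem trackedLabels_last : trackedLabels n d (Fin.last d) = emptyLabel n := by
  simp [trackedLabels]

omit [NeZero n] in
theorem tracked_swap_iff (x : Conf n d) (c : ZMod n × ZMod n)
    (σ : Equiv.Perm (ZMod n × ZMod n)) :
    (∀ i, (Equiv.swap (σ (emptyLabel n)) (σ (emptyLabel n) + c) * σ) (trackedLabels n d i) =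
      x.1 i) ↔ ∀ i, σ (trackedLabels n d i) = (move (-c) x).1 i := by
  simp only [Equiv.Perm.mul_apply, move_apply]
  constructor
  · intro h i
    have h1 := h (Fin.last d)
    rw [trackedLabels_last, Equiv.swap_apply_left] at h1
    have h2 : x.blank = σ (emptyLabel n) + c := h1.symm
    rw [h2, add_neg_cancel_right, Equiv.swap_comm, ← h i, Equiv.swap_apply_self]
  · intro h i
    have h1 := h (Fin.last d)
    have h2 : x.1 (Fin.last d) = x.blank := rfl
    rw [trackedLabels_last, h2, Equiv.swap_apply_left] at h1
    rw [h1, neg_add_cancel_right, h i, Equiv.swap_comm, Equiv.swap_apply_self]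

theorem law_succ (N : ℕ) (x : Conf n d) :
    law n d (N + 1) x = (1 / 5) * ∑ c ∈ displacements n, law n d N (move c x) := by
  classical
  rw [← sum_displacements_neg fun c => law n d N (move c x)]
  simp only [law, markedDist, puzzleDist, puzzleStep]
  have h1 : ∀ τ : Equiv.Perm (ZMod n × ZMod n),
      (if ∀ i, τ (trackedLabels n d i) = x.1 i then ∑ σ, puzzleDist n N σ * (1 / 5 *
        (((displacements n).filter (fun d => τ = Equiv.swap (σ (emptyLabel n))
          (σ (emptyLabel n) + d) * σ)).card : ℝ)) else 0) =
      1 / 5 * ∑ c ∈ displacements n, ∑ σ, if τ = Equiv.swap (σ (emptyLabel n))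
          (σ (emptyLabel n) + c) * σ then (if ∀ i, τ (trackedLabels n d i) = x.1 i then
            puzzleDist n N σ else 0) else 0 := by
    intro τ
    rw [Finset.sum_comm, Finset.mul_sum]
    by_cases hτ : ∀ i, τ (trackedLabels n d i) = x.1 i
    · simp only [if_pos hτ]
      refine Finset.sum_congr rfl fun σ _ => ?_
      rw [Finset.card_filter, Nat.cast_sum, mul_left_comm, Finset.mul_sum]
      congr 1
      refine Finset.sum_congr rfl fun c _ => ?_
      split_ifs <;> simp
    · simp only [if_neg hτ, ite_self, Finset.sum_const_zero, mul_zero]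
  calc _ = ∑ τ : Equiv.Perm (ZMod n × ZMod n), 1 / 5 * ∑ c ∈ displacements n, ∑ σ,
        if τ = Equiv.swap (σ (emptyLabel n)) (σ (emptyLabel n) + c) * σ then
          (if ∀ i, τ (trackedLabels n d i) = x.1 i then puzzleDist n N σ else 0) else 0 := by
        refine Finset.sum_congr rfl fun τ _ => ?_
        rw [← h1 τ]
        congr!
    _ = _ := by
        rw [← Finset.mul_sum, Finset.sum_comm]
        congr 1
        refine Finset.sum_congr rfl fun c _ => ?_
        rw [Finset.sum_comm]
        refine Finset.sum_congr rfl fun σ _ => ?_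
        rw [Finset.sum_ite_eq' univ]
        simp only [Finset.mem_univ, if_true]
        congr 1
        exact propext (tracked_swap_iff x c σ)

theorem law_zero (x : Conf n d) [Decidable (∀ i, trackedLabels n d i = x.1 i)] :
    law n d 0 x = if ∀ i, trackedLabels n d i = x.1 i then 1 else 0 := by
  classical
  simp only [law, markedDist, puzzleDist]
  rw [Finset.sum_eq_single 1]
  · simp only [Equiv.Perm.one_apply, if_true]
  · intro σ _ h
    simp [h]
  · simp

omit [NeZero n] in
theorem trackedLabels_injective (hn : 2 ≤ n) (hd : d ≤ n) :
    Function.Injective (trackedLabels n d) := by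
  have h2 : ((n - 1 : ℕ) : ZMod n) ≠ 0 := by
    intro h
    rw [ZMod.natCast_eq_zero_iff] at h
    have := Nat.le_of_dvd (by omega) h
    omega
  intro i j h
  simp only [trackedLabels, emptyLabel] at h
  split_ifs at h with h3 h4 h4
  · have h5 := congrArg (fun v => ZMod.val v.1) h
    simp only [ZMod.val_natCast] at h5
    rw [Nat.mod_eq_of_lt (by omega), Nat.mod_eq_of_lt (by omega)] at h5
    exact Fin.ext h5
  · exact absurd (congrArg Prod.snd h).symm h2
  · exact absurd (congrArg Prod.snd h) h2
  · exact Fin.ext (by omega)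

theorem law_zero_eq (hn : 2 ≤ n) (hd : d ≤ n) : ∃ x₀ : Conf n d, ∀ x, law n d 0 x =
    if x = x₀ then 1 else 0 := by
  classical
  refine ⟨⟨trackedLabels n d, trackedLabels_injective hn hd⟩, fun x => ?_⟩
  rw [law_zero]
  congr 1
  rw [eq_iff_iff, Subtype.ext_iff, funext_iff]
  exact forall_congr' fun i => eq_comm

theorem law_nonneg (N : ℕ) (x : Conf n d) : 0 ≤ law n d N x := by
  classical
  induction N generalizing x with
  | zero =>
    rw [law_zero]
    split_ifs <;> norm_num
  | succ N ih =>
    rw [law_succ]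
    exact mul_nonneg (by norm_num) (Finset.sum_nonneg fun c _ => ih _)

theorem sum_law (hn : 3 ≤ n) (hd : d ≤ n) (N : ℕ) : ∑ x : Conf n d, law n d N x = 1 := by
  classical
  induction N with
  | zero =>
    obtain ⟨x₀, h⟩ := law_zero_eq (d := d) (by omega : 2 ≤ n) hd
    simp [h]
  | succ N ih =>
    simp only [law_succ, ← Finset.mul_sum]
    rw [Finset.sum_comm]
    have : ∀ c ∈ displacements n, ∑ x : Conf n d, law n d N (move c x) = 1 := fun c _ => by
      rw [Equiv.sum_comp (move c) (law n d N), ih]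
    rw [Finset.sum_congr rfl this, Finset.sum_const, card_displacements hn]
    norm_num

theorem sum_sq_law_zero (hn : 2 ≤ n) (hd : d ≤ n) : ∑ x : Conf n d, law n d 0 x ^ 2 = 1 := by
  classical
  obtain ⟨x₀, h⟩ := law_zero_eq (d := d) hn hd
  simp [h]

/-- One step of the chain decreases the `L²` norm. -/
theorem sum_sq_average_le (hn : 3 ≤ n) (f : Conf n d → ℝ) :
    ∑ x, ((1 / 5) * ∑ c ∈ displacements n, f (move c x)) ^ 2 ≤
      ∑ x, f x ^ 2 - energy f / 25 := by
  have h0 : (0 : ZMod n × ZMod n) ∈ displacements n := by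
    simp only [displacements, Finset.mem_insert]
    exact Or.inl rfl
  have pt : ∀ x, ((1 / 5) * ∑ c ∈ displacements n, f (move c x)) ^ 2 ≤
      (1 / 5) * ∑ c ∈ displacements n, f (move c x) ^ 2 -
        (∑ c ∈ displacements n, (f (move c x) - f x) ^ 2) / 25 := by
    intro x
    have hc := sq_sum_le_card_mul_sum_sq (s := (displacements n).erase 0)
      (f := fun c => f (move c x) - f x)
    rw [Finset.card_erase_of_mem h0, card_displacements hn] at hc
    have e1 : ∑ c ∈ (displacements n).erase 0, (f (move c x) - f x) =
        ∑ c ∈ displacements n, (f (move c x) - f x) := by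
      rw [← Finset.add_sum_erase _ _ h0, move_zero]
      ring
    have e2 : ∑ c ∈ (displacements n).erase 0, (f (move c x) - f x) ^ 2 =
        ∑ c ∈ displacements n, (f (move c x) - f x) ^ 2 := by
      rw [← Finset.add_sum_erase _ _ h0, move_zero]
      ring
    rw [e1, e2] at hc
    have e3 : ∑ c ∈ displacements n, (f (move c x) - f x) =
        ∑ c ∈ displacements n, f (move c x) - 5 * f x := by
      rw [Finset.sum_sub_distrib, Finset.sum_const, card_displacements hn]
      simp
    have e4 : ∑ c ∈ displacements n, (f (move c x) - f x) ^ 2 =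
        ∑ c ∈ displacements n, f (move c x) ^ 2 -
          2 * f x * ∑ c ∈ displacements n, f (move c x) + 5 * f x ^ 2 := by
      simp only [sub_sq, Finset.sum_add_distrib, Finset.sum_sub_distrib, Finset.sum_const,
        card_displacements hn]
      rw [Finset.mul_sum]
      simp only [nsmul_eq_mul, Nat.cast_ofNat]
      congr 2
      exact Finset.sum_congr rfl fun c _ => by ring
    rw [e3, e4] at hc
    rw [e4]
    norm_num at hc
    nlinarith
  refine (Finset.sum_le_sum fun x _ => pt x).trans (le_of_eq ?_)
  rw [Finset.sum_sub_distrib, ← Finset.mul_sum, Finset.sum_comm, ← Finset.sum_div,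
    Finset.sum_comm (f := fun x c => (f (move c x) - f x) ^ 2)]
  have h1 : ∀ c ∈ displacements n, ∑ x, f (move c x) ^ 2 = ∑ x, f x ^ 2 := fun c _ =>
    Equiv.sum_comp (move c) fun x => f x ^ 2
  rw [Finset.sum_congr rfl h1, Finset.sum_const, card_displacements hn, energy]
  simp only [nsmul_eq_mul, Nat.cast_ofNat]
  ring

theorem energy_sub_const (f : Conf n d → ℝ) (a : ℝ) : energy (fun x => f x - a) = energy f := by
  simp only [energy, sub_sub_sub_cancel_right]

theorem card_conf_pos (hn : 2 ≤ n) (hd : d ≤ n) : 0 < Fintype.card (Conf n d) := by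
  obtain ⟨x₀, -⟩ := law_zero_eq (d := d) hn hd
  exact Fintype.card_pos_iff.mpr ⟨x₀⟩

theorem card_mul_sum_sub_sq (hn : 2 ≤ n) (hd : d ≤ n) (f : Conf n d → ℝ) (hf : ∑ x, f x = 1) :
    Fintype.card (Conf n d) * ∑ x, (f x - 1 / Fintype.card (Conf n d)) ^ 2 =
      Fintype.card (Conf n d) * ∑ x, f x ^ 2 - 1 := by
  have hT : (0 : ℝ) < Fintype.card (Conf n d) := by exact_mod_cast card_conf_pos hn hd
  have h1 : ∀ x, (f x - 1 / (Fintype.card (Conf n d) : ℝ)) ^ 2 =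
      f x ^ 2 - f x * (2 / Fintype.card (Conf n d)) + 1 / (Fintype.card (Conf n d) : ℝ) ^ 2 := by
    intro x
    field_simp
    ring
  simp only [h1, Finset.sum_add_distrib, Finset.sum_sub_distrib, ← Finset.sum_mul, hf,
    Finset.sum_const, Finset.card_univ, nsmul_eq_mul]
  field_simp
  ring

end Conf

/-! ### From the functional inequalities to a mixing time -/

namespace EnergyDecay

/-- A nonincreasing nonnegative sequence which contracts by the factor `1 - δ` as long as it is
above the level `θ`, and which is at most `Λ θ` after time `s`, is at most `θ` after time
`s + log Λ / δ + 1`. -/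
theorem le_of_contraction {u : ℕ → ℝ} {θ δ Λ s : ℝ} (hθ : 0 < θ) (hδ : 0 < δ) (hΛ : 1 ≤ Λ)
    (hs : 0 ≤ s) (hanti : ∀ t, u (t + 1) ≤ u t)
    (hstep : ∀ t, θ ≤ u t → u (t + 1) ≤ (1 - δ) * u t)
    (hu : ∀ t : ℕ, s ≤ t → u t ≤ Λ * θ) {t : ℕ} (ht : s + Real.log Λ / δ + 1 ≤ t) : u t ≤ θ := by
  have key : ∀ m : ℕ, u (⌈s⌉₊ + m) ≤ max θ (Real.exp (-(δ * m)) * (Λ * θ)) := by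
    intro m
    induction m with
    | zero => simpa using Or.inr (hu _ (Nat.le_ceil s))
    | succ m ih =>
      rcases le_or_gt (u (⌈s⌉₊ + m)) θ with h | h
      · exact le_max_of_le_left ((hanti _).trans h)
      · refine le_max_of_le_right ?_
        have h1 : u (⌈s⌉₊ + m) ≤ Real.exp (-(δ * m)) * (Λ * θ) :=
          (le_max_iff.mp ih).resolve_left (not_le.mpr h)
        have h2 : 1 - δ ≤ Real.exp (-δ) := by linarith [Real.add_one_le_exp (-δ)]
        calc u (⌈s⌉₊ + (m + 1)) ≤ (1 - δ) * u (⌈s⌉₊ + m) := hstep _ h.le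
          _ ≤ Real.exp (-δ) * u (⌈s⌉₊ + m) := by gcongr; linarith
          _ ≤ Real.exp (-δ) * (Real.exp (-(δ * m)) * (Λ * θ)) := by gcongr
          _ = Real.exp (-(δ * (m + 1 : ℕ))) * (Λ * θ) := by
            rw [← mul_assoc, ← Real.exp_add]; push_cast; ring_nf
  have hlog : 0 ≤ Real.log Λ / δ := div_nonneg (Real.log_nonneg hΛ) hδ.le
  have hc : (⌈s⌉₊ : ℝ) < s + 1 := Nat.ceil_lt_add_one hs
  have hle : ⌈s⌉₊ ≤ t := by
    have : (⌈s⌉₊ : ℝ) ≤ t := by linarith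
    exact_mod_cast this
  obtain ⟨m, rfl⟩ := Nat.exists_eq_add_of_le hle
  refine (key m).trans (max_le le_rfl ?_)
  push_cast at ht
  have hm : Real.log Λ ≤ δ * m := by
    have : Real.log Λ / δ ≤ m := by linarith
    rwa [div_le_iff₀ hδ, mul_comm] at this
  have hΛ' : Real.exp (-(δ * m)) ≤ Λ⁻¹ := by
    rw [Real.exp_neg]
    refine inv_anti₀ (by linarith) ?_
    calc Λ = Real.exp (Real.log Λ) := (Real.exp_log (by linarith)).symm
      _ ≤ _ := Real.exp_le_exp.mpr hm
  calc Real.exp (-(δ * m)) * (Λ * θ) ≤ Λ⁻¹ * (Λ * θ) := by gcongr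
    _ = θ := by field_simp

/-- A Nash inequality at all scales `r ≤ n` gives one at every dyadic scale `n / 2 ^ k` with
`4 ^ k ≤ n`. -/
theorem dyadic_nash {n d k : ℕ} {a M x e : ℝ} (hn : 1 ≤ n) (ha : 0 ≤ a) (hM : 0 ≤ M) (he : 0 ≤ e)
    (hk : 4 ^ k ≤ n)
    (hnash : ∀ r : ℕ, 0 < r → r ≤ n →
      x ≤ a * (n : ℝ) ^ 2 * (n + (r : ℝ) ^ 2) * e + 2 * M * ((n : ℝ) / r) ^ (2 * d)) :
    x ≤ 5 * a * ((n : ℝ) ^ 4 / 4 ^ k) * e + 2 * M * (4 ^ k) ^ d := by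
  have hn0 : (0 : ℝ) < n := by exact_mod_cast hn
  have hk' : (4 : ℝ) ^ k ≤ n := by exact_mod_cast hk
  have h2k : (0 : ℝ) < 2 ^ k := by positivity
  have h24 : (2 : ℝ) ^ k * 2 ^ k = 4 ^ k := by rw [← mul_pow]; norm_num
  have h1 : (1 : ℝ) ≤ 2 ^ k := one_le_pow₀ (by norm_num)
  have h2n : (2 : ℝ) ^ k ≤ n := by nlinarith
  set r := ⌈(n : ℝ) / 2 ^ k⌉₊ with hr
  have hr0 : 0 < r := Nat.ceil_pos.mpr (by positivity)
  have hr0' : (0 : ℝ) < r := by exact_mod_cast hr0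
  have hrn : r ≤ n := Nat.ceil_le.mpr (div_le_self hn0.le h1)
  have hrl : (n : ℝ) / 2 ^ k ≤ r := Nat.le_ceil _
  have hru : (r : ℝ) ≤ 2 * (n / 2 ^ k) := by
    have h3 : (r : ℝ) < n / 2 ^ k + 1 := Nat.ceil_lt_add_one (by positivity)
    have h4 : 1 ≤ (n : ℝ) / 2 ^ k := (one_le_div h2k).mpr h2n
    linarith
  refine (hnash r hr0 hrn).trans ?_
  have h5 : (n : ℝ) + (r : ℝ) ^ 2 ≤ 5 * ((n : ℝ) ^ 2 / 4 ^ k) := by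
    have h6 : (r : ℝ) ^ 2 ≤ 4 * ((n : ℝ) ^ 2 / 4 ^ k) := by
      calc (r : ℝ) ^ 2 ≤ (2 * (n / 2 ^ k)) ^ 2 := by gcongr
        _ = 4 * ((n : ℝ) ^ 2 / 4 ^ k) := by rw [← h24]; field_simp; ring
    have h7 : (n : ℝ) ≤ (n : ℝ) ^ 2 / 4 ^ k := by
      rw [le_div_iff₀ (by positivity)]; nlinarith
    linarith
  have h8 : (n : ℝ) / r ≤ 2 ^ k := by
    rw [div_le_iff₀ hr0']
    rwa [div_le_iff₀ h2k, mul_comm] at hrl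
  have h9 : ((n : ℝ) / r) ^ (2 * d) ≤ (4 ^ k) ^ d := by
    calc ((n : ℝ) / r) ^ (2 * d) ≤ (2 ^ k) ^ (2 * d) := by gcongr
      _ = (4 ^ k) ^ d := by rw [pow_mul, sq, h24]
  have h10 : a * (n : ℝ) ^ 2 * (n + (r : ℝ) ^ 2) * e ≤
      a * (n : ℝ) ^ 2 * (5 * ((n : ℝ) ^ 2 / 4 ^ k)) * e := by gcongr
  have h11 : 2 * M * ((n : ℝ) / r) ^ (2 * d) ≤ 2 * M * (4 ^ k) ^ d := by gcongr
  calc _ ≤ a * (n : ℝ) ^ 2 * (5 * ((n : ℝ) ^ 2 / 4 ^ k)) * e + 2 * M * (4 ^ k) ^ d :=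
        add_le_add h10 h11
    _ = _ := by ring

/-- If a sequence `u` loses at least `e / 25` in each step, where `e` controls `u` through a Nash
inequality at the scales `4 ^ k ≤ n`, then `u` is bounded after a time of order `n ^ 4`. -/
theorem le_of_nash {n d : ℕ} {A M : ℝ} {u e : ℕ → ℝ} (hn : 1 ≤ n) (hA : 1 ≤ A) (hM : 1 ≤ M)
    (he : ∀ t, 0 ≤ e t) (hu : ∀ t, u (t + 1) ≤ u t - e t / 25)
    (hnash : ∀ k, 4 ^ k ≤ n → ∀ t,
      u t ≤ A * ((n : ℝ) ^ 4 / 4 ^ k) * e t + 2 * M * (4 ^ k) ^ d)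
    (hu0 : u 0 ≤ (n : ℝ) ^ (2 * d + 2)) {t : ℕ}
    (ht : (200 * A * (2 * d + 2) + 1 + 2 * (100 * d * A + 1)) * (n : ℝ) ^ 4 ≤ t) :
    u t ≤ 4 * M := by
  have hn1 : (1 : ℝ) ≤ n := by exact_mod_cast hn
  have hn0 : (0 : ℝ) < n := by linarith
  have hA0 : 0 < A := by linarith
  have hanti : ∀ t, u (t + 1) ≤ u t := fun t => by linarith [hu t, he t]
  have hstep : ∀ k, 4 ^ k ≤ n → ∀ t, 4 * M * (4 ^ k) ^ d ≤ u t →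
      u (t + 1) ≤ (1 - 4 ^ k / (50 * A * (n : ℝ) ^ 4)) * u t := by
    intro k hk t h
    have h1 : u t / 2 ≤ A * ((n : ℝ) ^ 4 / 4 ^ k) * e t := by linarith [hnash k hk t]
    have h2 : u t * (4 ^ k / (2 * A * (n : ℝ) ^ 4)) ≤ e t := by
      calc u t * (4 ^ k / (2 * A * (n : ℝ) ^ 4))
          = u t / 2 * (4 ^ k / (A * (n : ℝ) ^ 4)) := by field_simp
        _ ≤ A * ((n : ℝ) ^ 4 / 4 ^ k) * e t * (4 ^ k / (A * (n : ℝ) ^ 4)) := by gcongr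
        _ = e t := by field_simp
    calc u (t + 1) ≤ u t - e t / 25 := hu t
      _ ≤ u t - u t * (4 ^ k / (2 * A * (n : ℝ) ^ 4)) / 25 := by linarith
      _ = _ := by field_simp; ring
  set K := Nat.log 4 n with hK
  have hKn : 4 ^ K ≤ n := Nat.pow_log_le_self 4 (by omega)
  have hKn' : n < 4 ^ (K + 1) := Nat.lt_pow_succ_log_self (by norm_num) n
  set L : ℝ := (200 * A * (2 * d + 2) + 1) * (n : ℝ) ^ 4 with hL
  have hL0 : 0 ≤ L := by positivity
  set B : ℝ := 100 * d * A + 1 with hB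
  have hB0 : 0 ≤ B := by positivity
  have hbase : ∀ t : ℕ, L ≤ t → u t ≤ 4 * M * (4 ^ K) ^ d := by
    intro t ht
    have hθ : 1 ≤ 4 * M * ((4 : ℝ) ^ K) ^ d := by
      have : (1 : ℝ) ≤ ((4 : ℝ) ^ K) ^ d := one_le_pow₀ (one_le_pow₀ (by norm_num))
      nlinarith
    have hδ : (0 : ℝ) < 4 ^ K / (50 * A * (n : ℝ) ^ 4) := by positivity
    refine le_of_contraction (by linarith) hδ (Λ := (n : ℝ) ^ (2 * d + 2)) (s := 0)
      (one_le_pow₀ hn1) le_rfl hanti (hstep K hKn) (fun t _ => ?_) (le_trans ?_ ht)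
    · have : u t ≤ u 0 := antitone_nat_of_succ_le hanti (Nat.zero_le t)
      refine (this.trans hu0).trans (le_mul_of_one_le_right (by positivity) hθ)
    · have hlog : Real.log ((n : ℝ) ^ (2 * d + 2)) ≤ (2 * d + 2) * n := by
        rw [Real.log_pow]
        push_cast
        gcongr
        exact (Real.log_le_sub_one_of_pos hn0).trans (by linarith)
      have hnK : (n : ℝ) ≤ 4 * 4 ^ K := by
        have : (n : ℝ) < 4 ^ (K + 1) := by exact_mod_cast hKn'
        rw [pow_succ] at this; linarith
      have h1 : Real.log ((n : ℝ) ^ (2 * d + 2)) / (4 ^ K / (50 * A * (n : ℝ) ^ 4)) ≤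
          200 * A * (2 * d + 2) * (n : ℝ) ^ 4 := by
        rw [div_le_iff₀ hδ]
        calc Real.log ((n : ℝ) ^ (2 * d + 2)) ≤ (2 * d + 2) * n := hlog
          _ ≤ (2 * d + 2) * (4 * 4 ^ K) := by gcongr
          _ = _ := by field_simp; ring
      have h2 : (1 : ℝ) ≤ (n : ℝ) ^ 4 := one_le_pow₀ hn1
      rw [hL]
      linarith
  have hstage : ∀ k, k ≤ K → ∀ t : ℕ, L + 2 * B * ((n : ℝ) ^ 4 / 4 ^ k) ≤ t →
      u t ≤ 4 * M * (4 ^ k) ^ d := by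
    intro k hk
    induction hk using Nat.decreasingInduction with
    | self =>
      intro t ht
      exact hbase t (le_trans (le_add_of_nonneg_right (by positivity)) ht)
    | of_succ k hk ih =>
      intro t ht
      have hkn : 4 ^ k ≤ n := (Nat.pow_le_pow_right (by norm_num) hk.le).trans hKn
      have hkn' : (4 : ℝ) ^ k ≤ n := by exact_mod_cast hkn
      have hδ : (0 : ℝ) < 4 ^ k / (50 * A * (n : ℝ) ^ 4) := by positivity
      refine le_of_contraction (by positivity) hδ (Λ := 4 ^ d)
        (s := L + 2 * B * ((n : ℝ) ^ 4 / 4 ^ (k + 1))) (one_le_pow₀ (by norm_num)) (by positivity)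
        hanti (hstep k hkn) (fun t ht => (ih t ht).trans_eq ?_) (le_trans ?_ ht)
      · rw [pow_succ, mul_pow]; ring
      · have hlog : Real.log ((4 : ℝ) ^ d) ≤ d * 2 := by
          rw [Real.log_pow]
          gcongr
          have h4 : Real.log 4 = 2 * Real.log 2 := by
            rw [show (4 : ℝ) = 2 ^ 2 by norm_num, Real.log_pow]; norm_num
          linarith [Real.log_two_lt_d9]
        have h1 : Real.log ((4 : ℝ) ^ d) / (4 ^ k / (50 * A * (n : ℝ) ^ 4)) ≤
            100 * d * A * ((n : ℝ) ^ 4 / 4 ^ k) := by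
          rw [div_le_iff₀ hδ]
          refine hlog.trans_eq ?_
          field_simp; ring
        have h2 : 1 ≤ (n : ℝ) ^ 4 / 4 ^ k := by
          rw [one_le_div (by positivity)]
          exact hkn'.trans (le_self_pow₀ hn1 (by norm_num))
        have h3 : (n : ℝ) ^ 4 / 4 ^ (k + 1) = (n : ℝ) ^ 4 / 4 ^ k / 4 := by
          rw [pow_succ (4 : ℝ) k, div_div]
        rw [h3]
        have h4 : B * ((n : ℝ) ^ 4 / 4 ^ k) =
            100 * d * A * ((n : ℝ) ^ 4 / 4 ^ k) + (n : ℝ) ^ 4 / 4 ^ k := by rw [hB]; ring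
        have h5 : 0 ≤ B * ((n : ℝ) ^ 4 / 4 ^ k) := by positivity
        linarith
  have := hstage 0 (Nat.zero_le _) t (by
    refine le_trans (le_of_eq ?_) ht
    simp only [pow_zero, div_one]; ring)
  simpa using this

/-- Together with a Poincaré inequality, the bound of `le_of_nash` improves to exponential
convergence to `1`. -/
theorem sub_one_le_of_nash_of_poincare {n d : ℕ} {A P M : ℝ} {u e : ℕ → ℝ} (hn : 1 ≤ n)
    (hA : 1 ≤ A) (hP : 1 ≤ P) (hM : 1 ≤ M)
    (he : ∀ t, 0 ≤ e t) (hu : ∀ t, u (t + 1) ≤ u t - e t / 25)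
    (hnash : ∀ k, 4 ^ k ≤ n → ∀ t,
      u t ≤ A * ((n : ℝ) ^ 4 / 4 ^ k) * e t + 2 * M * (4 ^ k) ^ d)
    (hpoincare : ∀ t, u t - 1 ≤ P * (n : ℝ) ^ 4 * e t)
    (hu0 : u 0 ≤ (n : ℝ) ^ (2 * d + 2)) {t : ℕ}
    (ht : (200 * A * (2 * d + 2) + 1 + 2 * (100 * d * A + 1) +
      (25 * P * Real.log (4 * M * Real.exp 2) + 1)) * (n : ℝ) ^ 4 ≤ t) :
    u t - 1 ≤ Real.exp (-2) := by
  have hn1 : (1 : ℝ) ≤ n := by exact_mod_cast hn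
  have hn0 : (0 : ℝ) < n := by linarith
  have hP0 : 0 < P := by linarith
  have hA0 : 0 < A := by linarith
  have h4 : (1 : ℝ) ≤ (n : ℝ) ^ 4 := one_le_pow₀ hn1
  have hΛ : 1 ≤ 4 * M * Real.exp 2 := by
    have : 1 ≤ Real.exp 2 := Real.one_le_exp (by norm_num)
    nlinarith
  refine le_of_contraction (u := fun t => u t - 1) (δ := 1 / (25 * P * (n : ℝ) ^ 4))
    (Λ := 4 * M * Real.exp 2)
    (s := (200 * A * (2 * d + 2) + 1 + 2 * (100 * d * A + 1)) * (n : ℝ) ^ 4)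
    (Real.exp_pos _) (by positivity) hΛ (by positivity) (fun t => by linarith [hu t, he t])
    (fun t _ => ?_) (fun t ht => ?_) (le_trans ?_ ht)
  · have h1 : (u t - 1) * (1 / (P * (n : ℝ) ^ 4)) ≤ e t := by
      rw [mul_one_div, div_le_iff₀ (by positivity), mul_comm (e t)]
      exact hpoincare t
    calc u (t + 1) - 1 ≤ u t - 1 - e t / 25 := by linarith [hu t]
      _ ≤ u t - 1 - (u t - 1) * (1 / (P * (n : ℝ) ^ 4)) / 25 := by linarith
      _ = _ := by field_simp
  · rw [mul_assoc, ← Real.exp_add]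
    norm_num
    linarith [le_of_nash hn hA hM he hu hnash hu0 ht]
  · rw [div_div_eq_mul_div, div_one]
    nlinarith

end EnergyDecay

open Classical in
/-- **`d₂` mixing of `d` marked pieces and the empty square in time `O(n⁴)`.**  For every
`d ≥ 1` there are `C > 0` and `n₀ ≥ 3` such that for every `n ≥ n₀` and every `N ≥ C n⁴`,
the `d₂` distance to uniformity of the joint distribution of the `d` marked pieces and the
empty square, over the set `T_d` of `(d+1)`-tuples of pairwise distinct positions, is at
most `1/e`. -/
theorem marked_pieces_d2_mixing (d : ℕ) (hd : 1 ≤ d) :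
    ∃ C : ℝ, 0 < C ∧ ∃ n₀ : ℕ, 3 ≤ n₀ ∧ ∀ (n : ℕ) [NeZero n], n₀ ≤ n → ∀ N : ℕ,
      C * (n : ℝ) ^ 4 ≤ N →
      Real.sqrt ((Fintype.card {x : Fin (d + 1) → ZMod n × ZMod n // Function.Injective x} : ℝ) *
          ∑ x : {x : Fin (d + 1) → ZMod n × ZMod n // Function.Injective x},
            (markedDist n d N x.1 -
              1 / (Fintype.card {x : Fin (d + 1) → ZMod n × ZMod n // Function.Injective x} : ℝ)) ^ 2)
        ≤ (Real.exp 1)⁻¹ := by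
  classical
  set M := Conf.kernelConst d with hM
  have hM1 : 1 ≤ M := Conf.one_le_kernelConst d
  have hd1 : (1 : ℝ) ≤ d := by exact_mod_cast hd
  set A : ℝ := 2760 * d ^ 2 with hA
  have hA1 : 1 ≤ A := by nlinarith
  set P : ℝ := 2208 * d ^ 2 with hP
  have hP1 : 1 ≤ P := by nlinarith
  have hlog : 0 ≤ Real.log (4 * M * Real.exp 2) := by
    have : 1 ≤ Real.exp 2 := Real.one_le_exp (by norm_num)
    exact Real.log_nonneg (by nlinarith)
  refine ⟨200 * A * (2 * d + 2) + 1 + 2 * (100 * d * A + 1) +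
    (25 * P * Real.log (4 * M * Real.exp 2) + 1), by positivity,
    max (max 4 d) ⌈384 * M * d ^ 2⌉₊, by simp, fun n _ hn N hN => ?_⟩
  simp only [max_le_iff] at hn
  obtain ⟨⟨hn4, hdn⟩, hnM⟩ := hn
  have hnM' : 384 * M * d ^ 2 ≤ n := (Nat.le_ceil _).trans (by exact_mod_cast hnM)
  set T : ℝ := ((Fintype.card (Conf n d) : ℕ) : ℝ) with hT
  have hT0 : 0 ≤ T := Nat.cast_nonneg _
  set u : ℕ → ℝ := fun t => T * ∑ x, Conf.law n d t x ^ 2 with hu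
  set e : ℕ → ℝ := fun t => T * Conf.energy (Conf.law n d t) with he
  have hsum : ∀ t, ∑ x, Conf.law n d t x = 1 := Conf.sum_law (by omega) hdn
  have he0 : ∀ t, 0 ≤ e t := fun t => mul_nonneg hT0 (Conf.energy_nonneg _)
  have hstep : ∀ t, u (t + 1) ≤ u t - e t / 25 := by
    intro t
    have h := mul_le_mul_of_nonneg_left
      (Conf.sum_sq_average_le (by omega) (Conf.law n d t)) hT0
    simp only [← Conf.law_succ] at h
    calc u (t + 1) ≤ T * (∑ x, Conf.law n d t x ^ 2 - Conf.energy (Conf.law n d t) / 25) := h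
      _ = u t - e t / 25 := by simp only [hu, he]; ring
  have hnash : ∀ k, 4 ^ k ≤ n → ∀ t,
      u t ≤ A * ((n : ℝ) ^ 4 / 4 ^ k) * e t + 2 * M * (4 ^ k) ^ d := by
    intro k hk t
    have h := EnergyDecay.dyadic_nash (a := 552 * (d : ℝ) ^ 2) (M := M) (x := u t) (d := d)
      (by omega : 1 ≤ n) (by positivity) (by linarith) (he0 t) hk fun r hr0 hr =>
        Conf.nash hd (by omega) hr0 hr (Conf.law n d t) (Conf.law_nonneg t) (hsum t)
    refine h.trans_eq ?_
    rw [hA]; ring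
  have hvar : ∀ t, T * ∑ x, (Conf.law n d t x - 1 / T) ^ 2 = u t - 1 := fun t =>
    Conf.card_mul_sum_sub_sq (by omega) hdn _ (hsum t)
  have hTpos : 0 < T := by
    have := Conf.card_conf_pos (n := n) (by omega) hdn
    rw [hT]
    exact_mod_cast this
  have hpoincare : ∀ t, u t - 1 ≤ P * (n : ℝ) ^ 4 * e t := by
    intro t
    have h := Conf.poincare hd hn4 hnM' (fun x => Conf.law n d t x - 1 / T) (by
      rw [Finset.sum_sub_distrib, hsum, Finset.sum_const, Finset.card_univ, nsmul_eq_mul, ← hT,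
        mul_one_div_cancel hTpos.ne', sub_self])
    rw [Conf.energy_sub_const] at h
    rw [← hvar]
    refine (mul_le_mul_of_nonneg_left h hT0).trans_eq ?_
    simp only [hP, he]; ring
  have hu0 : u 0 ≤ (n : ℝ) ^ (2 * d + 2) := by
    have h1 : u 0 = T := by
      simp only [hu]
      rw [Conf.sum_sq_law_zero (by omega) hdn, mul_one]
    rw [h1, hT]
    have h2 := Conf.card_conf_le (n := n) hd
    have h3 := Conf.card_off_add_one (n := n)
    have h4 : Fintype.card (Conf n d) ≤ n ^ (2 * d + 2) := by
      rw [pow_add]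
      exact h2.trans (Nat.mul_le_mul_left _ (by omega))
    exact_mod_cast h4
  have hfinal : u N - 1 ≤ Real.exp (-2) :=
    EnergyDecay.sub_one_le_of_nash_of_poincare (by omega) hA1 hP1 hM1 he0 hstep hnash hpoincare
      hu0 hN
  rw [← hvar] at hfinal
  refine Real.sqrt_le_iff.mpr ⟨by positivity, ?_⟩
  have hexp : (Real.exp 1)⁻¹ ^ 2 = Real.exp (-2) := by
    rw [← Real.exp_neg, ← Real.exp_nat_mul]; norm_num
  rw [hexp]
  convert hfinal
  rfl
end

section
/- Fix d ≥ 1. For every ε > 0 there exists c₀ > 0 such that for all real c ≥ c₀, all integers n ≥ 2, and all integers M with 1 ≤ M ≤ exp(√(log n)), one has Σ_{a ∈ ((ℤ/nℤ)²)^{d+1}, a ≠ 0} λ_a^{c·(n/M)²} < ε, where the exponent denotes the real power of the nonnegative number λ_a. (These λ_a are the eigenvalues of the symmetrized auxiliary chain P_{d,M}, so this says Σ_{1≠λ∈σ(P_{d,M})} λ^{c(n/M)²} → 0 as c → ∞ uniformly in n.) -/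
/-- The Dirichlet kernel `D_N(x) = 1/(2N+1) · (1 + 2 Σ_{j=1}^N cos(2πjx))`. -/
noncomputable def dirichletKer (N : ℕ) (x : ℝ) : ℝ :=
  (1 / (2 * (N : ℝ) + 1)) * (1 + 2 * ∑ j ∈ Finset.Icc 1 N, Real.cos (2 * Real.pi * j * x))

/-- The eigenvalue `λ_a` of the symmetrized auxiliary chain `P_{d,M}` at the character
`a ∈ ((ℤ/nℤ)²)^{d+1}`: `λ_a = 1/2` if the last coordinate is nonzero, and otherwise
`λ_a = 1/2 + (1/2)·Π_{j=1}^d D_M(a_{j,1}/n)·D_M(a_{j,2}/n)`. -/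
noncomputable def lamEig (n M d : ℕ) (a : Fin (d + 1) → ZMod n × ZMod n) : ℝ :=
  if a (Fin.last d) ≠ 0 then 1 / 2
  else 1 / 2 + 1 / 2 * ∏ j : Fin d,
    dirichletKer M (((a j.castSucc).1.val : ℝ) / n) *
      dirichletKer M (((a j.castSucc).2.val : ℝ) / n)

theorem dirichletKer_mul_sin (N : ℕ) (x : ℝ) :
    dirichletKer N x * ((2 * N + 1) * Real.sin (Real.pi * x)) =
      Real.sin ((2 * N + 1) * (Real.pi * x)) := by
  have key : ∀ N : ℕ, (1 + 2 * ∑ j ∈ Finset.Icc 1 N, Real.cos (2 * Real.pi * j * x)) *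
      Real.sin (Real.pi * x) = Real.sin ((2 * N + 1) * (Real.pi * x)) := by
    intro N
    induction N with
    | zero => simp
    | succ k ih =>
      rw [Finset.sum_Icc_succ_top (by omega), mul_add, ← add_assoc, add_mul, ih]
      have h1 : (2 * (k : ℝ) + 1) * (Real.pi * x)
          = 2 * Real.pi * ((k + 1 : ℕ) : ℝ) * x - Real.pi * x := by push_cast; ring
      have h2 : (2 * ((k + 1 : ℕ) : ℝ) + 1) * (Real.pi * x)
          = 2 * Real.pi * ((k + 1 : ℕ) : ℝ) * x + Real.pi * x := by ring
      rw [h1, h2, Real.sin_add, Real.sin_sub]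
      ring
  rw [← key N, dirichletKer]
  have : (2 * (N : ℝ) + 1) ≠ 0 := by positivity
  generalize ∑ j ∈ Finset.Icc 1 N, Real.cos (2 * Real.pi * j * x) = S
  field_simp

theorem abs_dirichletKer_le_one (N : ℕ) (x : ℝ) : |dirichletKer N x| ≤ 1 := by
  have hpos : (0 : ℝ) < 2 * N + 1 := by positivity
  have h : |∑ j ∈ Finset.Icc 1 N, Real.cos (2 * Real.pi * j * x)| ≤ N :=
    calc _ ≤ ∑ j ∈ Finset.Icc 1 N, |Real.cos (2 * Real.pi * j * x)| :=
          Finset.abs_sum_le_sum_abs _ _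
      _ ≤ ∑ j ∈ Finset.Icc 1 N, (1 : ℝ) := Finset.sum_le_sum fun j _ => Real.abs_cos_le_one _
      _ = N := by simp
  rw [dirichletKer, abs_mul, abs_of_pos (by positivity : 0 < 1 / (2 * (N : ℝ) + 1)),
    one_div, inv_mul_le_iff₀ hpos, mul_one, abs_le]
  obtain ⟨h1, h2⟩ := abs_le.1 h
  constructor <;> linarith

theorem one_sub_dirichletKer (N : ℕ) (x : ℝ) :
    1 - dirichletKer N x =
      4 / (2 * N + 1) * ∑ j ∈ Finset.Icc 1 N, Real.sin (Real.pi * j * x) ^ 2 := by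
  have h : ∀ j : ℕ, Real.cos (2 * Real.pi * j * x) = 1 - 2 * Real.sin (Real.pi * j * x) ^ 2 := by
    intro j
    rw [show 2 * Real.pi * j * x = 2 * (Real.pi * j * x) by ring, Real.cos_two_mul,
      Real.cos_sq']
    ring
  have hpos : (2 * (N : ℝ) + 1) ≠ 0 := by positivity
  rw [dirichletKer]
  simp only [h, Finset.sum_sub_distrib, ← Finset.mul_sum]
  simp only [Finset.sum_const, Nat.card_Icc, Nat.add_sub_cancel, nsmul_eq_mul, mul_one]
  generalize ∑ j ∈ Finset.Icc 1 N, Real.sin (Real.pi * j * x) ^ 2 = S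
  field_simp
  ring

theorem sum_Icc_sq (N : ℕ) :
    ∑ j ∈ Finset.Icc 1 N, (j : ℝ) ^ 2 = N * (N + 1) * (2 * N + 1) / 6 := by
  induction N with
  | zero => simp
  | succ k ih =>
    rw [Finset.sum_Icc_succ_top (by omega), ih]
    push_cast
    ring

theorem two_mul_le_sin_pi_mul {x : ℝ} (hx : 0 ≤ x) (hx' : x ≤ 1 / 2) :
    2 * x ≤ Real.sin (Real.pi * x) := by
  have h := Real.mul_le_sin (x := Real.pi * x) (by positivity) (by nlinarith [Real.pi_pos])
  have : 2 / Real.pi * (Real.pi * x) = 2 * x := by field_simp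
  linarith

theorem abs_dirichletKer_le (N : ℕ) {x : ℝ} (hx : 0 ≤ x) (hx' : x ≤ 1 / 2) :
    |dirichletKer N x| ≤ 1 - min (1 / 2 : ℝ) (2 * (N * x) ^ 2 : ℝ) := by
  have hpos : (0 : ℝ) < 2 * N + 1 := by positivity
  have hid := dirichletKer_mul_sin N x
  have hsx := two_mul_le_sin_pi_mul hx hx'
  rcases le_or_gt 2 ((2 * N + 1) * Real.sin (Real.pi * x)) with h | h
  · refine le_trans ?_ (sub_le_sub_left (min_le_left _ _) 1)
    have h1 : |dirichletKer N x| * ((2 * N + 1) * Real.sin (Real.pi * x)) ≤ 1 := by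
      rw [← abs_of_nonneg (by linarith : 0 ≤ (2 * N + 1) * Real.sin (Real.pi * x)), ← abs_mul, hid]
      exact Real.abs_sin_le_one _
    nlinarith [abs_nonneg (dirichletKer N x)]
  · refine le_trans ?_ (sub_le_sub_left (min_le_right _ _) 1)
    have hNx : (2 * N + 1) * x < 1 := by nlinarith
    have hlow : 0 ≤ dirichletKer N x := by
      rcases hx.eq_or_lt with rfl | hx0
      · simp only [dirichletKer, mul_zero, Real.cos_zero]
        positivity
      · have hs : 0 < (2 * N + 1) * Real.sin (Real.pi * x) := by
          have : 0 < Real.sin (Real.pi * x) := by linarith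
          positivity
        have hs2 : 0 ≤ Real.sin ((2 * N + 1) * (Real.pi * x)) :=
          Real.sin_nonneg_of_nonneg_of_le_pi (by positivity) (by nlinarith [Real.pi_pos])
        rw [← hid] at hs2
        exact nonneg_of_mul_nonneg_left hs2 hs
    rw [abs_of_nonneg hlow]
    have hsum : ∑ j ∈ Finset.Icc 1 N, 4 * x ^ 2 * (j : ℝ) ^ 2 ≤
        ∑ j ∈ Finset.Icc 1 N, Real.sin (Real.pi * j * x) ^ 2 := by
      refine Finset.sum_le_sum fun j hj => ?_
      have hjN : (j : ℝ) ≤ N := by exact_mod_cast (Finset.mem_Icc.1 hj).2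
      have := two_mul_le_sin_pi_mul (x := j * x) (by positivity) (by nlinarith)
      rw [mul_assoc Real.pi, show 4 * x ^ 2 * (j : ℝ) ^ 2 = (2 * (j * x)) ^ 2 by ring]
      gcongr
    rw [← Finset.mul_sum, sum_Icc_sq] at hsum
    have h1 := one_sub_dirichletKer N x
    have h2 : 4 / (2 * N + 1) * (4 * x ^ 2 * (N * (N + 1) * (2 * N + 1) / 6)) ≤
        1 - dirichletKer N x := by
      rw [h1]
      gcongr
    have h3 : 4 / (2 * (N : ℝ) + 1) * (4 * x ^ 2 * (N * (N + 1) * (2 * N + 1) / 6)) =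
        8 / 3 * (x ^ 2 * (N * (N + 1))) := by
      field_simp
      ring
    have h4 : (0 : ℝ) ≤ x ^ 2 * N := by positivity
    nlinarith [sq_nonneg (N * x)]

theorem dirichletKer_val_div (N n : ℕ) [NeZero n] (z : ZMod n) :
    dirichletKer N ((z.val : ℝ) / n) = dirichletKer N ((z.valMinAbs.natAbs : ℝ) / n) := by
  have hn : (n : ℝ) ≠ 0 := NeZero.ne _
  have habs : ((z.valMinAbs.natAbs : ℝ)) = |(z.valMinAbs : ℝ)| := by
    rw [Nat.cast_natAbs, Int.cast_abs]
  unfold dirichletKer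
  congr 3
  refine Finset.sum_congr rfl fun j _ => ?_
  have h1 : Real.cos (2 * Real.pi * j * ((z.valMinAbs.natAbs : ℝ) / n)) =
      Real.cos (2 * Real.pi * j * ((z.valMinAbs : ℝ) / n)) := by
    rw [habs, ← Real.cos_abs (2 * Real.pi * j * ((z.valMinAbs : ℝ) / n)), abs_mul, abs_div,
      abs_of_nonneg (by positivity : 0 ≤ 2 * Real.pi * (j : ℝ)),
      abs_of_nonneg (by positivity : (0 : ℝ) ≤ n)]
  rw [h1, ZMod.valMinAbs_def_pos]
  split_ifs with h
  · simp
  · have : 2 * Real.pi * j * ((((z.val : ℤ) - n : ℤ) : ℝ) / n) =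
        2 * Real.pi * j * ((z.val : ℝ) / n) - (j : ℕ) * (2 * Real.pi) := by
      push_cast
      field_simp
    rw [this, Real.cos_sub_nat_mul_two_pi]

theorem two_mul_natAbs_valMinAbs_le {n : ℕ} [NeZero n] (z : ZMod n) :
    2 * (z.valMinAbs.natAbs : ℝ) ≤ n := by
  have h := ZMod.natAbs_valMinAbs_le z
  have : 2 * z.valMinAbs.natAbs ≤ n := by omega
  exact_mod_cast this

theorem abs_dirichletKer_val_div_le (N n : ℕ) [NeZero n] (z : ZMod n) :
    |dirichletKer N ((z.val : ℝ) / n)| ≤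
      1 - min (1 / 2 : ℝ) (2 * (N * (z.valMinAbs.natAbs / n : ℝ)) ^ 2) := by
  have hn : (0 : ℝ) < n := by exact_mod_cast Nat.pos_of_ne_zero (NeZero.ne n)
  rw [dirichletKer_val_div]
  apply abs_dirichletKer_le _ (by positivity)
  rw [div_le_iff₀ hn]
  linarith [two_mul_natAbs_valMinAbs_le z]

theorem abs_prod_dirichletKer_le_one {ι : Type*} (s : Finset ι) (N : ℕ) (x y : ι → ℝ) :
    |∏ j ∈ s, dirichletKer N (x j) * dirichletKer N (y j)| ≤ 1 := by
  rw [Finset.abs_prod]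
  refine Finset.prod_le_one (fun _ _ => abs_nonneg _) fun j _ => ?_
  rw [abs_mul]
  exact mul_le_one₀ (abs_dirichletKer_le_one _ _) (abs_nonneg _) (abs_dirichletKer_le_one _ _)

theorem abs_prod_dirichletKer_le {ι : Type*} [Fintype ι] [DecidableEq ι] (N : ℕ) (x y : ι → ℝ)
    (i : ι) :
    |∏ j, dirichletKer N (x j) * dirichletKer N (y j)| ≤
      min |dirichletKer N (x i)| |dirichletKer N (y i)| := by
  have h := abs_prod_dirichletKer_le_one (Finset.univ.erase i) N x y
  rw [← Finset.mul_prod_erase _ _ (Finset.mem_univ i), abs_mul, abs_mul]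
  have hx := abs_dirichletKer_le_one N (x i)
  have hy := abs_dirichletKer_le_one N (y i)
  have hx0 := abs_nonneg (dirichletKer N (x i))
  have hy0 := abs_nonneg (dirichletKer N (y i))
  refine le_trans (mul_le_of_le_one_right (mul_nonneg hx0 hy0) h) (le_min ?_ ?_)
  · exact mul_le_of_le_one_right hx0 hy
  · exact mul_le_of_le_one_left hy0 hx

theorem lamEig_nonneg (n M d : ℕ) (a : Fin (d + 1) → ZMod n × ZMod n) : 0 ≤ lamEig n M d a := by
  unfold lamEig
  split_ifs
  · norm_num
  · have := (abs_le.1 (abs_prod_dirichletKer_le_one Finset.univ M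
      (fun j : Fin d => ((a j.castSucc).1.val : ℝ) / n)
      (fun j : Fin d => ((a j.castSucc).2.val : ℝ) / n))).1
    linarith

theorem lamEig_le (n M d : ℕ) [NeZero n] (a : Fin (d + 1) → ZMod n × ZMod n) (i : Fin (d + 1)) :
    lamEig n M d a ≤ 1 - min (1 / 4 : ℝ) ((M * ((a i).1.valMinAbs.natAbs / n : ℝ)) ^ 2) ∧
    lamEig n M d a ≤ 1 - min (1 / 4 : ℝ) ((M * ((a i).2.valMinAbs.natAbs / n : ℝ)) ^ 2) := by
  have hmin : ∀ u : ℝ, min (1 / 2 : ℝ) (2 * u) = 2 * min (1 / 4 : ℝ) u := by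
    intro u
    rw [mul_min_of_nonneg _ _ (by norm_num)]
    norm_num
  unfold lamEig
  split_ifs with h
  · constructor <;> linarith [min_le_left (1 / 4 : ℝ) ((M * ((a i).1.valMinAbs.natAbs / n : ℝ)) ^ 2),
      min_le_left (1 / 4 : ℝ) ((M * ((a i).2.valMinAbs.natAbs / n : ℝ)) ^ 2)]
  · rw [not_not] at h
    induction i using Fin.lastCases with
    | last =>
      have := (abs_le.1 (abs_prod_dirichletKer_le_one Finset.univ M
        (fun j : Fin d => ((a j.castSucc).1.val : ℝ) / n)
        (fun j : Fin d => ((a j.castSucc).2.val : ℝ) / n))).2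
      simp only [h, Prod.fst_zero, Prod.snd_zero, ZMod.valMinAbs_zero, Int.natAbs_zero,
        Nat.cast_zero, zero_div, mul_zero, ne_eq, OfNat.ofNat_ne_zero,
        not_false_eq_true, zero_pow]
      have h0 : min (1 / 4 : ℝ) 0 = 0 := by norm_num
      constructor <;> linarith
    | cast i =>
      have h1 := abs_prod_dirichletKer_le M
        (fun j : Fin d => ((a j.castSucc).1.val : ℝ) / n)
        (fun j : Fin d => ((a j.castSucc).2.val : ℝ) / n) i
      have h2 := abs_dirichletKer_val_div_le M n (a i.castSucc).1
      have h3 := abs_dirichletKer_val_div_le M n (a i.castSucc).2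
      rw [hmin] at h2 h3
      have h4 := (le_abs_self _).trans (h1.trans (min_le_left _ _))
      have h5 := (le_abs_self _).trans (h1.trans (min_le_right _ _))
      constructor <;> linarith

theorem div_three_le_sq_div {n M : ℕ} (hn : 2 ≤ n) (hM : 1 ≤ M)
    (h : (M : ℝ) ≤ Real.exp (Real.sqrt (Real.log n))) :
    (n : ℝ) / 3 ≤ ((n : ℝ) / M) ^ 2 := by
  have hn0 : (0 : ℝ) < n := by positivity
  have hM0 : (0 : ℝ) < M := by positivity
  have hL : 0 ≤ Real.log n := Real.log_natCast_nonneg n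
  have hsq := Real.sq_sqrt hL
  have h1 : (M : ℝ) ^ 2 ≤ n * 3 :=
    calc (M : ℝ) ^ 2 ≤ Real.exp (Real.sqrt (Real.log n)) ^ 2 := by gcongr
      _ = Real.exp (2 * Real.sqrt (Real.log n)) := by rw [← Real.exp_nat_mul]; norm_num
      _ ≤ Real.exp (Real.log n + 1) := by
        gcongr
        nlinarith [sq_nonneg (Real.sqrt (Real.log n) - 1)]
      _ = n * Real.exp 1 := by rw [Real.exp_add, Real.exp_log hn0]
      _ ≤ n * 3 := by gcongr; exact Real.exp_one_lt_three.le
  rw [div_pow, le_div_iff₀ (by positivity)]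
  nlinarith

theorem rpow_le_exp_of_le_one_sub_min {l c : ℝ} {n M k : ℕ} (hl : 0 ≤ l) (hc : 0 ≤ c)
    (hn : 2 ≤ n) (hM : 1 ≤ M) (h : (M : ℝ) ≤ Real.exp (Real.sqrt (Real.log n)))
    (hk : 2 * (k : ℝ) ≤ n) (hlk : l ≤ 1 - min (1 / 4 : ℝ) ((M * (k / n : ℝ)) ^ 2)) :
    l ^ (c * ((n : ℝ) / M) ^ 2) ≤ Real.exp (-(c * k / 6)) := by
  have hn0 : (0 : ℝ) < n := by positivity
  have hM0 : (0 : ℝ) < M := by positivity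
  have ht := div_three_le_sq_div hn hM h
  have hle : l ≤ Real.exp (-min (1 / 4 : ℝ) ((M * (k / n : ℝ)) ^ 2)) := by
    have := Real.add_one_le_exp (-min (1 / 4 : ℝ) ((M * ((k : ℝ) / n)) ^ 2))
    linarith
  refine (Real.rpow_le_rpow hl hle (by positivity)).trans ?_
  rw [← Real.exp_mul, Real.exp_le_exp]
  have hmain : (k : ℝ) / 6 ≤ min (1 / 4 : ℝ) ((M * (k / n : ℝ)) ^ 2) * ((n : ℝ) / M) ^ 2 := by
    rw [min_mul_of_nonneg _ _ (by positivity)]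
    refine le_min (by linarith) ?_
    have h1 : (M * ((k : ℝ) / n)) ^ 2 * ((n : ℝ) / M) ^ 2 = k ^ 2 := by field_simp
    rw [h1]
    have h2 : (k : ℝ) ≤ k ^ 2 := by exact_mod_cast Nat.le_self_pow two_ne_zero k
    have h3 : (0 : ℝ) ≤ k := by positivity
    linarith
  nlinarith [mul_le_mul_of_nonneg_left hmain hc]

theorem summable_exp_neg_mul_natAbs {s : ℝ} (hs : 0 < s) :
    Summable fun k : ℤ => Real.exp (-(s * k.natAbs)) := by
  have h : Summable fun k : ℕ => Real.exp (-(s * k)) := by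
    have := Real.summable_exp_nat_mul_iff.2 (neg_lt_zero.2 hs)
    refine this.congr fun k => ?_
    congr 1
    ring
  exact Summable.of_nat_of_neg (by simpa using h) (by simpa using h)

theorem sum_exp_neg_mul_valMinAbs_le {s : ℝ} (hs : 0 < s) (n : ℕ) [NeZero n] :
    ∑ z : ZMod n, Real.exp (-(s * z.valMinAbs.natAbs)) ≤
      ∑' k : ℤ, Real.exp (-(s * k.natAbs)) := by
  have h := (summable_exp_neg_mul_natAbs hs).sum_le_tsum
    (Finset.univ.map ⟨ZMod.valMinAbs, ZMod.injective_valMinAbs (n := n)⟩)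
    (fun _ _ => (Real.exp_pos _).le)
  simpa using h

theorem lamEig_rpow_le {d n M : ℕ} [NeZero n] {c : ℝ} (hc : 1 ≤ c) (hn : 2 ≤ n) (hM : 1 ≤ M)
    (h : (M : ℝ) ≤ Real.exp (Real.sqrt (Real.log n))) {a : Fin (d + 1) → ZMod n × ZMod n}
    (ha : a ≠ 0) :
    lamEig n M d a ^ (c * ((n : ℝ) / M) ^ 2) ≤
      Real.exp (-(1 / (12 * (d + 1)) * (c - 1))) *
        ∏ i, Real.exp (-(1 / (12 * (d + 1)) *
          ((a i).1.valMinAbs.natAbs + (a i).2.valMinAbs.natAbs : ℝ))) := by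
  set p : Fin (d + 1) → ℝ :=
    fun i => (a i).1.valMinAbs.natAbs + (a i).2.valMinAbs.natAbs with hp
  set s : ℝ := 1 / (12 * (d + 1)) with hs
  have hs0 : 0 < s := by positivity
  obtain ⟨i, -, hi⟩ : ∃ i ∈ (Finset.univ : Finset (Fin (d + 1))),
      (∑ j, p j) / (d + 1) ≤ p i := by
    apply Finset.exists_le_of_sum_le Finset.univ_nonempty
    simp
    field_simp
    rfl
  have hS : 1 ≤ ∑ j, p j := by
    obtain ⟨i, hi⟩ := Function.ne_iff.1 ha
    have h1 : 1 ≤ p i := by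
      have : 1 ≤ (a i).1.valMinAbs.natAbs + (a i).2.valMinAbs.natAbs := by
        by_contra hcon
        apply hi
        have h1 : (a i).1.valMinAbs = 0 := by omega
        have h2 : (a i).2.valMinAbs = 0 := by omega
        rw [ZMod.valMinAbs_eq_zero] at h1 h2
        exact Prod.ext h1 h2
      simp only [hp]
      exact_mod_cast this
    exact h1.trans (Finset.single_le_sum (f := p) (fun j _ => by positivity) (Finset.mem_univ i))
  have hterm : lamEig n M d a ^ (c * ((n : ℝ) / M) ^ 2) ≤ Real.exp (-(c * p i / 12)) := by
    have h1 := rpow_le_exp_of_le_one_sub_min (lamEig_nonneg n M d a) (by linarith : 0 ≤ c) hn hM h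
      (two_mul_natAbs_valMinAbs_le (a i).1) (lamEig_le n M d a i).1
    have h2 := rpow_le_exp_of_le_one_sub_min (lamEig_nonneg n M d a) (by linarith : 0 ≤ c) hn hM h
      (two_mul_natAbs_valMinAbs_le (a i).2) (lamEig_le n M d a i).2
    rcases le_total ((a i).1.valMinAbs.natAbs : ℝ) ((a i).2.valMinAbs.natAbs) with hle | hle
    · refine h2.trans (Real.exp_le_exp.2 ?_)
      simp only [hp]
      nlinarith
    · refine h1.trans (Real.exp_le_exp.2 ?_)
      simp only [hp]
      nlinarith
  refine hterm.trans ?_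
  rw [← Real.exp_sum, ← Real.exp_add, Real.exp_le_exp, Finset.sum_neg_distrib, ← Finset.mul_sum]
  have h1 : s * ∑ j, p j ≤ p i / 12 := by
    have : s * ∑ j, p j = (∑ j, p j) / (d + 1) / 12 := by rw [hs]; field_simp
    linarith
  have h2 : s * (c - 1) + s * ∑ j, p j ≤ c * (s * ∑ j, p j) := by
    nlinarith [mul_nonneg hs0.le (mul_nonneg (sub_nonneg.2 hc) (sub_nonneg.2 hS))]
  have h3 := mul_le_mul_of_nonneg_left h1 (by linarith : 0 ≤ c)
  change -(c * p i / 12) ≤ -(s * (c - 1)) + -(s * ∑ j, p j)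
  linarith

/-- Fix `d ≥ 1`. For every `ε > 0` there is `c₀ > 0` such that for all real `c ≥ c₀`, all
`n ≥ 2` and all `1 ≤ M ≤ exp(√(log n))`, `Σ_{a ≠ 0} λ_a^{c(n/M)²} < ε`; i.e. the spectral
sum of `P_{d,M}` tends to `0` as `c → ∞`, uniformly in `n`. -/
theorem spectral_sum_P_d_M_tendsto_zero (d : ℕ) (hd : 1 ≤ d) :
    ∀ ε : ℝ, 0 < ε → ∃ c₀ : ℝ, 0 < c₀ ∧ ∀ c : ℝ, c₀ ≤ c →
      ∀ (n : ℕ) [NeZero n], 2 ≤ n → ∀ M : ℕ, 1 ≤ M →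
        (M : ℝ) ≤ Real.exp (Real.sqrt (Real.log n)) →
        (∑ a : Fin (d + 1) → ZMod n × ZMod n,
            if a ≠ 0 then lamEig n M d a ^ (c * ((n : ℝ) / (M : ℝ)) ^ 2) else 0) < ε := by
  intro ε hε
  set s : ℝ := 1 / (12 * (d + 1)) with hs
  have hs0 : 0 < s := by positivity
  set K : ℝ := ∑' k : ℤ, Real.exp (-(s * k.natAbs)) with hK
  have hK0 : 0 ≤ K := tsum_nonneg fun _ => (Real.exp_pos _).le
  set C : ℝ := (K * K) ^ (d + 1) with hC
  have hC0 : 0 ≤ C := by positivity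
  refine ⟨1 + C / (s * ε), by positivity, fun c hc n _ hn M hM h => ?_⟩
  have hc1 : 1 ≤ c := le_trans (by linarith [show 0 ≤ C / (s * ε) by positivity]) hc
  have hprod : ∑ a : Fin (d + 1) → ZMod n × ZMod n, ∏ i, Real.exp (-(s *
      ((a i).1.valMinAbs.natAbs + (a i).2.valMinAbs.natAbs : ℝ))) ≤ C := by
    rw [← Fintype.piFinset_univ, ← Finset.prod_univ_sum (fun _ : Fin (d + 1) => Finset.univ)
      (fun _ (z : ZMod n × ZMod n) =>
        Real.exp (-(s * (z.1.valMinAbs.natAbs + z.2.valMinAbs.natAbs : ℝ)))),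
      Finset.prod_const, Finset.card_univ, Fintype.card_fin]
    have hsplit : ∑ z : ZMod n × ZMod n,
        Real.exp (-(s * (z.1.valMinAbs.natAbs + z.2.valMinAbs.natAbs : ℝ))) =
        (∑ z : ZMod n, Real.exp (-(s * z.valMinAbs.natAbs))) *
          ∑ z : ZMod n, Real.exp (-(s * z.valMinAbs.natAbs)) := by
      rw [Finset.sum_mul_sum, Fintype.sum_prod_type]
      simp only [mul_add, neg_add, Real.exp_add]
    have hle := sum_exp_neg_mul_valMinAbs_le hs0 n
    rw [hsplit]
    exact pow_le_pow_left₀ (by positivity) (mul_le_mul hle hle (by positivity) hK0) _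
  calc _ ≤ ∑ a : Fin (d + 1) → ZMod n × ZMod n, Real.exp (-(s * (c - 1))) *
        ∏ i, Real.exp (-(s * ((a i).1.valMinAbs.natAbs + (a i).2.valMinAbs.natAbs : ℝ))) := by
        refine Finset.sum_le_sum fun a _ => ?_
        split_ifs with ha
        · exact lamEig_rpow_le hc1 hn hM h ha
        · positivity
    _ ≤ Real.exp (-(s * (c - 1))) * C := by
        rw [← Finset.mul_sum]
        gcongr
    _ < ε := by
        rw [Real.exp_neg, inv_mul_lt_iff₀ (Real.exp_pos _)]
        have h1 : C ≤ s * (c - 1) * ε := by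
          have : C / (s * ε) ≤ c - 1 := by linarith
          rw [div_le_iff₀ (by positivity)] at this
          linarith
        have h2 := Real.add_one_le_exp (s * (c - 1))
        nlinarith
end

section
/- There exist constants c, C > 0 such that for every n ≥ 3: every eigenvalue λ of the real symmetric matrix P'_n satisfies λ ≤ 1 − c/(n² log n), and P'_n has at least one eigenvalue λ with λ ≥ 1 − C/n². -/
/-- Transition matrix of `1/5`-lazy simple random walk on `(ℤ/nℤ)²`:
`P(x,y) = (1/5)·#{d ∈ {(0,0),(1,0),(−1,0),(0,1),(0,−1)} : y = x + d}`. -/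
noncomputable def lazySRW (n : ℕ) : Matrix (ZMod n × ZMod n) (ZMod n × ZMod n) ℝ :=
  fun x y => (1 / 5 : ℝ) *
    ((({((0 : ZMod n), (0 : ZMod n)), (1, 0), (-1, 0), (0, 1), (0, -1)} :
        Finset (ZMod n × ZMod n)).filter (fun d => y = x + d)).card : ℝ)

/-- The submatrix `P'ₙ` of `lazySRW n` obtained by deleting the row and column of `(0,0)`. -/
noncomputable def lazySRW' (n : ℕ) :
    Matrix {x : ZMod n × ZMod n // x ≠ 0} {x : ZMod n × ZMod n // x ≠ 0} ℝ :=
  fun x y => lazySRW n x.1 y.1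

open Finset

section Cone

/-- The mean of the `i`-th slice `{(i, 0), …, (i, i)}` of the triangular cone. -/
noncomputable def coneMean (g : ℕ → ℕ → ℝ) (i : ℕ) : ℝ :=
  (∑ j ∈ range (i + 1), g i j) / (i + 1)

theorem sum_range_succ_mul_sub (a : ℕ → ℝ) (m : ℕ) :
    ∑ j ∈ range m, ((j : ℝ) + 1) * (a (j + 1) - a j) = m * a m - ∑ j ∈ range m, a j := by
  induction m with
  | zero => simp
  | succ m ih => rw [sum_range_succ, ih, sum_range_succ]; push_cast; ring

theorem coneMean_succ_sub (g : ℕ → ℕ → ℝ) (i : ℕ) :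
    coneMean g (i + 1) - coneMean g i =
      ∑ j ∈ range (i + 1), (1 / ((i : ℝ) + 1) * (g (i + 1) j - g i j) +
        1 / (((i : ℝ) + 1) * (i + 2)) * (((j : ℝ) + 1) * (g (i + 1) (j + 1) - g (i + 1) j))) := by
  rw [sum_add_distrib, ← mul_sum, ← mul_sum, sum_range_succ_mul_sub (g (i + 1)), sum_sub_distrib,
    coneMean, coneMean, sum_range_succ _ (i + 1)]
  push_cast
  field_simp
  ring

theorem coneMean_succ_sub_sq_le (g : ℕ → ℕ → ℝ) (i : ℕ) :
    (coneMean g (i + 1) - coneMean g i) ^ 2 ≤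
      2 * ((i + 1 : ℕ) : ℝ)⁻¹ * ∑ j ∈ range (i + 1),
        ((g (i + 1) j - g i j) ^ 2 + (g (i + 1) (j + 1) - g (i + 1) j) ^ 2) := by
  rw [coneMean_succ_sub]
  refine sq_sum_le_card_mul_sum_sq.trans ?_
  rw [card_range, mul_sum, mul_sum]
  refine sum_le_sum fun j hj => ?_
  have hj' : (j : ℝ) + 1 ≤ i + 2 := by
    have : (j : ℝ) < i + 1 := by exact_mod_cast mem_range.1 hj
    linarith
  have hi : (0 : ℝ) < (i : ℝ) + 1 := by positivity
  set u := g (i + 1) j - g i j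
  set v := g (i + 1) (j + 1) - g (i + 1) j
  set t : ℝ := ((j : ℝ) + 1) / (i + 2) with ht
  have ht0 : 0 ≤ t := by positivity
  have ht1 : t ≤ 1 := by rw [ht, div_le_one (by positivity)]; exact hj'
  have hrw : 1 / ((i : ℝ) + 1) * u + 1 / (((i : ℝ) + 1) * (i + 2)) * (((j : ℝ) + 1) * v) =
      ((i : ℝ) + 1)⁻¹ * (u + t * v) := by
    rw [ht]; field_simp
  have hcancel : ((i : ℝ) + 1) * (((i : ℝ) + 1)⁻¹ * (u + t * v)) ^ 2 =
      ((i : ℝ) + 1)⁻¹ * (u + t * v) ^ 2 := by field_simp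
  push_cast
  rw [hrw, hcancel, mul_comm (2 : ℝ), mul_assoc]
  refine mul_le_mul_of_nonneg_left ?_ (by positivity)
  have : t ^ 2 * v ^ 2 ≤ 1 * v ^ 2 :=
    mul_le_mul_of_nonneg_right (pow_le_one₀ ht0 ht1) (sq_nonneg v)
  nlinarith [sq_nonneg (u - t * v)]

theorem coneMean_sub_sq_le (g : ℕ → ℕ → ℝ) (m : ℕ) :
    (coneMean g m - g 0 0) ^ 2 ≤ 2 * (1 + Real.log m) * ∑ i ∈ range m, ∑ j ∈ range (i + 1),
        ((g (i + 1) j - g i j) ^ 2 + (g (i + 1) (j + 1) - g (i + 1) j) ^ 2) := by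
  have h0 : coneMean g 0 = g 0 0 := by simp [coneMean]
  rw [← h0, ← sum_range_sub]
  refine (sum_sq_le_sum_mul_sum_of_sq_le_mul _ (fun i _ => by positivity)
    (fun i _ => sum_nonneg fun j _ => by positivity)
    (fun i _ => coneMean_succ_sub_sq_le g i)).trans ?_
  refine mul_le_mul_of_nonneg_right ?_
    (sum_nonneg fun i _ => sum_nonneg fun j _ => by positivity)
  rw [← mul_sum]
  have := harmonic_le_one_add_log m
  rw [harmonic] at this
  push_cast at this ⊢
  linarith

end Cone

theorem lazySRW_comm {n : ℕ} (x y : ZMod n × ZMod n) : lazySRW n x y = lazySRW n y x := by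
  simp only [lazySRW]
  congr 2
  refine card_bij' (fun d _ => -d) (fun d _ => -d) ?_ ?_ (fun d _ => neg_neg d)
    (fun d _ => neg_neg d)
  all_goals
    intro d hd
    simp only [mem_filter, mem_insert, mem_singleton] at hd ⊢
    obtain ⟨hd, h⟩ := hd
    refine ⟨?_, by rw [h, add_neg_cancel_right]⟩
    rcases hd with rfl | rfl | rfl | rfl | rfl <;> simp

theorem lazySRW'_isHermitian (n : ℕ) : (lazySRW' n).IsHermitian := by
  ext x y
  simp [lazySRW', lazySRW_comm x.1 y.1]

section Torus

variable {n : ℕ} [NeZero n]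

theorem ZMod.sum_range_add_natCast (φ : ZMod n → ℝ) (a : ZMod n) :
    ∑ i ∈ range n, φ (a + i) = ∑ w, φ w := by
  have h : ∑ i ∈ range n, φ (a + i) = ∑ w : ZMod n, φ (a + w) := by
    refine sum_bij' (fun i _ => (i : ZMod n)) (fun w _ => w.val) (fun _ _ => mem_univ _)
      (fun w _ => mem_range.2 w.val_lt) (fun i hi => ZMod.val_natCast_of_lt (mem_range.1 hi))
      (fun w _ => ZMod.natCast_zmod_val w) (fun _ _ => rfl)
  rw [h]
  exact Equiv.sum_comp (Equiv.addLeft a) φ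

theorem ZMod.sum_range_add_natCast_le {φ : ZMod n → ℝ} (hφ : ∀ w, 0 ≤ φ w) (a : ZMod n)
    {k : ℕ} (hk : k ≤ n) : ∑ i ∈ range k, φ (a + i) ≤ ∑ w, φ w := by
  rw [← ZMod.sum_range_add_natCast φ a]
  exact sum_le_sum_of_subset_of_nonneg (range_subset_range.2 hk) fun _ _ _ => hφ _

/-- The Dirichlet energy of a function on the discrete torus, each edge counted once. -/
noncomputable def torusEnergy (f : ZMod n × ZMod n → ℝ) : ℝ :=
  ∑ a, ∑ w, (f (a + 1, w) - f (a, w)) ^ 2 + ∑ a, ∑ w, (f (a, w + 1) - f (a, w)) ^ 2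

/-- The mean of `f` over the row with first coordinate `a`. -/
noncomputable def rowMean (f : ZMod n × ZMod n → ℝ) (a : ZMod n) : ℝ :=
  (∑ w, f (a, w)) / n

theorem rowMean_sub_sq_le (f : ZMod n × ZMod n → ℝ) (a b : ZMod n) :
    (rowMean f b - rowMean f a) ^ 2 ≤ torusEnergy f := by
  have hn : (0 : ℝ) < n := by exact_mod_cast Nat.pos_of_ne_zero (NeZero.ne n)
  have hstep (c : ZMod n) : (rowMean f (c + 1) - rowMean f c) ^ 2 ≤
      (n : ℝ)⁻¹ * ∑ w, (f (c + 1, w) - f (c, w)) ^ 2 := by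
    have h := sq_sum_le_card_mul_sum_sq (s := (univ : Finset (ZMod n)))
      (f := fun w => f (c + 1, w) - f (c, w))
    rw [card_univ, ZMod.card] at h
    rw [rowMean, rowMean, ← sub_div, ← sum_sub_distrib, div_pow, div_le_iff₀ (by positivity)]
    refine h.trans_eq ?_
    field_simp
  have hk : (b - a).val ≤ n := (ZMod.val_lt _).le
  have htel : rowMean f b - rowMean f a =
      ∑ i ∈ range (b - a).val, (rowMean f (a + i + 1) - rowMean f (a + i)) := by
    have := sum_range_sub (fun i : ℕ => rowMean f (a + i)) (b - a).val
    simp only [Nat.cast_add, Nat.cast_one, Nat.cast_zero, add_zero, ZMod.natCast_zmod_val,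
      add_sub_cancel, ← add_assoc] at this
    exact this.symm
  have hV : 0 ≤ ∑ c : ZMod n, ∑ w, (f (c, w + 1) - f (c, w)) ^ 2 :=
    sum_nonneg fun _ _ => sum_nonneg fun _ _ => sq_nonneg _
  calc (rowMean f b - rowMean f a) ^ 2
      ≤ ((b - a).val : ℝ) *
          ∑ i ∈ range (b - a).val, (rowMean f (a + i + 1) - rowMean f (a + i)) ^ 2 := by
        rw [htel]
        simpa using sq_sum_le_card_mul_sum_sq (s := range (b - a).val)
          (f := fun i : ℕ => rowMean f (a + i + 1) - rowMean f (a + i))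
    _ ≤ n * ∑ c, (rowMean f (c + 1) - rowMean f c) ^ 2 := by
        refine mul_le_mul (by exact_mod_cast hk) ?_ (sum_nonneg fun _ _ => sq_nonneg _) hn.le
        exact ZMod.sum_range_add_natCast_le
          (φ := fun c => (rowMean f (c + 1) - rowMean f c) ^ 2) (fun _ => sq_nonneg _) a hk
    _ ≤ n * ∑ c : ZMod n, (n : ℝ)⁻¹ * ∑ w, (f (c + 1, w) - f (c, w)) ^ 2 :=
        mul_le_mul_of_nonneg_left (sum_le_sum fun c _ => hstep c) hn.le
    _ = ∑ c, ∑ w, (f (c + 1, w) - f (c, w)) ^ 2 := by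
        rw [← mul_sum, mul_inv_cancel_left₀ hn.ne']
    _ ≤ torusEnergy f := le_add_of_nonneg_right hV

theorem rowMean_sub_apply_sq_le (f : ZMod n × ZMod n → ℝ) (x : ZMod n × ZMod n) :
    (rowMean f (x.1 - 1) - f x) ^ 2 ≤ 2 * (1 + Real.log n) * torusEnergy f := by
  obtain ⟨m, rfl⟩ := Nat.exists_eq_succ_of_ne_zero (NeZero.ne n)
  set g : ℕ → ℕ → ℝ := fun i j => f (x.1 + i, x.2 + j) with hg
  have hm : ((m : ℕ) : ZMod (m + 1)) = -1 := by
    rw [eq_neg_iff_add_eq_zero]; exact_mod_cast ZMod.natCast_self (m + 1)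
  have hmean : coneMean g m = rowMean f (x.1 - 1) := by
    rw [coneMean, rowMean, hg]
    simp only [hm, ← sub_eq_add_neg]
    rw [ZMod.sum_range_add_natCast (fun w => f (x.1 - 1, w)) x.2]
    push_cast
    rfl
  have h00 : g 0 0 = f x := by simp [hg]
  rw [← hmean, ← h00]
  refine (coneMean_sub_sq_le g m).trans ?_
  have hlog : Real.log m ≤ Real.log (m + 1 : ℕ) := by
    rcases Nat.eq_zero_or_pos m with rfl | h
    · simp
    · exact Real.log_le_log (by exact_mod_cast h) (by push_cast; linarith)
  have hlog0 : 0 ≤ Real.log (m + 1 : ℕ) := Real.log_natCast_nonneg _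
  refine mul_le_mul (by linarith) ?_
    (sum_nonneg fun i _ => sum_nonneg fun j _ => by positivity) (by positivity)
  simp only [sum_add_distrib]
  refine add_le_add ?_ ?_
  · refine le_trans (sum_le_sum fun i hi => ?_) (ZMod.sum_range_add_natCast_le
      (φ := fun a => ∑ w, (f (a + 1, w) - f (a, w)) ^ 2)
      (fun _ => sum_nonneg fun _ _ => sq_nonneg _) x.1 m.le_succ)
    have := ZMod.sum_range_add_natCast_le
      (φ := fun w => (f (x.1 + i + 1, w) - f (x.1 + i, w)) ^ 2) (fun _ => sq_nonneg _) x.2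
      (show i + 1 ≤ m + 1 by have := mem_range.1 hi; omega)
    simpa only [hg, Nat.cast_add, Nat.cast_one, ← add_assoc] using this
  · refine le_trans (sum_le_sum fun i hi => ?_) (ZMod.sum_range_add_natCast_le
      (φ := fun a => ∑ w, (f (a, w + 1) - f (a, w)) ^ 2)
      (fun _ => sum_nonneg fun _ _ => sq_nonneg _) (x.1 + 1) m.le_succ)
    have := ZMod.sum_range_add_natCast_le
      (φ := fun w => (f (x.1 + 1 + i, w + 1) - f (x.1 + 1 + i, w)) ^ 2) (fun _ => sq_nonneg _) x.2
      (show i + 1 ≤ m + 1 by have := mem_range.1 hi; omega)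
    simpa only [hg, Nat.cast_add, Nat.cast_one, ← add_assoc, add_right_comm x.1 (1 : ZMod _)]
      using this

theorem one_le_log_natCast {n : ℕ} (hn : 3 ≤ n) : 1 ≤ Real.log n := by
  have h3 : (3 : ℝ) ≤ n := by exact_mod_cast hn
  rw [Real.le_log_iff_exp_le (by linarith)]
  linarith [Real.exp_one_lt_three]

theorem torus_sub_sq_le (hn : 3 ≤ n) (f : ZMod n × ZMod n → ℝ) (x y : ZMod n × ZMod n) :
    (f x - f y) ^ 2 ≤ 27 * Real.log n * torusEnergy f := by
  have hE : 0 ≤ torusEnergy f := (sq_nonneg _).trans (rowMean_sub_sq_le f 0 0)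
  have hlog := mul_le_mul_of_nonneg_right (one_le_log_natCast hn) hE
  have hx := rowMean_sub_apply_sq_le f x
  have hy := rowMean_sub_apply_sq_le f y
  have hxy := rowMean_sub_sq_le f (y.1 - 1) (x.1 - 1)
  set p := rowMean f (x.1 - 1)
  set q := rowMean f (y.1 - 1)
  have hsq : (f x - f y) ^ 2 ≤ 3 * ((p - f x) ^ 2 + (p - q) ^ 2 + (q - f y) ^ 2) := by
    nlinarith [sq_nonneg ((p - f x) + (p - q)), sq_nonneg ((p - q) - (q - f y)),
      sq_nonneg ((p - f x) + (q - f y))]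
  linarith

/-- Poincaré inequality on the torus with a Dirichlet condition at the origin. -/
theorem torus_sum_sq_le (hn : 3 ≤ n) (f : ZMod n × ZMod n → ℝ) (hf : f 0 = 0) :
    ∑ x, f x ^ 2 ≤ 27 * ((n : ℝ) ^ 2 * Real.log n) * torusEnergy f := by
  have h := sum_le_card_nsmul univ (fun x => f x ^ 2) (27 * Real.log n * torusEnergy f)
    fun x _ => by simpa [hf] using torus_sub_sq_le hn f x 0
  rw [card_univ, Fintype.card_prod, ZMod.card, nsmul_eq_mul] at h
  push_cast at h
  linarith

theorem sum_lazySRW_mul (hn : 3 ≤ n) (f : ZMod n × ZMod n → ℝ) (x : ZMod n × ZMod n) :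
    ∑ y, lazySRW n x y * f y = 1 / 5 * (f x + f (x + (1, 0)) + f (x + (-1, 0)) +
      f (x + (0, 1)) + f (x + (0, -1))) := by
  have h1 : (1 : ZMod n) ≠ 0 := by
    intro h
    have := (ZMod.natCast_eq_zero_iff 1 n).1 (by exact_mod_cast h)
    exact absurd (Nat.le_of_dvd one_pos this) (by omega)
  have h2 : (1 : ZMod n) ≠ -1 := by
    intro h
    rw [eq_neg_iff_add_eq_zero] at h
    have := (ZMod.natCast_eq_zero_iff 2 n).1 (by rw [← h]; norm_num)
    exact absurd (Nat.le_of_dvd two_pos this) (by omega)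
  simp only [lazySRW, card_filter, mul_assoc, ← mul_sum]
  congr 1
  push_cast
  simp only [sum_mul, ite_mul, one_mul, zero_mul]
  rw [sum_comm]
  simp only [sum_ite_eq', mem_univ, if_true]
  rw [sum_insert, sum_insert, sum_insert, sum_insert, sum_singleton, Prod.mk_zero_zero, add_zero]
  · ring
  all_goals simp [h1, h1.symm, h2]


theorem lazySRW'_mulVec (hn : 3 ≤ n) {f : ZMod n × ZMod n → ℝ} (hf : f 0 = 0)
    (x : {x : ZMod n × ZMod n // x ≠ 0}) :
    (lazySRW' n).mulVec (fun y => f y) x = 1 / 5 * (f x.1 + f (x.1 + (1, 0)) + f (x.1 + (-1, 0)) +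
      f (x.1 + (0, 1)) + f (x.1 + (0, -1))) := by
  rw [← sum_lazySRW_mul hn f x.1, ← sum_filter_of_ne (p := fun y => y ≠ 0)
    (fun y _ hy h => hy (by rw [h, hf, mul_zero]))]
  exact (sum_subtype (p := fun y => y ≠ 0) _ (fun y => by rw [mem_filter_univ])
    fun y => lazySRW n x y * f y).symm

theorem sum_mul_lazySRW (f : ZMod n × ZMod n → ℝ) :
    ∑ x, f x * (1 / 5 * (f x + f (x + (1, 0)) + f (x + (-1, 0)) +
      f (x + (0, 1)) + f (x + (0, -1)))) = ∑ x, f x ^ 2 - 1 / 5 * torusEnergy f := by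
  have hshift (d : ZMod n × ZMod n) (g : ZMod n × ZMod n → ℝ) : ∑ x, g (x + d) = ∑ x, g x :=
    Equiv.sum_comp (Equiv.addRight d) g
  have hback (d : ZMod n × ZMod n) : ∑ x, f x * f (x + -d) = ∑ x, f x * f (x + d) := by
    rw [← hshift d]
    exact sum_congr rfl fun x _ => by rw [add_neg_cancel_right, mul_comm]
  have henergy (d : ZMod n × ZMod n) :
      ∑ x, (f (x + d) - f x) ^ 2 = 2 * ∑ x, f x ^ 2 - 2 * ∑ x, f x * f (x + d) := by
    have : ∑ x, (f (x + d) - f x) ^ 2 =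
        ∑ x, f (x + d) ^ 2 + ∑ x, f x ^ 2 - 2 * ∑ x, f x * f (x + d) := by
      rw [mul_sum, ← sum_add_distrib, ← sum_sub_distrib]
      exact sum_congr rfl fun x _ => by ring
    rw [this, hshift d fun x => f x ^ 2]
    ring
  have hE : torusEnergy f =
      ∑ x, (f (x + (1, 0)) - f x) ^ 2 + ∑ x, (f (x + (0, 1)) - f x) ^ 2 := by
    simp [torusEnergy, Fintype.sum_prod_type]
  have h1 := hback (1, 0)
  have h2 := hback (0, 1)
  simp only [Prod.neg_mk, neg_zero] at h1 h2
  have hexp : ∑ x, f x * (1 / 5 * (f x + f (x + (1, 0)) + f (x + (-1, 0)) +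
      f (x + (0, 1)) + f (x + (0, -1)))) = 1 / 5 * (∑ x, f x ^ 2 + ∑ x, f x * f (x + (1, 0)) +
      ∑ x, f x * f (x + (-1, 0)) + ∑ x, f x * f (x + (0, 1)) + ∑ x, f x * f (x + (0, -1))) := by
    rw [← sum_add_distrib, ← sum_add_distrib, ← sum_add_distrib, ← sum_add_distrib, mul_sum]
    exact sum_congr rfl fun x _ => by ring
  rw [hexp, hE, henergy, henergy, h1, h2]
  ring

theorem le_of_mem_spectrum_lazySRW' (hn : 3 ≤ n) {lam : ℝ} (hlam : lam ∈ spectrum ℝ (lazySRW' n)) :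
    lam ≤ 1 - 1 / 135 / ((n : ℝ) ^ 2 * Real.log n) := by
  rw [← Matrix.spectrum_toLin', ← Module.End.hasEigenvalue_iff_mem_spectrum] at hlam
  obtain ⟨v, hv⟩ := hlam.exists_hasEigenvector
  have hv0 : v ≠ 0 := hv.2
  have hev : (lazySRW' n).mulVec v = lam • v := by simpa using hv.apply_eq_smul
  set f : ZMod n × ZMod n → ℝ := fun x => if h : x ≠ 0 then v ⟨x, h⟩ else 0 with hfdef
  have hf : f 0 = 0 := by simp [hfdef]
  have hfv : (fun y : {x : ZMod n × ZMod n // x ≠ 0} => f y) = v := by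
    ext y
    simp [hfdef, y.2]
  have hquad := sum_mul_lazySRW f
  have hlamf : ∑ x, f x * (1 / 5 * (f x + f (x + (1, 0)) + f (x + (-1, 0)) +
      f (x + (0, 1)) + f (x + (0, -1)))) = lam * ∑ x, f x ^ 2 := by
    rw [mul_sum]
    refine sum_congr rfl fun x _ => ?_
    by_cases hx : x = 0
    · rw [hx, hf]; ring
    · rw [← lazySRW'_mulVec hn hf ⟨x, hx⟩, hfv, hev, ← hfv]
      simp only [Pi.smul_apply, smul_eq_mul]
      ring
  have hpos : 0 < ∑ x, f x ^ 2 := by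
    obtain ⟨y, hy⟩ := Function.ne_iff.1 hv0
    refine sum_pos' (fun _ _ => sq_nonneg _) ⟨y.1, mem_univ _, ?_⟩
    have : f y = v y := congrFun hfv y
    rw [this]
    exact sq_pos_of_ne_zero hy
  have hP := torus_sum_sq_le hn f hf
  have hK : 0 < (n : ℝ) ^ 2 * Real.log n := by
    have := one_le_log_natCast hn
    have : (0 : ℝ) < n := by exact_mod_cast (by omega : 0 < n)
    positivity
  set K := (n : ℝ) ^ 2 * Real.log n
  have hE : torusEnergy f = 5 * (1 - lam) * ∑ x, f x ^ 2 := by linarith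
  rw [hE] at hP
  have h1 : 1 ≤ 135 * K * (1 - lam) := by
    by_contra! h
    nlinarith [mul_lt_mul_of_pos_right h hpos]
  have h2 : 1 / 135 / K ≤ 1 - lam := by
    rw [div_le_iff₀ hK]; linarith
  linarith

theorem sin_val_add_sin_val {a : ZMod n} (ha : a ≠ 0) :
    Real.sin (Real.pi * (a + 1).val / n) + Real.sin (Real.pi * (a + -1).val / n) =
      2 * Real.cos (Real.pi / n) * Real.sin (Real.pi * a.val / n) := by
  have hn : (n : ℝ) ≠ 0 := by exact_mod_cast NeZero.ne n
  obtain ⟨m, hm⟩ := Nat.exists_eq_succ_of_ne_zero ((ZMod.val_ne_zero a).2 ha)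
  have hlt : m + 1 < n := by
    have := a.val_lt
    omega
  have hcast : a = ((m + 1 : ℕ) : ZMod n) := by rw [← Nat.succ_eq_add_one, ← hm]; simp
  have hpred : (a + -1).val = m := by
    rw [hcast]; push_cast
    rw [add_neg_cancel_right, ZMod.val_natCast_of_lt (by omega)]
  have hsucc : Real.sin (Real.pi * (a + 1).val / n) = Real.sin (Real.pi * (m + 2 : ℕ) / n) := by
    have hcast' : a + 1 = ((m + 2 : ℕ) : ZMod n) := by rw [hcast]; push_cast; ring
    rw [hcast']
    rcases (show m + 2 ≤ n from hlt).lt_or_eq with h | h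
    · rw [ZMod.val_natCast_of_lt h]
    · rw [h, ZMod.natCast_self, ZMod.val_zero, mul_div_cancel_right₀ _ hn]
      simp
  rw [hsucc, hpred, hm]
  have e1 : Real.pi * (m + 2 : ℕ) / n = Real.pi * (m.succ : ℕ) / n + Real.pi / n := by
    push_cast; field_simp; ring
  have e2 : Real.pi * (m : ℕ) / n = Real.pi * (m.succ : ℕ) / n - Real.pi / n := by
    push_cast; field_simp; ring
  rw [e1, e2, Real.sin_add, Real.sin_sub]
  ring

theorem exists_mem_spectrum_lazySRW'_ge (hn : 3 ≤ n) :
    ∃ lam ∈ spectrum ℝ (lazySRW' n), 1 - Real.pi ^ 2 / 5 / (n : ℝ) ^ 2 ≤ lam := by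
  by_contra! hlt
  set θ : ℝ := 1 - Real.pi ^ 2 / 5 / (n : ℝ) ^ 2 with hθ
  set f : ZMod n × ZMod n → ℝ := fun x => Real.sin (Real.pi * x.1.val / n) with hfdef
  set v : {x : ZMod n × ZMod n // x ≠ 0} → ℝ := fun x => f x with hv
  have hf : f 0 = 0 := by simp [hfdef]
  have hn0 : (0 : ℝ) < n := by exact_mod_cast (by omega : 0 < n)
  have hherm : (algebraMap ℝ (Matrix _ _ ℝ) θ - lazySRW' n).IsHermitian := by
    refine Matrix.IsHermitian.sub ?_ (lazySRW'_isHermitian n)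
    rw [Matrix.algebraMap_eq_diagonal]
    exact Matrix.isHermitian_diagonal _
  have hpd : (algebraMap ℝ (Matrix _ _ ℝ) θ - lazySRW' n).PosDef := by
    rw [hherm.posDef_iff_eigenvalues_pos]
    intro i
    have hi : hherm.eigenvalues i ∈ spectrum ℝ (algebraMap ℝ (Matrix _ _ ℝ) θ - lazySRW' n) := by
      rw [hherm.spectrum_real_eq_range_eigenvalues]
      exact ⟨i, rfl⟩
    rw [← spectrum.singleton_sub_eq, Set.singleton_sub] at hi
    obtain ⟨μ, hμ, hμi⟩ := hi
    have := hlt μ hμ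
    simp only at hμi
    linarith
  have hne : v ≠ 0 := by
    have : Fact (1 < n) := ⟨by omega⟩
    have h10 : ((1, 0) : ZMod n × ZMod n) ≠ 0 := by simp [Prod.ext_iff]
    intro h
    have h1 : f (1, 0) = 0 := congrFun h ⟨(1, 0), h10⟩
    have : 0 < f (1, 0) := by
      simp only [hfdef, ZMod.val_one]
      refine Real.sin_pos_of_pos_of_lt_pi (by positivity) ?_
      rw [div_lt_iff₀ hn0]
      have : (3 : ℝ) ≤ n := by exact_mod_cast hn
      push_cast
      nlinarith [Real.pi_pos]
    linarith
  have hq := hpd.dotProduct_mulVec_pos hne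
  refine absurd hq (not_lt.2 (sum_nonpos fun x _ => ?_))
  have hmul : (lazySRW' n).mulVec v x = 1 / 5 * (f x + f (x.1 + (1, 0)) + f (x.1 + (-1, 0)) +
      f (x.1 + (0, 1)) + f (x.1 + (0, -1))) := lazySRW'_mulVec hn hf x
  rw [Matrix.sub_mulVec, Algebra.algebraMap_eq_smul_one, Matrix.smul_mulVec, Matrix.one_mulVec,
    Pi.sub_apply, hmul]
  simp only [Pi.star_apply, star_trivial, Pi.smul_apply, smul_eq_mul]
  rw [show v x = f x from rfl]
  by_cases hx : x.1.1 = 0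
  · have : f x = 0 := by simp [hfdef, hx]
    rw [this, zero_mul]
  · have hs := sin_val_add_sin_val hx
    have e3 : f (x.1 + (0, 1)) = f x := by simp [hfdef]
    have e4 : f (x.1 + (0, -1)) = f x := by simp [hfdef]
    have e12 : f (x.1 + (1, 0)) + f (x.1 + (-1, 0)) = 2 * Real.cos (Real.pi / n) * f x := by
      simpa [hfdef] using hs
    have hcos := Real.one_sub_sq_div_two_le_cos (x := Real.pi / n)
    have hθ' : θ ≤ (3 + 2 * Real.cos (Real.pi / n)) / 5 := by
      have : Real.pi ^ 2 / 5 / (n : ℝ) ^ 2 = (Real.pi / n) ^ 2 / 5 := by rw [div_pow]; ring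
      rw [hθ, this]
      linarith
    rw [e3, e4, add_assoc (f x.1) (f (x.1 + (1, 0))), e12]
    nlinarith [mul_le_mul_of_nonneg_right hθ' (sq_nonneg (f x))]

end Torus

/-- There are constants `c, C > 0` such that for every `n ≥ 3`: every eigenvalue `λ` of the
real symmetric matrix `P'ₙ` satisfies `λ ≤ 1 − c/(n² log n)`, and `P'ₙ` has at least one
eigenvalue `λ ≥ 1 − C/n²`. -/
theorem lazySRW'_spectrum_bounds :
    ∃ c C : ℝ, 0 < c ∧ 0 < C ∧ ∀ (n : ℕ) [NeZero n], 3 ≤ n →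
      (∀ lam ∈ spectrum ℝ (lazySRW' n), lam ≤ 1 - c / ((n : ℝ) ^ 2 * Real.log n)) ∧
      (∃ lam ∈ spectrum ℝ (lazySRW' n), 1 - C / (n : ℝ) ^ 2 ≤ lam) := by
  refine ⟨1 / 135, Real.pi ^ 2 / 5, by norm_num, by positivity, fun n _ hn =>
    ⟨fun lam hlam => ?_, ?_⟩⟩
  · exact le_of_mem_spectrum_lazySRW' hn hlam
  · exact exists_mem_spectrum_lazySRW'_ge hn
end
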